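/- Suppose (a,b,c) satisfies the parabolicity–regularity assumption with respect to some ρ ≥ 2, and set r = ρ − 2. Then there exists K ∈ ℕ, depending only on d and r, such that for every T > 0 and all multi-indices j_1, j_2 ∈ ℕ^{1+d} with |j_1|_s + |j_2|_s ≤ r one has Σ_{k≥K} sup_{x,y∈ℝ^d} sup_{|t−s|≤T} |∂_1^{j_1}∂_2^{j_2}(Z*(−E)^{*k})((t,x),(s,y))| < ∞; consequently the tail Σ_{k≥K} Z*(−E)^{*k} converges in C_{loc,t}^r, and the full series Σ_{k≥0} Z*(−E)^{*k}, together with all its parabolic derivatives of order at most r, converges uniformly on compact subsets of {((t,x),(s,y)) : t ≠ s}. Moreover the map A_ρ ∋ (a,b,c) ↦ Σ_{k≥K} Z*(−E)^{*k} ∈ C_{loc,t}^r is continuous. -/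

import Mathlib

open MeasureTheory Filter
open scoped BigOperators ENNReal

namespace VarBPHZ

/-! ## Basic parabolic setting on `ℝ^{1+d}` -/

/-- A space-time point in `ℝ^{1+d}`; coordinate `0` is time, coordinates `1, …, d` are space. -/
abbrev Pt (d : ℕ) := Fin (d + 1) → ℝ

variable {d : ℕ}

/-- Parabolic scaled degree `|k|_𝔰 = 2k₀ + k₁ + ⋯ + k_d` of a multi-index. -/
def pdeg (k : Fin (d + 1) → ℕ) : ℕ := k 0 + ∑ i, k i

/-- Parabolic norm `|z|_𝔰 = |t|^{1/2} + ∑ᵢ |xᵢ|`. -/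
noncomputable def pnorm (z : Pt d) : ℝ := Real.sqrt |z 0| + ∑ i : Fin d, |z i.succ|

/-- First-order partial derivative in the `i`-th coordinate. -/
noncomputable def pd (i : Fin (d + 1)) (f : Pt d → ℝ) : Pt d → ℝ :=
  fun z => fderiv ℝ f z (Pi.single i 1)

/-- Iterated partial derivative `∂^k` for a multi-index `k`. -/
noncomputable def mderiv (k : Fin (d + 1) → ℕ) (f : Pt d → ℝ) : Pt d → ℝ :=
  (List.finRange (d + 1)).foldr (fun i g => (pd i)^[k i] g) f

/-- Mixed partial derivative `∂₁^j ∂₂^m` of a two-argument kernel. -/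
noncomputable def mderiv2 (j m : Fin (d + 1) → ℕ) (F : Pt d → Pt d → ℝ) :
    Pt d → Pt d → ℝ :=
  fun z zb => mderiv j (fun z' => mderiv m (F z') zb) z

/-- Space-time convolution `u * v (z, z̄) = ∫ u(z, ζ) v(ζ, z̄) dζ`. -/
noncomputable def conv (u v : Pt d → Pt d → ℝ) : Pt d → Pt d → ℝ :=
  fun z zb => ∫ ζ : Pt d, u z ζ * v ζ zb

/-! ## The heat calculus spaces `Ψ_r^α` and `Φ_r^α` -/

/-- `Ft` is an `F̃`-representation of `F` for the space `Ψ_r^α`; the second argument of `Ft`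
packs `(u, v) ∈ ℝ × ℝ^d` as an element of `ℝ^{1+d}`. -/
def PsiRep (α : ℝ) (Ft : Pt d → Pt d → ℝ) (F : Pt d → Pt d → ℝ) : Prop :=
  ∀ z zb : Pt d, F z zb =
    if zb 0 < z 0 then
      (z 0 - zb 0) ^ ((α - d - 2) / 2) *
        Ft zb (Fin.cons (Real.sqrt (z 0 - zb 0))
          fun i : Fin d => (z i.succ - zb i.succ) / Real.sqrt (z 0 - zb 0))
    else 0

/-- Existence (and continuity) of the derivatives of `F̃` entering the `Ψ_r^α` seminorms:
derivatives are counted parabolically in the first slot and by total order in the second. -/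
def PsiSmooth (r : ℕ) (Ft : Pt d → Pt d → ℝ) : Prop :=
  (∀ j m : Fin (d + 1) → ℕ, pdeg j + ∑ i, m i < r →
    Differentiable ℝ fun p : Pt d × Pt d => mderiv2 j m Ft p.1 p.2) ∧
  ∀ j m : Fin (d + 1) → ℕ, pdeg j + ∑ i, m i ≤ r →
    Continuous fun p : Pt d × Pt d => mderiv2 j m Ft p.1 p.2

/-- The set of numbers of which the `Ψ_r^α` seminorm `‖·‖_{α,r;T,n}` of a representation
`Ft` is the supremum. -/
def psiSet (r : ℕ) (T : ℝ) (n : ℕ) (Ft : Pt d → Pt d → ℝ) : Set ℝ :=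
  {y | ∃ (j m : Fin (d + 1) → ℕ) (w uv : Pt d),
    pdeg j + ∑ i, m i ≤ r ∧ 0 ≤ uv 0 ∧ uv 0 ≤ Real.sqrt T ∧
    y = (1 + Real.sqrt (∑ i : Fin d, uv i.succ ^ 2)) ^ n * |mderiv2 j m Ft w uv|}

/-- Membership in the heat-calculus space `Ψ_r^α`. -/
def MemPsi (α : ℝ) (r : ℕ) (F : Pt d → Pt d → ℝ) : Prop :=
  ∃ Ft, PsiRep α Ft F ∧ PsiSmooth r Ft ∧
    ∀ T : ℝ, 0 < T → ∀ n : ℕ, BddAbove (psiSet r T n Ft)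

/-- The `Ψ_r^α` seminorm `‖F‖_{α,r;T,n}` of a kernel `F`. -/
noncomputable def psiNorm (α : ℝ) (r : ℕ) (T : ℝ) (n : ℕ) (F : Pt d → Pt d → ℝ) : ℝ :=
  sInf {y | ∃ Ft, PsiRep α Ft F ∧ PsiSmooth r Ft ∧ BddAbove (psiSet r T n Ft) ∧
    y = sSup (psiSet r T n Ft)}

/-- Translation invariance of a two-argument kernel. -/
def TransInv (F : Pt d → Pt d → ℝ) : Prop := ∀ z zb h : Pt d, F (z + h) (zb + h) = F z zb

/-- Membership in `Φ_r^α`, the translation-invariant part of `Ψ_r^α`. -/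
def MemPhi (α : ℝ) (r : ℕ) (F : Pt d → Pt d → ℝ) : Prop := MemPsi α r F ∧ TransInv F

/-- `∂_w^m` of a family of kernels depending on a parameter `w`. -/
noncomputable def famDeriv (m : Fin (d + 1) → ℕ) (F : Pt d → Pt d → Pt d → ℝ) :
    Pt d → Pt d → Pt d → ℝ :=
  fun w z zb => mderiv m (fun w' => F w' z zb) w

/-- Membership in `C^m(Ψ_r^α)` for a family of kernels. -/
def MemCPsi (m : ℕ) (α : ℝ) (r : ℕ) (F : Pt d → Pt d → Pt d → ℝ) : Prop :=
  (∀ m' : Fin (d + 1) → ℕ, pdeg m' < m → ∀ z zb : Pt d,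
    Differentiable ℝ fun w => famDeriv m' F w z zb) ∧
  (∀ m' : Fin (d + 1) → ℕ, pdeg m' ≤ m → ∀ w : Pt d, MemPsi α r (famDeriv m' F w)) ∧
  ∀ T : ℝ, 0 < T → ∀ n : ℕ,
    BddAbove {y | ∃ (m' : Fin (d + 1) → ℕ) (w : Pt d), pdeg m' ≤ m ∧
      y = psiNorm α r T n (famDeriv m' F w)}

/-- The `C^m(Ψ_r^α)` seminorm `sup_w max_{|m'|_𝔰 ≤ m} ‖∂_w^{m'} F_w‖_{α,r;T,n}`. -/
noncomputable def cpsiNorm (m : ℕ) (α : ℝ) (r : ℕ) (T : ℝ) (n : ℕ)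
    (F : Pt d → Pt d → Pt d → ℝ) : ℝ :=
  sSup {y | ∃ (m' : Fin (d + 1) → ℕ) (w : Pt d), pdeg m' ≤ m ∧
    y = psiNorm α r T n (famDeriv m' F w)}

/-- Membership in `C^m(Φ_r^α)`. -/
def MemCPhi (m : ℕ) (α : ℝ) (r : ℕ) (F : Pt d → Pt d → Pt d → ℝ) : Prop :=
  MemCPsi m α r F ∧ ∀ w, TransInv (F w)

/-- The Beta function `B(a,b) = ∫₀¹ (1−s)^{a−1} s^{b−1} ds`. -/
noncomputable def betaFn (a b : ℝ) : ℝ := ∫ s in (0 : ℝ)..1, (1 - s) ^ (a - 1) * s ^ (b - 1)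

/-! ## Coefficient fields, the parabolicity–regularity assumption, `Z`, `E` and `Γ` -/

/-- Membership in the parabolic space `C^ρ`: all parabolic derivatives of order `≤ ρ`
exist, are continuous and bounded. -/
def MemCpar (ρ : ℕ) (f : Pt d → ℝ) : Prop :=
  (∀ k : Fin (d + 1) → ℕ, pdeg k < ρ → Differentiable ℝ (mderiv k f)) ∧
  ∀ k : Fin (d + 1) → ℕ, pdeg k ≤ ρ →
    Continuous (mderiv k f) ∧ ∃ M : ℝ, ∀ z, |mderiv k f z| ≤ M

/-- The `C^ρ` norm `max_{|k|_𝔰 ≤ ρ} sup |∂^k f|`. -/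
noncomputable def cparNorm (ρ : ℕ) (f : Pt d → ℝ) : ℝ :=
  sSup {y | ∃ (k : Fin (d + 1) → ℕ) (z : Pt d), pdeg k ≤ ρ ∧ y = |mderiv k f z|}

/-- A triple of coefficient fields `(a, b, c)`. -/
structure Coeffs (d : ℕ) where
  a : Pt d → Matrix (Fin d) (Fin d) ℝ
  b : Pt d → Fin d → ℝ
  c : Pt d → ℝ

/-- The parabolicity–regularity assumption, with ellipticity constant `lam` and
regularity exponent `ρ`. -/
structure ParReg (lam : ℝ) (ρ : ℕ) (A : Coeffs d) : Prop where
  symm : ∀ z, (A.a z).IsSymm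
  lower : ∀ (z : Pt d) (ζ : Fin d → ℝ), lam * ∑ i, ζ i ^ 2 ≤ ∑ i, ∑ j, A.a z i j * ζ i * ζ j
  upper : ∀ (z : Pt d) (ζ : Fin d → ℝ), ∑ i, ∑ j, A.a z i j * ζ i * ζ j ≤ lam⁻¹ * ∑ i, ζ i ^ 2
  areg : ∀ i j, MemCpar ρ fun z => A.a z i j
  breg : ∀ i, MemCpar ρ fun z => A.b z i
  creg : MemCpar ρ A.c

/-- The norm `‖(a,b,c)‖_ρ` on coefficient triples. -/
noncomputable def coeffNorm (ρ : ℕ) (A : Coeffs d) : ℝ :=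
  sSup {y | ∃ i j, y = cparNorm ρ fun z => A.a z i j} +
    sSup {y | ∃ i, y = cparNorm ρ fun z => A.b z i} + cparNorm ρ A.c

/-- Difference of two coefficient triples. -/
def coeffSub (A B : Coeffs d) : Coeffs d where
  a := fun z => A.a z - B.a z
  b := fun z => A.b z - B.b z
  c := fun z => A.c z - B.c z

/-- The distance on the space `𝐀_ρ` of coefficient fields. -/
noncomputable def coeffDist (ρ : ℕ) (A B : Coeffs d) : ℝ := coeffNorm ρ (coeffSub A B)

/-- The constant-coefficient heat kernel `W^w` with coefficients frozen at `w`. -/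
noncomputable def Wker (A : Coeffs d) (w : Pt d) (z : Pt d) : ℝ :=
  if 0 < z 0 then
    (4 * Real.pi) ^ (-(d : ℝ) / 2) * (A.a w).det ^ (-(1 : ℝ) / 2) * z 0 ^ (-(d : ℝ) / 2) *
      Real.exp (-(∑ i, ∑ j, (A.a w)⁻¹ i j * z i.succ * z j.succ) / (4 * z 0))
  else 0

/-- `Z(z, z̄) = W^{z̄}(z − z̄)`. -/
noncomputable def Zker (A : Coeffs d) : Pt d → Pt d → ℝ := fun z zb => Wker A zb (z - zb)

/-- `∂ᵢ Z`, derivative in the `i`-th spatial coordinate of the first argument. -/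
noncomputable def ZkerD (A : Coeffs d) (i : Fin d) : Pt d → Pt d → ℝ :=
  fun z zb => pd i.succ (fun y => Zker A y zb) z

/-- `∂ᵢ ∂ⱼ Z`. -/
noncomputable def ZkerDD (A : Coeffs d) (i j : Fin d) : Pt d → Pt d → ℝ :=
  fun z zb => pd i.succ (fun y => pd j.succ (fun y' => Zker A y' zb) y) z

/-- The kernel `E = LZ` away from the diagonal. -/
noncomputable def Eker (A : Coeffs d) : Pt d → Pt d → ℝ := fun z zb =>
  (∑ i, ∑ j, (A.a zb i j - A.a z i j) * ZkerDD A i j z zb) -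
    (∑ i, A.b z i * ZkerD A i z zb) - A.c z * Zker A z zb

/-- The `k`-th term `Z * (−E)^{*k}` of the Volterra series. -/
noncomputable def volterra (A : Coeffs d) : ℕ → (Pt d → Pt d → ℝ)
  | 0 => Zker A
  | k + 1 => conv (volterra A k) fun z zb => -Eker A z zb

/-- The heat kernel `Γ`, defined as the sum of the Volterra series. -/
noncomputable def GammaKer (A : Coeffs d) : Pt d → Pt d → ℝ :=
  fun z zb => ∑' k, volterra A k z zb

/-! ## The space `C_{loc,t}^r` -/

/-- The set of which the `C_{loc,t}^r` seminorm with parameter `T` is the supremum. -/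
def clocSet (r : ℕ) (T : ℝ) (F : Pt d → Pt d → ℝ) : Set ℝ :=
  {y | ∃ (j1 j2 : Fin (d + 1) → ℕ) (z zb : Pt d), pdeg j1 + pdeg j2 ≤ r ∧
    |z 0 - zb 0| ≤ T ∧ y = |mderiv2 j1 j2 F z zb|}

/-- Membership in `C_{loc,t}^r`. -/
def MemCloc (r : ℕ) (F : Pt d → Pt d → ℝ) : Prop :=
  (∀ j1 j2 : Fin (d + 1) → ℕ, pdeg j1 + pdeg j2 < r →
    Differentiable ℝ fun p : Pt d × Pt d => mderiv2 j1 j2 F p.1 p.2) ∧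
  (∀ j1 j2 : Fin (d + 1) → ℕ, pdeg j1 + pdeg j2 ≤ r →
    Continuous fun p : Pt d × Pt d => mderiv2 j1 j2 F p.1 p.2) ∧
  ∀ T : ℝ, 0 < T → BddAbove (clocSet r T F)

/-- The `C_{loc,t}^r` seminorm with time-separation parameter `T`. -/
noncomputable def clocNorm (r : ℕ) (T : ℝ) (F : Pt d → Pt d → ℝ) : ℝ := sSup (clocSet r T F)

end VarBPHZ

open MeasureTheory Filter
open scoped BigOperators ENNReal

namespace VarBPHZ

set_option linter.unusedVariables false
set_option linter.unusedSimpArgs false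
set_option linter.unusedSectionVars false

variable {d : ℕ}

/-! ## Kernel classes -/

abbrev XX (d : ℕ) := Pt d × Pt d

abbrev Dir (d : ℕ) := Fin (d + 1) ⊕ Fin (d + 1)

def wi (i : Fin (d + 1)) : ℕ := if i = 0 then 2 else 1

lemma wi_pos (i : Fin (d + 1)) : 1 ≤ wi i := by unfold wi; split_ifs <;> omega

lemma wi_le (i : Fin (d + 1)) : wi i ≤ 2 := by unfold wi; split_ifs <;> omega

@[simp] lemma wi_zero : wi (0 : Fin (d + 1)) = 2 := by simp [wi]

@[simp] lemma wi_succ (i : Fin d) : wi i.succ = 1 := by simp [wi, Fin.succ_ne_zero]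

def wt : Dir d → ℕ
  | Sum.inl i => wi i
  | Sum.inr i => wi i

@[simp] lemma wt_inl (i : Fin (d + 1)) : wt (Sum.inl i) = wi i := rfl

@[simp] lemma wt_inr (i : Fin (d + 1)) : wt (Sum.inr i) = wi i := rfl

lemma wt_pos (D : Dir d) : 1 ≤ wt D := by cases D <;> exact wi_pos _

noncomputable def cost : Dir d → ℝ
  | Sum.inl _ => 0
  | Sum.inr i => (wi i : ℝ) / 2

@[simp] lemma cost_inl (i : Fin (d + 1)) : cost (Sum.inl i) = 0 := rfl

@[simp] lemma cost_inr (i : Fin (d + 1)) : cost (Sum.inr i) = (wi i : ℝ) / 2 := rfl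

lemma cost_nonneg (D : Dir d) : 0 ≤ cost D := by
  cases D <;> simp only [cost] <;> positivity

noncomputable def ee : Dir d → XX d
  | Sum.inl i => (Pi.single i 1, 0)
  | Sum.inr i => (0, Pi.single i 1)

abbrev Ker (S : Type*) (d : ℕ) := S → Bool → XX d → ℝ

def UU (d : ℕ) (T : ℝ) : Set (XX d) := {x | 0 < x.2 0 ∧ x.2 0 < T}

lemma isOpen_UU (T : ℝ) : IsOpen (UU d T) := by
  have h : Continuous fun x : XX d => x.2 0 := by fun_prop
  exact (isOpen_lt continuous_const h).inter (isOpen_lt h continuous_const)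

def Bd (δ M : ℝ) (g : Bool → ℝ) : Prop := (∀ b, |g b| ≤ M) ∧ |g true - g false| ≤ δ * M

lemma Bd.nonneg {δ M : ℝ} {g : Bool → ℝ} (h : Bd δ M g) : 0 ≤ M := (abs_nonneg _).trans (h.1 true)

lemma Bd.mono {δ M M' : ℝ} {g : Bool → ℝ} (hδ : 0 ≤ δ) (h : Bd δ M g) (hM : M ≤ M') :
    Bd δ M' g :=
  ⟨fun b => (h.1 b).trans hM, h.2.trans (mul_le_mul_of_nonneg_left hM hδ)⟩

lemma Bd.add {δ M N : ℝ} {f g : Bool → ℝ} (hf : Bd δ M f) (hg : Bd δ N g) :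
    Bd δ (M + N) (fun b => f b + g b) := by
  refine ⟨fun b => (abs_add_le _ _).trans (add_le_add (hf.1 b) (hg.1 b)), ?_⟩
  have : f true + g true - (f false + g false) = (f true - f false) + (g true - g false) := by ring
  rw [this, mul_add]
  exact (abs_add_le _ _).trans (add_le_add hf.2 hg.2)

lemma Bd.smul {δ M : ℝ} {f : Bool → ℝ} (c : ℝ) (hf : Bd δ M f) :
    Bd δ (|c| * M) (fun b => c * f b) := by
  refine ⟨fun b => ?_, ?_⟩
  · rw [abs_mul]; exact mul_le_mul_of_nonneg_left (hf.1 b) (abs_nonneg _)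
  · have : c * f true - c * f false = c * (f true - f false) := by ring
    rw [this, abs_mul]
    calc |c| * |f true - f false| ≤ |c| * (δ * M) := mul_le_mul_of_nonneg_left hf.2 (abs_nonneg _)
      _ = _ := by ring

lemma Bd.mul {δ M N : ℝ} {f g : Bool → ℝ} (hδ : 0 ≤ δ) (hf : Bd δ M f) (hg : Bd δ N g) :
    Bd δ (2 * M * N) (fun b => f b * g b) := by
  have hM := hf.nonneg
  have hN := hg.nonneg
  refine ⟨fun b => ?_, ?_⟩
  · rw [abs_mul]
    have := mul_le_mul (hf.1 b) (hg.1 b) (abs_nonneg _) hM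
    nlinarith [mul_nonneg hM hN]
  · have : f true * g true - f false * g false
      = f true * (g true - g false) + (f true - f false) * g false := by ring
    rw [this]
    refine (abs_add_le _ _).trans ?_
    rw [abs_mul, abs_mul]
    have h1 := mul_le_mul (hf.1 true) hg.2 (abs_nonneg _) hM
    have h2 := mul_le_mul hf.2 (hg.1 false) (abs_nonneg _) (mul_nonneg hδ hM)
    nlinarith

noncomputable def sq (v : Pt d) : ℝ := ∑ i : Fin d, v i.succ ^ 2

lemma sq_nonneg' (v : Pt d) : 0 ≤ sq v := Finset.sum_nonneg fun _ _ => sq_nonneg _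

noncomputable def gau (κ : ℝ) (v : Pt d) : ℝ := Real.exp (-(κ * (sq v / v 0)))

lemma gau_pos (κ : ℝ) (v : Pt d) : 0 < gau κ v := Real.exp_pos _

lemma gau_add (κ κ' : ℝ) (v : Pt d) : gau (κ + κ') v = gau κ v * gau κ' v := by
  unfold gau; rw [← Real.exp_add]; congr 1; ring

lemma gau_mono {κ κ' : ℝ} (h : κ' ≤ κ) {v : Pt d} (hv : 0 < v 0) : gau κ v ≤ gau κ' v := by
  unfold gau
  apply Real.exp_le_exp.2
  have : 0 ≤ sq v / v 0 := div_nonneg (sq_nonneg' v) hv.le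
  nlinarith [mul_le_mul_of_nonneg_right h this]

variable {S : Type*} {δ : S → NNReal} {T κ κ' κ₁ κ₂ γ γ' γ₁ γ₂ C C' C₁ C₂ : ℝ} {n n' : ℕ}
  {Φ Φ' Ψ Ψ' : Ker S d}

structure Base (δ : S → NNReal) (T κ γ C : ℝ) (Φ : Ker S d) : Prop where
  nn : 0 ≤ C
  cont : ∀ s b, ContinuousOn (Φ s b) (UU d T)
  bd : ∀ s, ∀ x ∈ UU d T, Bd (δ s) (C * x.2 0 ^ γ * gau κ x.2) (fun b => Φ s b x)

def Has (T : ℝ) (D : Dir d) (Φ Φ' : Ker S d) : Prop :=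
  ∀ s b, ∀ x ∈ UU d T, HasLineDerivAt ℝ (Φ s b) (Φ' s b x) x (ee D)

inductive Cls (δ : S → NNReal) (T κ : ℝ) : ℕ → ℝ → ℝ → Ker S d → Prop
  | mk {n : ℕ} {γ C : ℝ} {Φ : Ker S d} (base : Base δ T κ γ C Φ) (dΦ : Dir d → Ker S d)
      (has : ∀ D, wt D ≤ n → Has T D Φ (dΦ D))
      (sub : ∀ D, wt D ≤ n → Cls δ T κ (n - wt D) (γ - cost D) C (dΦ D)) : Cls δ T κ n γ C Φ

lemma Cls.base (h : Cls δ T κ n γ C Φ) : Base δ T κ γ C Φ := by cases h; assumption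

lemma Cls.nn (h : Cls δ T κ n γ C Φ) : 0 ≤ C := h.base.nn

lemma Cls.exd (h : Cls δ T κ n γ C Φ) : ∃ dΦ : Dir d → Ker S d,
    (∀ D, wt D ≤ n → Has T D Φ (dΦ D)) ∧
    (∀ D, wt D ≤ n → Cls δ T κ (n - wt D) (γ - cost D) C (dΦ D)) := by
  cases h with
  | mk base dΦ has sub => exact ⟨dΦ, has, sub⟩

lemma Cls.of_le (h : Cls δ T κ n γ C Φ) : ∀ {m : ℕ}, m ≤ n → Cls δ T κ m γ C Φ := by
  induction h with
  | mk base dΦ has sub ih =>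
    intro m hm
    exact .mk base dΦ (fun D hD => has D (hD.trans hm))
      (fun D hD => ih D (hD.trans hm) (by omega))

lemma Base.mono (hT : 1 ≤ T) (h : Base δ T κ γ C Φ) (hκ : κ' ≤ κ) (hγ : γ' ≤ γ)
    (hC : C * T ^ (γ - γ') ≤ C') : Base δ T κ' γ' C' Φ := by
  have hTp : 0 < T := by linarith
  have h0 : 0 ≤ C * T ^ (γ - γ') := mul_nonneg h.nn (Real.rpow_nonneg hTp.le _)
  refine ⟨h0.trans hC, h.cont, fun s x hx => (h.bd s x hx).mono (δ s).2 ?_⟩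
  have hu := hx.1
  have e : x.2 0 ^ γ = x.2 0 ^ (γ - γ') * x.2 0 ^ γ' := by
    rw [← Real.rpow_add hu]; congr 1; ring
  have h1 : x.2 0 ^ (γ - γ') ≤ T ^ (γ - γ') :=
    Real.rpow_le_rpow hu.le hx.2.le (by linarith)
  have h2 := Real.rpow_nonneg hu.le γ'
  have h3 : C * x.2 0 ^ γ ≤ C' * x.2 0 ^ γ' := by
    rw [e, ← mul_assoc]
    exact mul_le_mul_of_nonneg_right ((mul_le_mul_of_nonneg_left h1 h.nn).trans hC) h2
  exact mul_le_mul h3 (gau_mono hκ hu) (gau_pos _ _).le (mul_nonneg (h0.trans hC) h2)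

lemma Cls.mono (hT : 1 ≤ T) (h : Cls δ T κ n γ C Φ) : ∀ {γ' : ℝ}, (κ' ≤ κ) → (γ' ≤ γ) →
    (C * T ^ (γ - γ') ≤ C') → Cls δ T κ' n γ' C' Φ := by
  induction h with
  | mk base dΦ has sub ih =>
    intro γ' hκ hγ hC
    exact .mk (base.mono hT hκ hγ hC) dΦ has
      (fun D hD => ih D hD hκ (by linarith) (by simpa using hC))

lemma Cls.monoC (hT : 1 ≤ T) (h : Cls δ T κ n γ C Φ) (hC : C ≤ C') : Cls δ T κ n γ C' Φ :=
  h.mono hT le_rfl le_rfl (by simpa using hC)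

/-- Membership with an unspecified constant. -/
def UC (δ : S → NNReal) (T κ : ℝ) (n : ℕ) (γ : ℝ) (Φ : Ker S d) : Prop :=
  ∃ C, Cls δ T κ n γ C Φ

lemma Cls.uc (h : Cls δ T κ n γ C Φ) : UC δ T κ n γ Φ := ⟨C, h⟩

lemma UC.of_le (h : UC δ T κ n γ Φ) {m : ℕ} (hm : m ≤ n) : UC δ T κ m γ Φ := by
  obtain ⟨C, h⟩ := h; exact ⟨C, h.of_le hm⟩

lemma UC.mono (hT : 1 ≤ T) (h : UC δ T κ n γ Φ) (hκ : κ' ≤ κ) (hγ : γ' ≤ γ) :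
    UC δ T κ' n γ' Φ := by
  obtain ⟨C, h⟩ := h; exact ⟨_, h.mono hT hκ hγ le_rfl⟩

lemma UC.mk (hT : 1 ≤ T) (base : ∃ C, Base δ T κ γ C Φ) (dΦ : Dir d → Ker S d)
    (has : ∀ D, wt D ≤ n → Has T D Φ (dΦ D))
    (sub : ∀ D, wt D ≤ n → UC δ T κ (n - wt D) (γ - cost D) (dΦ D)) : UC δ T κ n γ Φ := by
  classical
  obtain ⟨C, hb⟩ := base
  choose! c hc using sub
  set C' := C + ∑ D, |c D| with hC'
  have h1 : C ≤ C' := by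
    have : 0 ≤ ∑ D, |c D| := Finset.sum_nonneg fun _ _ => abs_nonneg _
    linarith
  refine ⟨C', .mk (hb.mono hT le_rfl le_rfl (by simpa using h1)) dΦ has fun D hD => ?_⟩
  refine (hc D hD).monoC hT ?_
  have := Finset.single_le_sum (f := fun D => |c D|) (fun _ _ => abs_nonneg _) (Finset.mem_univ D)
  have h2 := hb.nn
  have h3 := le_abs_self (c D)
  linarith

lemma UC.exd (h : UC δ T κ n γ Φ) : ∃ dΦ : Dir d → Ker S d,
    (∀ D, wt D ≤ n → Has T D Φ (dΦ D)) ∧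
    (∀ D, wt D ≤ n → UC δ T κ (n - wt D) (γ - cost D) (dΦ D)) := by
  obtain ⟨C, h⟩ := h
  obtain ⟨dΦ, h1, h2⟩ := h.exd
  exact ⟨dΦ, h1, fun D hD => ⟨C, h2 D hD⟩⟩

lemma UC.base (h : UC δ T κ n γ Φ) : ∃ C, Base δ T κ γ C Φ := by
  obtain ⟨C, h⟩ := h; exact ⟨C, h.base⟩

/-! ### Congruence -/

lemma Has.congr {D : Dir d} (h : Has T D Φ Φ') (e : ∀ s b, ∀ x ∈ UU d T, Φ s b x = Ψ s b x)
    (e' : ∀ s b, ∀ x ∈ UU d T, Φ' s b x = Ψ' s b x) : Has T D Ψ Ψ' := by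
  intro s b x hx
  rw [← e' s b x hx]
  refine (h s b x hx).congr_of_eventuallyEq ?_
  filter_upwards [(isOpen_UU T).mem_nhds hx] with y hy using (e s b y hy).symm

lemma Base.congr (h : Base δ T κ γ C Φ) (e : ∀ s b, ∀ x ∈ UU d T, Φ s b x = Ψ s b x) :
    Base δ T κ γ C Ψ := by
  refine ⟨h.nn, fun s b => (h.cont s b).congr fun x hx => (e s b x hx).symm, fun s x hx => ?_⟩
  have := h.bd s x hx
  simpa only [e s _ x hx] using this

lemma Cls.congr (h : Cls δ T κ n γ C Φ) (e : ∀ s b, ∀ x ∈ UU d T, Φ s b x = Ψ s b x) :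
    Cls δ T κ n γ C Ψ := by
  obtain ⟨dΦ, h1, h2⟩ := h.exd
  exact .mk (h.base.congr e) dΦ (fun D hD => (h1 D hD).congr e fun _ _ _ _ => rfl) h2

lemma UC.congr (h : UC δ T κ n γ Φ) (e : ∀ s b, ∀ x ∈ UU d T, Φ s b x = Ψ s b x) :
    UC δ T κ n γ Ψ := by
  obtain ⟨C, h⟩ := h; exact ⟨C, h.congr e⟩

lemma Has.unique {D : Dir d} (h : Has T D Φ Φ') (h' : Has T D Φ Ψ') :
    ∀ s b, ∀ x ∈ UU d T, Φ' s b x = Ψ' s b x := fun s b x hx =>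
  (h s b x hx).unique (h' s b x hx)

/-- From membership and a known derivative. -/
lemma Cls.sub_of_has {D : Dir d} (h : Cls δ T κ n γ C Φ) (hD : wt D ≤ n) (h' : Has T D Φ Φ') :
    Cls δ T κ (n - wt D) (γ - cost D) C Φ' := by
  obtain ⟨dΦ, h1, h2⟩ := h.exd
  exact (h2 D hD).congr ((h1 D hD).unique h')

lemma UC.sub_of_has {D : Dir d} (h : UC δ T κ n γ Φ) (hD : wt D ≤ n) (h' : Has T D Φ Φ') :
    UC δ T κ (n - wt D) (γ - cost D) Φ' := by
  obtain ⟨C, h⟩ := h; exact ⟨C, h.sub_of_has hD h'⟩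

/-! ### Algebra -/

lemma Has.add {D : Dir d} (h : Has T D Φ Φ') (h' : Has T D Ψ Ψ') :
    Has T D (Φ + Ψ) (Φ' + Ψ') := fun s b x hx => (h s b x hx).add (h' s b x hx)

lemma Has.smul {D : Dir d} (c : ℝ) (h : Has T D Φ Φ') : Has T D (c • Φ) (c • Φ') :=
  fun s b x hx => by
    have := HasDerivAt.const_mul c (h s b x hx)
    exact this

lemma Has.mul {D : Dir d} (h : Has T D Φ Φ') (h' : Has T D Ψ Ψ') :
    Has T D (Φ * Ψ) (Φ' * Ψ + Φ * Ψ') := fun s b x hx => by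
  have := HasDerivAt.mul (h s b x hx) (h' s b x hx)
  simp only [zero_smul, add_zero] at this
  exact this

lemma Base.add (h : Base δ T κ γ C₁ Φ) (h' : Base δ T κ γ C₂ Ψ) :
    Base δ T κ γ (C₁ + C₂) (Φ + Ψ) := by
  refine ⟨add_nonneg h.nn h'.nn, fun s b => (h.cont s b).add (h'.cont s b), fun s x hx => ?_⟩
  have := (h.bd s x hx).add (h'.bd s x hx)
  rw [← add_mul, ← add_mul] at this
  exact this

lemma Base.smul (c : ℝ) (h : Base δ T κ γ C Φ) : Base δ T κ γ (|c| * C) (c • Φ) := by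
  refine ⟨mul_nonneg (abs_nonneg _) h.nn, fun s b => (h.cont s b).const_smul c, fun s x hx => ?_⟩
  have := (h.bd s x hx).smul c
  rw [← mul_assoc, ← mul_assoc] at this
  exact this

lemma Base.mul (h : Base δ T κ₁ γ₁ C₁ Φ) (h' : Base δ T κ₂ γ₂ C₂ Ψ) :
    Base δ T (κ₁ + κ₂) (γ₁ + γ₂) (2 * C₁ * C₂) (Φ * Ψ) := by
  refine ⟨mul_nonneg (mul_nonneg zero_le_two h.nn) h'.nn,
    fun s b => (h.cont s b).mul (h'.cont s b), fun s x hx => ?_⟩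
  have := (h.bd s x hx).mul (δ s).2 (h'.bd s x hx)
  rw [gau_add, Real.rpow_add hx.1]
  exact this.mono (δ s).2 (le_of_eq (by ring))

lemma Cls.add (h : Cls δ T κ n γ C₁ Φ) : ∀ {Ψ : Ker S d}, Cls δ T κ n γ C₂ Ψ →
    Cls δ T κ n γ (C₁ + C₂) (Φ + Ψ) := by
  induction h with
  | mk base dΦ has sub ih =>
    intro Ψ h'
    obtain ⟨dΨ, h1, h2⟩ := h'.exd
    exact .mk (base.add h'.base) (fun D => dΦ D + dΨ D) (fun D hD => (has D hD).add (h1 D hD))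
      (fun D hD => ih D hD (h2 D hD))

lemma Cls.smul (c : ℝ) (h : Cls δ T κ n γ C Φ) : Cls δ T κ n γ (|c| * C) (c • Φ) := by
  induction h with
  | mk base dΦ has sub ih =>
    exact .mk (base.smul c) (fun D => c • dΦ D) (fun D hD => (has D hD).smul c) ih

lemma Cls.neg (h : Cls δ T κ n γ C Φ) : Cls δ T κ n γ C (-Φ) := by
  simpa using h.smul (-1)

lemma Cls.mul (hT : 1 ≤ T) : ∀ (n : ℕ) {γ₁ γ₂ : ℝ} {Φ Ψ : Ker S d}, Cls δ T κ₁ n γ₁ C₁ Φ →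
    Cls δ T κ₂ n γ₂ C₂ Ψ → Cls δ T (κ₁ + κ₂) n (γ₁ + γ₂) (2 ^ (n + 1) * (C₁ * C₂)) (Φ * Ψ) := by
  intro n
  induction n using Nat.strong_induction_on with
  | _ n ih =>
    intro γ₁ γ₂ Φ Ψ h h'
    obtain ⟨dΦ, h1, h2⟩ := h.exd
    obtain ⟨dΨ, h1', h2'⟩ := h'.exd
    have hC := mul_nonneg h.nn h'.nn
    refine .mk ((h.base.mul h'.base).mono hT le_rfl le_rfl ?_) (fun D => dΦ D * Ψ + Φ * dΨ D)
      (fun D hD => (h1 D hD).mul (h1' D hD)) (fun D hD => ?_)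
    · simp only [sub_self, Real.rpow_zero, mul_one]
      have : (2 : ℝ) ≤ 2 ^ (n + 1) := by
        rw [pow_succ]; have := one_le_pow₀ (n := n) (one_le_two (α := ℝ)); linarith
      nlinarith [mul_le_mul_of_nonneg_right this hC]
    · have hp := wt_pos D
      have a := ih (n - wt D) (by omega) (h2 D hD) (h'.of_le (by omega))
      have b := ih (n - wt D) (by omega) (h.of_le (Nat.sub_le n (wt D))) (h2' D hD)
      rw [show γ₁ + (γ₂ - cost D) = γ₁ - cost D + γ₂ by ring] at b
      have c := a.add b
      rw [show γ₁ - cost D + γ₂ = γ₁ + γ₂ - cost D by ring] at c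
      refine c.monoC hT ?_
      rw [← two_mul, ← mul_assoc, ← pow_succ']
      refine mul_le_mul_of_nonneg_right ?_ hC
      exact pow_le_pow_right₀ one_le_two (by omega)

lemma UC.add (hT : 1 ≤ T) (h : UC δ T κ n γ Φ) (h' : UC δ T κ n γ Ψ) :
    UC δ T κ n γ (Φ + Ψ) := by
  obtain ⟨C, h⟩ := h; obtain ⟨C', h'⟩ := h'; exact ⟨_, h.add h'⟩

lemma UC.smul (c : ℝ) (h : UC δ T κ n γ Φ) : UC δ T κ n γ (c • Φ) := by
  obtain ⟨C, h⟩ := h; exact ⟨_, h.smul c⟩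

lemma UC.neg (h : UC δ T κ n γ Φ) : UC δ T κ n γ (-Φ) := by
  obtain ⟨C, h⟩ := h; exact ⟨_, h.neg⟩

lemma UC.sub (hT : 1 ≤ T) (h : UC δ T κ n γ Φ) (h' : UC δ T κ n γ Ψ) :
    UC δ T κ n γ (Φ - Ψ) := by
  rw [sub_eq_add_neg]; exact h.add hT h'.neg

lemma UC.mul (hT : 1 ≤ T) (h : UC δ T κ₁ n γ₁ Φ) (h' : UC δ T κ₂ n γ₂ Ψ) :
    UC δ T (κ₁ + κ₂) n (γ₁ + γ₂) (Φ * Ψ) := by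
  obtain ⟨C, h⟩ := h; obtain ⟨C', h'⟩ := h'; exact ⟨_, Cls.mul hT n h h'⟩

lemma Base.zero : Base δ T κ γ 0 (0 : Ker S d) :=
  ⟨le_rfl, fun _ _ => continuousOn_const, fun s x hx => by simp [Bd]⟩

lemma Has.zero {D : Dir d} : Has T D (0 : Ker S d) 0 := fun s b x hx => hasDerivAt_const _ _

lemma Cls.zero : ∀ (n : ℕ) (γ : ℝ), Cls δ T κ n γ 0 (0 : Ker S d) := by
  intro n
  induction n using Nat.strong_induction_on with
  | _ n ih =>
    intro γ
    exact .mk Base.zero (fun _ => 0) (fun D _ => Has.zero)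
      (fun D hD => ih _ (by have := wt_pos D; omega) _)

lemma UC.zero (n : ℕ) (γ : ℝ) : UC δ T κ n γ (0 : Ker S d) := ⟨0, Cls.zero n γ⟩

lemma Cls.zero' (hT : 1 ≤ T) (hC : 0 ≤ C) : Cls δ T κ n γ C (0 : Ker S d) :=
  (Cls.zero n γ).monoC hT hC

lemma UC.sum (hT : 1 ≤ T) {ι : Type*} (s : Finset ι) {F : ι → Ker S d}
    (h : ∀ i ∈ s, UC δ T κ n γ (F i)) : UC δ T κ n γ (∑ i ∈ s, F i) := by
  classical
  induction s using Finset.induction_on with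
  | empty => simpa using UC.zero n γ
  | insert a s ha ih =>
    rw [Finset.sum_insert ha]
    exact (h a (by simp)).add hT (ih fun i hi => h i (by simp [hi]))

lemma Cls.sum (hT : 1 ≤ T) {ι : Type*} (s : Finset ι) {F : ι → Ker S d} (C : ℝ)
    (h : ∀ i ∈ s, Cls δ T κ n γ C (F i)) : Cls δ T κ n γ (s.card * C) (∑ i ∈ s, F i) := by
  classical
  induction s using Finset.induction_on with
  | empty => simpa using Cls.zero n γ
  | insert a s ha ih =>
    rw [Finset.sum_insert ha, Finset.card_insert_of_notMem ha]
    have := (h a (by simp)).add (ih fun i hi => h i (by simp [hi]))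
    convert this using 1
    push_cast; ring

lemma UC.const (hT : 1 ≤ T) (n : ℕ) (c : ℝ) : UC δ T 0 n 0 (fun _ _ _ => c : Ker S d) := by
  refine UC.mk hT ⟨|c|, ⟨abs_nonneg _, fun _ _ => continuousOn_const, fun s x hx => ?_⟩⟩
    (fun _ => 0) (fun D _ s b x hx => hasDerivAt_const _ _) (fun D hD => UC.zero _ _)
  have : 0 ≤ (δ s : ℝ) * |c| := by positivity
  simp [Bd, gau, this]

lemma UC.prod (hT : 1 ≤ T) {ι : Type*} (s : Finset ι) {F : ι → Ker S d}
    (h : ∀ i ∈ s, UC δ T 0 n 0 (F i)) : UC δ T 0 n 0 (∏ i ∈ s, F i) := by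
  classical
  induction s using Finset.induction_on with
  | empty => exact UC.const hT n 1
  | insert a s ha ih =>
    rw [Finset.prod_insert ha]
    have := (h a (by simp)).mul hT (ih fun i hi => h i (by simp [hi]))
    simpa using this

end VarBPHZ

open MeasureTheory Filter
open scoped BigOperators ENNReal

namespace VarBPHZ

set_option linter.unusedVariables false
set_option linter.unusedSimpArgs false
set_option linter.unusedSectionVars false

variable {d : ℕ}
variable {S : Type*} {δ : S → NNReal} {T κ κ' κ₁ κ₂ γ γ' γ₁ γ₂ C C' C₁ C₂ : ℝ} {n n' : ℕ}
  {Φ Φ' Ψ Ψ' : Ker S d}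

/-! ## Calculus lemmas -/

section calcs

variable {E : Type*} [NormedAddCommGroup E] [NormedSpace ℝ E]

lemma hasDerivAt_line {f : E → ℝ} {f' : ℝ} {x e : E} {t : ℝ}
    (h : HasLineDerivAt ℝ f f' (x + t • e) e) : HasDerivAt (fun τ => f (x + τ • e)) f' t := by
  have h1 : HasDerivAt (fun τ : ℝ => f (x + t • e + τ • e)) f' (t - t) := by
    rw [sub_self]; exact h
  have h2 := h1.comp_sub_const t t
  refine h2.congr_of_eventuallyEq (Eventually.of_forall fun τ => ?_)
  show f (x + τ • e) = f (x + t • e + (τ - t) • e)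
  congr 1; module

/-- Mean value inequality along a line. -/
lemma mvt_line {f f' : E → ℝ} {x e : E} {t M : ℝ}
    (h : ∀ τ ∈ Set.uIcc 0 t, HasLineDerivAt ℝ f (f' (x + τ • e)) (x + τ • e) e)
    (hM : ∀ τ ∈ Set.uIcc 0 t, |f' (x + τ • e)| ≤ M) :
    |f (x + t • e) - f x| ≤ M * |t| := by
  have := Convex.norm_image_sub_le_of_norm_hasDerivWithin_le (s := Set.uIcc 0 t)
    (f := fun τ => f (x + τ • e)) (f' := fun τ => f' (x + τ • e)) (C := M) (x := 0) (y := t)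
    (fun τ hτ => (hasDerivAt_line (h τ hτ)).hasDerivWithinAt) hM (convex_uIcc 0 t)
    Set.left_mem_uIcc Set.right_mem_uIcc
  simpa using this

lemma mvt_line' {f f' : E → ℝ} {x e : E} {t M c : ℝ}
    (h : ∀ τ ∈ Set.uIcc 0 t, HasLineDerivAt ℝ f (f' (x + τ • e)) (x + τ • e) e)
    (hM : ∀ τ ∈ Set.uIcc 0 t, |f' (x + τ • e) - c| ≤ M) :
    |f (x + t • e) - f x - t * c| ≤ M * |t| := by
  have := Convex.norm_image_sub_le_of_norm_hasDerivWithin_le (s := Set.uIcc 0 t)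
    (f := fun τ => f (x + τ • e) - τ * c) (f' := fun τ => f' (x + τ • e) - c)
    (C := M) (x := 0) (y := t)
    (fun τ hτ => ((hasDerivAt_line (h τ hτ)).sub
      (by simpa using (hasDerivAt_id τ).mul_const c)).hasDerivWithinAt) hM (convex_uIcc 0 t)
    Set.left_mem_uIcc Set.right_mem_uIcc
  simp only [zero_smul, add_zero, zero_mul, sub_zero, Real.norm_eq_abs] at this
  convert this using 2
  ring

lemma abs_le_of_uIcc {τ t : ℝ} (h : τ ∈ Set.uIcc 0 t) : |τ| ≤ |t| := by
  have := Set.abs_sub_left_of_mem_uIcc h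
  simpa using this

lemma hasDerivAt_of_bound {f : ℝ → ℝ} {f' x : ℝ}
    (h : ∀ ε > 0, ∀ᶠ t in nhds (0 : ℝ), |f (x + t) - f x - t * f'| ≤ ε * |t|) :
    HasDerivAt f f' x := by
  rw [hasDerivAt_iff_isLittleO_nhds_zero]
  rw [Asymptotics.isLittleO_iff]
  intro ε hε
  filter_upwards [h ε hε] with t ht
  simpa [smul_eq_mul] using ht

/-- Sum of directions. -/
lemma line_add {U : Set E} (hU : IsOpen U) {f A B : E → ℝ} {a b : E}
    (hA : ∀ x ∈ U, HasLineDerivAt ℝ f (A x) x a) (hB : ∀ x ∈ U, HasLineDerivAt ℝ f (B x) x b)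
    (hBc : ContinuousOn B U) : ∀ x ∈ U, HasLineDerivAt ℝ f (A x + B x) x (a + b) := by
  intro x hx
  refine hasDerivAt_of_bound fun ε hε => ?_
  have hc : ContinuousAt B x := hBc.continuousAt (hU.mem_nhds hx)
  have h1 : ∀ᶠ y in nhds x, y ∈ U ∧ |B y - B x| ≤ ε / 2 := by
    refine Eventually.and (hU.mem_nhds hx) ?_
    have := (tendsto_iff_norm_sub_tendsto_zero.1 hc.tendsto).eventually
      (ge_mem_nhds (half_pos hε))
    exact this
  obtain ⟨r, hr, hball⟩ := Metric.eventually_nhds_iff.1 h1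
  have hA' := hA x hx
  rw [HasLineDerivAt, hasDerivAt_iff_isLittleO_nhds_zero, Asymptotics.isLittleO_iff] at hA'
  have h2 := hA' (half_pos hε)
  have h3 : ∀ᶠ t in nhds (0 : ℝ), |t| * (‖a‖ + ‖b‖) < r := by
    have : Continuous fun t : ℝ => |t| * (‖a‖ + ‖b‖) := by fun_prop
    exact this.continuousAt.eventually_lt continuousAt_const (by simpa using hr)
  filter_upwards [h2, h3] with t ht ht3
  have key : ∀ τ ∈ Set.uIcc 0 t, x + t • a + τ • b ∈ U ∧ |B (x + t • a + τ • b) - B x| ≤ ε / 2 := by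
    intro τ hτ
    apply hball
    rw [dist_eq_norm, show x + t • a + τ • b - x = t • a + τ • b by abel]
    refine lt_of_le_of_lt (norm_add_le _ _) ?_
    rw [norm_smul, norm_smul]
    have := mul_le_mul_of_nonneg_right (abs_le_of_uIcc hτ) (norm_nonneg b)
    simp only [Real.norm_eq_abs]
    nlinarith
  have h4 := mvt_line' (f := f) (f' := B) (x := x + t • a) (e := b) (t := t) (M := ε / 2)
    (c := B x) (fun τ hτ => hB _ (key τ hτ).1) (fun τ hτ => (key τ hτ).2)
  simp only [zero_add, zero_smul, add_zero, smul_eq_mul, Real.norm_eq_abs] at ht ⊢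
  have e1 : x + t • (a + b) = x + t • a + t • b := by rw [smul_add, add_assoc]
  rw [e1]
  have e2 : f (x + t • a + t • b) - f x - t * (A x + B x) =
    (f (x + t • a + t • b) - f (x + t • a) - t * B x) + (f (x + t • a) - f x - t * A x) := by ring
  rw [e2]
  refine (abs_add_le _ _).trans ?_
  linarith

lemma line_smul {f : E → ℝ} {f' c : ℝ} {x a : E} (h : HasLineDerivAt ℝ f f' x a) :
    HasLineDerivAt ℝ f (c * f') x (c • a) := by
  have := h.smul c
  simpa using this

/-- Exchange of line derivatives. -/
lemma line_comm {U : Set E} (hU : IsOpen U) {g A B Y : E → ℝ} {a b : E}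
    (hA : ∀ x ∈ U, HasLineDerivAt ℝ g (A x) x a) (hB : ∀ x ∈ U, HasLineDerivAt ℝ g (B x) x b)
    (hY : ∀ x ∈ U, HasLineDerivAt ℝ A (Y x) x b)
    (hYc : ContinuousOn Y U) : ∀ x ∈ U, HasLineDerivAt ℝ B (Y x) x a := by
  intro x hx
  refine hasDerivAt_of_bound fun ε hε => ?_
  have hc : ContinuousAt Y x := hYc.continuousAt (hU.mem_nhds hx)
  have h1 : ∀ᶠ y in nhds x, y ∈ U ∧ |Y y - Y x| ≤ ε := by
    refine Eventually.and (hU.mem_nhds hx) ?_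
    have := (tendsto_iff_norm_sub_tendsto_zero.1 hc.tendsto).eventually
      (ge_mem_nhds hε)
    exact this
  obtain ⟨r, hr, hball⟩ := Metric.eventually_nhds_iff.1 h1
  have h3 : ∀ᶠ t in nhds (0 : ℝ), |t| * ‖a‖ < r / 2 := by
    have : Continuous fun t : ℝ => |t| * ‖a‖ := by fun_prop
    exact this.continuousAt.eventually_lt continuousAt_const (by simpa using hr)
  have h4 : ∀ᶠ t in nhds (0 : ℝ), |t| * ‖b‖ < r / 2 := by
    have : Continuous fun t : ℝ => |t| * ‖b‖ := by fun_prop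
    exact this.continuousAt.eventually_lt continuousAt_const (by simpa using hr)
  filter_upwards [h3] with t ht
  have mem : ∀ τ ∈ Set.uIcc 0 t, ∀ s : ℝ, |s| * ‖b‖ < r / 2 →
      x + s • b + τ • a ∈ U ∧ |Y (x + s • b + τ • a) - Y x| ≤ ε := by
    intro τ hτ s hs
    apply hball
    rw [dist_eq_norm, show x + s • b + τ • a - x = s • b + τ • a by abel]
    refine lt_of_le_of_lt (norm_add_le _ _) ?_
    rw [norm_smul, norm_smul]
    have := mul_le_mul_of_nonneg_right (abs_le_of_uIcc hτ) (norm_nonneg a)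
    simp only [Real.norm_eq_abs]
    linarith
  -- double difference bound
  have dd : ∀ᶠ s in nhds (0 : ℝ), |(g (x + s • b + t • a) - g (x + s • b))
      - (g (x + t • a) - g x) - t * (s * Y x)| ≤ ε * |s| * |t| := by
    filter_upwards [h4] with s hs
    have small : ∀ σ ∈ Set.uIcc 0 s, |σ| * ‖b‖ < r / 2 := fun σ hσ =>
      lt_of_le_of_lt (mul_le_mul_of_nonneg_right (abs_le_of_uIcc hσ) (norm_nonneg b)) hs
    have m := mvt_line' (f := fun y => g (y + s • b) - g y) (f' := fun y => A (y + s • b) - A y)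
      (x := x) (e := a) (t := t) (M := ε * |s|) (c := s * Y x) ?_ ?_
    · convert m using 2
      rw [show x + s • b + t • a = x + t • a + s • b by abel]
      ring
    · intro τ hτ
      have p1 := hA _ (mem τ hτ s hs).1
      have p2 := hA _ (mem τ hτ 0 (by simpa using hr)).1
      simp only [zero_smul, add_zero] at p2
      rw [show x + s • b + τ • a = x + τ • a + s • b by abel] at p1
      refine HasDerivAt.sub (f := fun t : ℝ => g (x + τ • a + t • a + s • b)) ?_ p2
      have : HasDerivAt (fun t : ℝ => g (x + τ • a + s • b + t • a)) _ 0 := p1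
      refine this.congr_of_eventuallyEq (Eventually.of_forall fun t' => ?_)
      show g _ = g _
      congr 1; abel
    · intro τ hτ
      have := mvt_line' (f := A) (f' := Y) (x := x + τ • a) (e := b) (t := s) (M := ε) (c := Y x)
        ?_ ?_
      · exact this
      · intro σ hσ
        have := (mem τ hτ σ (small σ hσ)).1
        rw [show x + σ • b + τ • a = x + τ • a + σ • b by abel] at this
        exact hY _ this
      · intro σ hσ
        have := (mem τ hτ σ (small σ hσ)).2
        rw [show x + σ • b + τ • a = x + τ • a + σ • b by abel] at this
        exact this
  have hxt : x + t • a ∈ U := by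
    have := (mem t Set.right_mem_uIcc 0 (by simpa using hr)).1
    simpa using this
  -- derivative in s of the double difference
  have hd : HasDerivAt (fun s : ℝ => g (x + t • a + s • b) - g (x + s • b))
      (B (x + t • a) - B x) 0 := HasDerivAt.sub (hB _ hxt) (hB _ hx)
  have hl : HasDerivAt (fun s : ℝ => g (x + t • a + s • b) - g (x + s • b) - t * (s * Y x))
      (B (x + t • a) - B x - t * Y x) 0 := by
    refine hd.sub ?_
    have := ((hasDerivAt_id (0 : ℝ)).mul_const (Y x)).const_mul t
    simpa using this
  have hfin := hl.le_of_lip' (C := ε * |t|) (by positivity) ?_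
  · simpa using hfin
  · filter_upwards [dd] with s hs
    simp only [zero_smul, add_zero, zero_mul, mul_zero, sub_zero, Real.norm_eq_abs]
    rw [show x + s • b + t • a = x + t • a + s • b by abel] at hs
    calc _ = |g (x + t • a + s • b) - g (x + s • b) - (g (x + t • a) - g x) - t * (s * Y x)| := by
          congr 1; ring
      _ ≤ ε * |s| * |t| := hs
      _ = _ := by ring

end calcs

lemma Has.comm {D D' : Dir d} {A B Y : Ker S d} (hA : Has T D Φ A) (hB : Has T D' Φ B)
    (hY : Has T D' A Y) (hc : ∀ s b, ContinuousOn (Y s b) (UU d T)) : Has T D B Y :=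
  fun s b => line_comm (isOpen_UU T) (hA s b) (hB s b) (hY s b) (hc s b)

end VarBPHZ

open MeasureTheory Filter
open scoped BigOperators ENNReal

namespace VarBPHZ

set_option linter.unusedVariables false
set_option linter.unusedSimpArgs false
set_option linter.unusedSectionVars false

variable {d : ℕ}
variable {S : Type*} {δ : S → NNReal} {T κ κ' κ₁ κ₂ γ γ' γ₁ γ₂ C C' C₁ C₂ : ℝ} {n n' : ℕ}
  {Φ Φ' Ψ Ψ' : Ker S d}

/-! ## Elementary kernels -/

lemma ee_inl_snd (i : Fin (d + 1)) : (ee (Sum.inl i) : XX d).2 = 0 := rfl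

lemma hasLine_coord (i : Fin (d + 1)) (D : Dir d) (x : XX d) :
    HasLineDerivAt ℝ (fun y : XX d => y.2 i) ((ee D).2 i) x (ee D) := by
  show HasDerivAt (fun t : ℝ => x.2 i + t * (ee D).2 i) _ 0
  simpa using ((hasDerivAt_id (0 : ℝ)).mul_const ((ee D).2 i)).const_add (x.2 i)

/-- Powers of time. -/
lemma UC.upow (hT : 1 ≤ T) : ∀ (n : ℕ) (a : ℝ),
    UC δ T 0 n a (fun _ _ x => x.2 0 ^ a : Ker S d) := by
  intro n
  induction n using Nat.strong_induction_on with
  | _ n ih =>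
    intro a
    refine UC.mk hT ⟨1, zero_le_one, fun s b => ?_, fun s x hx => ?_⟩
      (fun D => match D with
        | Sum.inl i => 0
        | Sum.inr i => if i = 0 then (a • (fun _ _ x => x.2 0 ^ (a - 1))) else 0)
      (fun D hD s b x hx => ?_) (fun D hD => ?_)
    · refine ContinuousOn.rpow_const (by fun_prop) fun x hx => Or.inl hx.1.ne'
    · have := Real.rpow_nonneg hx.1.le a
      have h2 : 0 ≤ (δ s : ℝ) * x.2 0 ^ a := by positivity
      simp [Bd, gau, abs_of_nonneg this, h2]
    · have h1 := HasDerivAt.rpow_const (p := a) (hasLine_coord 0 D x)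
        (Or.inl (by simpa using hx.1.ne'))
      have h2 : HasLineDerivAt ℝ (fun y : XX d => y.2 0 ^ a) _ x (ee D) := h1
      convert h2 using 1
      rcases D with i | i
      · simp [ee]
      · by_cases h : i = 0
        · subst h; simp [ee]
        · simp [ee, h, Pi.single_apply, Ne.symm h]
    · rcases D with i | i
      · exact UC.zero _ _
      · by_cases h : i = 0
        · subst h
          simp only [if_true, cost_inr, wi_zero, wt_inr]
          have := (ih (n - 2) (by simp at hD; omega) (a - 1)).smul a
          convert this using 1
          push_cast; ring
        · simp only [h, if_false]; exact UC.zero _ _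

lemma sq_le_sq_sum (v : Pt d) (i : Fin d) : v i.succ ^ 2 ≤ sq v :=
  Finset.single_le_sum (f := fun i : Fin d => v i.succ ^ 2) (fun _ _ => sq_nonneg _)
    (Finset.mem_univ i)

lemma abs_coord_le {ε : ℝ} (hε : 0 < ε) {v : Pt d} (hv : 0 < v 0) (i : Fin d) :
    |v i.succ| ≤ (2 * Real.sqrt ε)⁻¹ * v 0 ^ (1 / 2 : ℝ) * gau (-ε) v := by
  rw [← Real.sqrt_eq_rpow]
  have h1 : ε * (sq v / v 0) + 1 ≤ gau (-ε) v := by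
    unfold gau
    have := Real.add_one_le_exp (ε * (sq v / v 0))
    simpa using this
  have hs := Real.sqrt_pos.2 hε
  have hu := Real.sqrt_pos.2 hv
  have e1 := Real.sq_sqrt hε.le
  have e2 := Real.sq_sqrt hv.le
  set p := Real.sqrt ε
  set q := Real.sqrt (v 0)
  have h2 : |v i.succ| ^ 2 ≤ sq v := by rw [sq_abs]; exact sq_le_sq_sum v i
  have h3 : 2 * p * |v i.succ| / q ≤ gau (-ε) v := by
    refine le_trans ?_ h1
    rw [← e1, ← e2, div_le_iff₀ hu]
    have h4 : p ^ 2 * (|v i.succ| ^ 2 / q ^ 2) ≤ p ^ 2 * (sq v / q ^ 2) := by gcongr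
    have h5 : 0 ≤ (p * (|v i.succ| / q) - 1) ^ 2 := sq_nonneg _
    have h6 : 2 * (p * (|v i.succ| / q)) ≤ p ^ 2 * (sq v / q ^ 2) + 1 := by
      have : (p * (|v i.succ| / q)) ^ 2 = p ^ 2 * (|v i.succ| ^ 2 / q ^ 2) := by
        rw [mul_pow, div_pow]
      nlinarith
    calc 2 * p * |v i.succ| = 2 * (p * (|v i.succ| / q)) * q := by field_simp
      _ ≤ _ := mul_le_mul_of_nonneg_right h6 hu.le
  calc |v i.succ| = (2 * p)⁻¹ * q * (2 * p * |v i.succ| / q) := by field_simp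
    _ ≤ _ := by gcongr

/-- Spatial coordinates of the difference variable. -/
lemma UC.coord (hT : 1 ≤ T) {ε : ℝ} (hε : 0 < ε) (n : ℕ) (i : Fin d) :
    UC δ T (-ε) n (1 / 2) (fun _ _ x => x.2 i.succ : Ker S d) := by
  refine UC.mk hT ⟨(2 * Real.sqrt ε)⁻¹, by positivity, fun s b => by fun_prop, fun s x hx => ?_⟩
    (fun D _ _ _ => (ee D).2 i.succ) (fun D hD s b x hx => hasLine_coord _ _ _) (fun D hD => ?_)
  · have := abs_coord_le hε hx.1 i
    refine ⟨fun _ => this, ?_⟩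
    have h0 := (abs_nonneg _).trans this
    simp only [sub_self, abs_zero]
    exact mul_nonneg (δ s).2 h0
  · rcases D with j | j
    · simp only [ee, Pi.zero_apply]; exact UC.zero _ _
    · by_cases h : j = i.succ
      · subst h
        simp only [cost_inr, wi_succ, Nat.cast_one, sub_self]
        exact (UC.const hT _ _).mono hT (by linarith) le_rfl
      · simp only [ee, Pi.single_apply, Ne.symm h, if_false]; exact UC.zero _ _

/-- Function classes on space-time. -/
inductive Fcl (δ : S → NNReal) (C : ℝ) : ℕ → (S → Bool → Pt d → ℝ) → Prop
  | mk {n : ℕ} {f : S → Bool → Pt d → ℝ} (cont : ∀ s b, Continuous (f s b))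
      (bd : ∀ s z, Bd (δ s) C (fun b => f s b z)) (df : Fin (d + 1) → S → Bool → Pt d → ℝ)
      (has : ∀ i, wi i ≤ n → ∀ s b z, HasLineDerivAt ℝ (f s b) (df i s b z) z (Pi.single i 1))
      (sub : ∀ i, wi i ≤ n → Fcl δ C (n - wi i) (df i)) : Fcl δ C n f

variable {f g : S → Bool → Pt d → ℝ}

lemma Fcl.of_le (h : Fcl δ C n f) : ∀ {m : ℕ}, m ≤ n → Fcl δ C m f := by
  induction h with
  | mk c bd df has sub ih =>
    intro m hm
    exact .mk c bd df (fun D hD => has D (hD.trans hm))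
      (fun D hD => ih D (hD.trans hm) (by omega))

lemma Fcl.cont (h : Fcl δ C n f) : ∀ s b, Continuous (f s b) := by cases h; assumption

lemma Fcl.bd (h : Fcl δ C n f) : ∀ s z, Bd (δ s) C (fun b => f s b z) := by cases h; assumption

lemma Fcl.exd (h : Fcl δ C n f) : ∃ df : Fin (d + 1) → S → Bool → Pt d → ℝ,
    (∀ i, wi i ≤ n → ∀ s b z, HasLineDerivAt ℝ (f s b) (df i s b z) z (Pi.single i 1)) ∧
    (∀ i, wi i ≤ n → Fcl δ C (n - wi i) (df i)) := by
  cases h with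
  | mk c bd df has sub => exact ⟨df, has, sub⟩

lemma Bd_abs {D M : ℝ} {g : Bool → ℝ} (hD : 0 ≤ D) (h : Bd D M g) : Bd D |M| g :=
  h.mono hD (le_abs_self M)

lemma Fcl.base (h : Fcl δ C n f) (φ : XX d → Pt d) (hφ : Continuous φ) :
    Base δ T 0 0 |C| (fun s b x => f s b (φ x) : Ker S d) := by
  refine ⟨abs_nonneg _, fun s b => ((h.cont s b).comp hφ).continuousOn, fun s x hx => ?_⟩
  have := Bd_abs (δ s).2 (h.bd s (φ x))
  simpa [gau] using this

lemma UC.fp (hT : 1 ≤ T) (h : Fcl δ C n f) : UC δ T 0 n 0 (fun s b x => f s b x.1 : Ker S d) := by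
  induction h with
  | @mk n f c bd df has sub ih =>
    refine UC.mk hT ⟨_, (Fcl.mk c bd df has sub).base _ continuous_fst⟩
      (fun D => match D with
        | Sum.inl i => fun s b x => df i s b x.1
        | Sum.inr i => 0) (fun D hD s b x hx => ?_) (fun D hD => ?_)
    · rcases D with i | i
      · have := has i hD s b x.1
        exact this
      · show HasDerivAt (fun t : ℝ => f s b (x.1 + t • 0)) 0 0
        simpa using hasDerivAt_const (0 : ℝ) (f s b x.1)
    · rcases D with i | i
      · simpa using ih i hD
      · exact UC.zero _ _

lemma UC.fpv (hT : 1 ≤ T) (h : Fcl δ C n f) :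
    UC δ T 0 n 0 (fun s b x => f s b (x.1 + x.2) : Ker S d) := by
  induction h with
  | @mk n f c bd df has sub ih =>
    refine UC.mk hT ⟨_, (Fcl.mk c bd df has sub).base _ (continuous_fst.add continuous_snd)⟩
      (fun D => match D with
        | Sum.inl i => fun s b x => df i s b (x.1 + x.2)
        | Sum.inr i => fun s b x => df i s b (x.1 + x.2)) (fun D hD s b x hx => ?_) (fun D hD => ?_)
    · rcases D with i | i
      · have := has i hD s b (x.1 + x.2)
        show HasDerivAt (fun t : ℝ => f s b (x.1 + t • Pi.single i 1 + (x.2 + t • 0))) _ 0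
        refine HasDerivAt.congr_of_eventuallyEq this (Eventually.of_forall fun t => ?_)
        show f s b _ = f s b _
        congr 1; simp; abel
      · have := has i hD s b (x.1 + x.2)
        show HasDerivAt (fun t : ℝ => f s b (x.1 + t • 0 + (x.2 + t • Pi.single i 1))) _ 0
        refine HasDerivAt.congr_of_eventuallyEq this (Eventually.of_forall fun t => ?_)
        show f s b _ = f s b _
        congr 1; simp; abel
    · rcases D with i | i
      · simpa using ih i hD
      · exact (ih i hD).mono hT le_rfl (by simp only [cost_inr]; linarith [show (0:ℝ) ≤ (wi i : ℝ) / 2 by positivity])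

lemma lip_coord {h : Pt d → ℝ} {h' : Fin (d + 1) → Pt d → ℝ} {M : ℝ}
    (hd : ∀ i z, HasLineDerivAt ℝ h (h' i z) z (Pi.single i 1)) (hM : ∀ i z, |h' i z| ≤ M)
    (p v : Pt d) : |h (p + v) - h p| ≤ M * ∑ i, |v i| := by
  classical
  have key : ∀ s : Finset (Fin (d + 1)),
      |h (p + ∑ i ∈ s, Pi.single i (v i)) - h p| ≤ M * ∑ i ∈ s, |v i| := by
    intro s
    induction s using Finset.induction_on with
    | empty => simp
    | insert a s ha ih =>
      rw [Finset.sum_insert ha, Finset.sum_insert ha]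
      have e : (Pi.single a (v a) : Pt d) = v a • Pi.single a 1 := by
        ext j; simp [Pi.single_apply]
      have h1 := mvt_line (f := h) (f' := h' a) (x := p + ∑ i ∈ s, Pi.single i (v i))
        (e := Pi.single a 1) (t := v a) (M := M) (fun τ _ => hd a _) (fun τ _ => hM a _)
      rw [show p + (Pi.single a (v a) + ∑ i ∈ s, Pi.single i (v i)) =
        p + ∑ i ∈ s, Pi.single i (v i) + v a • Pi.single a 1 by rw [← e]; abel]
      rw [show h (p + ∑ i ∈ s, Pi.single i (v i) + v a • Pi.single a 1) - h p =
        (h (p + ∑ i ∈ s, Pi.single i (v i) + v a • Pi.single a 1) -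
          h (p + ∑ i ∈ s, Pi.single i (v i))) + (h (p + ∑ i ∈ s, Pi.single i (v i)) - h p) by ring]
      refine (abs_add_le _ _).trans ?_
      rw [mul_add]
      exact add_le_add h1 ih
  have := key Finset.univ
  rwa [Finset.univ_sum_single] at this

lemma Fcl.diff_bd (h : Fcl δ C (n + 2) f) (s : S) (p v : Pt d) :
    Bd (δ s) (|C| * ∑ i, |v i|) (fun b => f s b p - f s b (p + v)) := by
  obtain ⟨df, h1, h2⟩ := h.exd
  have hw : ∀ i : Fin (d + 1), wi i ≤ n + 2 := fun i => by have := wi_le i; omega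
  refine ⟨fun b => ?_, ?_⟩
  · rw [abs_sub_comm]
    exact lip_coord (h' := fun i => df i s b) (fun i z => h1 i (hw i) s b z)
      (fun i z => (Bd_abs (δ s).2 ((h2 i (hw i)).bd s z)).1 b) p v
  · have := lip_coord (h := fun z => f s true z - f s false z)
      (h' := fun i z => df i s true z - df i s false z) (M := δ s * |C|)
      (fun i z => HasDerivAt.sub (h1 i (hw i) s true z) (h1 i (hw i) s false z))
      (fun i z => (Bd_abs (δ s).2 ((h2 i (hw i)).bd s z)).2) p v
    rw [abs_sub_comm] at this
    rw [← mul_assoc]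
    refine le_trans (le_of_eq ?_) this
    congr 1; ring

lemma sum_abs_le (hT : 1 ≤ T) {ε : ℝ} (hε : 0 < ε) {v : Pt d} (hv : 0 < v 0) (hv' : v 0 < T) :
    ∑ i, |v i| ≤ (T + d * (2 * Real.sqrt ε)⁻¹) * v 0 ^ (1 / 2 : ℝ) * gau (-ε) v := by
  rw [Fin.sum_univ_succ, add_mul, add_mul]
  refine add_le_add ?_ ?_
  · rw [abs_of_pos hv]
    have h1 : 1 ≤ gau (-ε) v := by
      have := gau_mono (κ := 0) (κ' := -ε) (by linarith) hv
      simpa [gau] using this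
    have h2 : v 0 ≤ T * v 0 ^ (1 / 2 : ℝ) := by
      have e : v 0 = v 0 ^ (1 / 2 : ℝ) * v 0 ^ (1 / 2 : ℝ) := by
        rw [← Real.rpow_add hv]; norm_num
      have h3 : v 0 ^ (1 / 2 : ℝ) ≤ T := by
        calc v 0 ^ (1 / 2 : ℝ) ≤ T ^ (1 / 2 : ℝ) := Real.rpow_le_rpow hv.le hv'.le (by norm_num)
          _ ≤ T ^ (1 : ℝ) := Real.rpow_le_rpow_of_exponent_le hT (by norm_num)
          _ = T := Real.rpow_one T
      nlinarith [mul_le_mul_of_nonneg_right h3 (Real.rpow_nonneg hv.le (1 / 2 : ℝ))]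
    calc v 0 ≤ T * v 0 ^ (1 / 2 : ℝ) := h2
      _ = T * v 0 ^ (1 / 2 : ℝ) * 1 := by ring
      _ ≤ _ := mul_le_mul_of_nonneg_left h1 (hv.le.trans h2)
  · calc ∑ i : Fin d, |v i.succ| ≤ ∑ i : Fin d, (2 * Real.sqrt ε)⁻¹ * v 0 ^ (1 / 2 : ℝ) * gau (-ε) v :=
        Finset.sum_le_sum fun i _ => abs_coord_le hε hv i
      _ = _ := by simp; ring

/-- Increments of coefficients. -/
lemma UC.fdiff (hT : 1 ≤ T) {ε : ℝ} (hε : 0 < ε) : ∀ (n : ℕ) {f : S → Bool → Pt d → ℝ},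
    Fcl δ C (n + 2) f →
    UC δ T (-ε) n (1 / 2) (fun s b x => f s b x.1 - f s b (x.1 + x.2) : Ker S d) := by
  intro n
  induction n using Nat.strong_induction_on with
  | _ n ih =>
    intro f h
    obtain ⟨df, h1, h2⟩ := h.exd
    have c0 : 0 ≤ T + d * (2 * Real.sqrt ε)⁻¹ := by positivity
    obtain ⟨dA, hA, -⟩ := (UC.fp (T := T) hT h).exd
    refine UC.mk hT ⟨|C| * (T + d * (2 * Real.sqrt ε)⁻¹), mul_nonneg (abs_nonneg _) c0, fun s b => ?_,
      fun s x hx => ?_⟩ (fun D => match D with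
        | Sum.inl i => fun s b x => df i s b x.1 - df i s b (x.1 + x.2)
        | Sum.inr i => - fun s b x => df i s b (x.1 + x.2)) (fun D hD s b x hx => ?_) (fun D hD => ?_)
    · have := h.cont s b
      exact Continuous.continuousOn (by fun_prop)
    · refine (h.diff_bd s x.1 x.2).mono (δ s).2 ?_
      have := mul_le_mul_of_nonneg_left (sum_abs_le hT hε hx.1 hx.2) (abs_nonneg C)
      refine this.trans (le_of_eq (by ring))
    · rcases D with i | i
      · have hi : wi i ≤ n + 2 := by simp at hD; omega
        refine HasDerivAt.sub (h1 i hi s b x.1) ?_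
        have := h1 i hi s b (x.1 + x.2)
        refine HasDerivAt.congr_of_eventuallyEq this (Eventually.of_forall fun t => ?_)
        show f s b _ = f s b _
        congr 1; simp [ee]; abel
      · have hi : wi i ≤ n + 2 := by simp at hD; omega
        have := h1 i hi s b (x.1 + x.2)
        have h3 : HasDerivAt (fun t : ℝ => f s b x.1 - f s b (x.1 + x.2 + t • Pi.single i 1)) _ 0 :=
          HasDerivAt.const_sub (f s b x.1) this
        refine HasDerivAt.congr_of_eventuallyEq h3 (Eventually.of_forall fun t => ?_)
        simp [ee, add_assoc]
    · rcases D with i | i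
      · have hi : wi i ≤ n + 2 := by simp at hD; omega
        have hw := wi_pos i
        have := ih (n - wi i) (by simp at hD; omega) (f := df i) ((h2 i hi).of_le (by simp at hD; omega))
        simpa using this
      · have hi : wi i ≤ n + 2 := by simp at hD; omega
        have := (UC.fpv (T := T) hT ((h2 i hi).of_le (show n - wi i ≤ _ by omega))).neg
        refine this.mono hT (by linarith) ?_
        have hw : (1 : ℝ) ≤ wi i := by exact_mod_cast wi_pos i
        simp only [cost_inr]; linarith

/-- Real powers of a kernel bounded below. -/
lemma UC.rpow (hT : 1 ≤ T) {c : ℝ} (hc : 0 < c) : ∀ (n : ℕ) (a : ℝ) {Φ : Ker S d},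
    UC δ T 0 n 0 Φ → (∀ s b, ∀ x ∈ UU d T, c ≤ Φ s b x) →
    UC δ T 0 n 0 (fun s b x => Φ s b x ^ a) := by
  intro n
  induction n using Nat.strong_induction_on with
  | _ n ih =>
    intro a Φ h hcΦ
    obtain ⟨dΦ, h1, h2⟩ := h.exd
    obtain ⟨M, hb⟩ := h.base
    have hbd : ∀ s, ∀ x ∈ UU d T, Bd (δ s) M (fun b => Φ s b x) := by
      intro s x hx; simpa [gau] using hb.bd s x hx
    have hco : ∀ e : ℝ, ContinuousOn (fun t : ℝ => t ^ e) (Set.Icc c M) := fun e t ht =>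
      (Real.continuousAt_rpow_const t e (Or.inl (hc.trans_le ht.1).ne')).continuousWithinAt
    obtain ⟨K1, hK1⟩ := isCompact_Icc.exists_bound_of_continuousOn (hco a)
    obtain ⟨K2, hK2⟩ := isCompact_Icc.exists_bound_of_continuousOn
      ((hco (a - 1)).const_smul a)
    refine UC.mk hT ⟨|K1| + |K2| * M, add_nonneg (abs_nonneg _) (mul_nonneg (abs_nonneg _) hb.nn),
      fun s b => ?_, fun s x hx => ?_⟩
      (fun D => a • ((fun s b x => Φ s b x ^ (a - 1)) * dΦ D)) (fun D hD s b x hx => ?_) (fun D hD => ?_)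
    · exact (hb.cont s b).rpow_const fun x hx => Or.inl (hc.trans_le (hcΦ s b x hx)).ne'
    · have hm : ∀ b, Φ s b x ∈ Set.Icc c M := fun b =>
        ⟨hcΦ s b x hx, (le_abs_self _).trans ((hbd s x hx).1 b)⟩
      have hK1' : ∀ b, |Φ s b x ^ a| ≤ |K1| := fun b => (hK1 _ (hm b)).trans (le_abs_self _)
      have p2 : 0 ≤ |K2| * M := mul_nonneg (abs_nonneg _) hb.nn
      simp only [gau, zero_mul, neg_zero, Real.exp_zero, Real.rpow_zero, mul_one]
      refine ⟨fun b => (hK1' b).trans (by linarith), ?_⟩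
      have hmv := Convex.norm_image_sub_le_of_norm_hasDerivWithin_le (s := Set.Icc c M)
        (f := fun t : ℝ => t ^ a) (f' := fun t => a * t ^ (a - 1)) (C := |K2|)
        (x := Φ s false x) (y := Φ s true x)
        (fun t ht => (Real.hasDerivAt_rpow_const (Or.inl (hc.trans_le ht.1).ne')).hasDerivWithinAt)
        (fun t ht => (hK2 t ht).trans (le_abs_self _)) (convex_Icc c M) (hm false) (hm true)
      simp only [Real.norm_eq_abs] at hmv
      have h3 := mul_le_mul_of_nonneg_left (hbd s x hx).2 (abs_nonneg K2)
      have h4 : 0 ≤ (δ s : ℝ) * |K1| := by positivity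
      calc _ ≤ |K2| * |Φ s true x - Φ s false x| := hmv
        _ ≤ |K2| * (δ s * M) := h3
        _ ≤ _ := by rw [mul_add]; linarith
    · have h3 := HasDerivAt.rpow_const (p := a) (h1 D hD s b x hx)
        (Or.inl (by simpa using (hc.trans_le (hcΦ s b x hx)).ne'))
      have h4 : HasLineDerivAt ℝ (fun y : XX d => Φ s b y ^ a) _ x (ee D) := h3
      convert h4 using 1
      simp; ring
    · have hp := wt_pos D
      have h3 := ih (n - wt D) (by omega) (a - 1) (h.of_le (Nat.sub_le n (wt D))) hcΦ
      have h4 := ((h3.mul hT (h2 D hD)).smul a)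
      simpa using h4

/-- Gaussian-type exponentials. -/
lemma UC.exp (hT : 1 ≤ T) {κ₀ : ℝ} {Q : Ker S d}
    (hQ0 : ∀ s b, ∀ x ∈ UU d T, κ₀ * (sq x.2 / x.2 0) ≤ Q s b x) : ∀ (n : ℕ),
    (∀ ε > 0, UC δ T (-ε) n 0 Q) → ∀ ε > 0,
    UC δ T (κ₀ - ε) n 0 (fun s b x => Real.exp (-Q s b x)) := by
  intro n
  induction n using Nat.strong_induction_on with
  | _ n ih =>
    intro hQ ε hε
    obtain ⟨dQ, h1, h2⟩ := (hQ (ε / 2) (half_pos hε)).exd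
    obtain ⟨M, hb⟩ := (hQ ε hε).base
    refine UC.mk hT ⟨1 + M, add_nonneg zero_le_one hb.nn, fun s b => ?_, fun s x hx => ?_⟩
      (fun D => - (dQ D * (fun s b x => Real.exp (-Q s b x)))) (fun D hD s b x hx => ?_) (fun D hD => ?_)
    · exact Real.continuous_exp.comp_continuousOn (hb.cont s b).neg
    · have hg : ∀ b, Real.exp (-Q s b x) ≤ gau κ₀ x.2 := fun b => by
        unfold gau; exact Real.exp_le_exp.2 (neg_le_neg (hQ0 s b x hx))
      have hg2 : gau κ₀ x.2 ≤ gau (κ₀ - ε) x.2 := gau_mono (by linarith) hx.1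
      have hgp := gau_pos (κ₀ - ε) x.2
      have hbb := hb.bd s x hx
      simp only [Real.rpow_zero, mul_one] at hbb ⊢
      refine ⟨fun b => ?_, ?_⟩
      · rw [abs_of_pos (Real.exp_pos _)]
        have := mul_nonneg hb.nn hgp.le
        have := hg b
        nlinarith
      · have hmv := Convex.norm_image_sub_le_of_norm_hasDerivWithin_le
          (s := Set.Ici (κ₀ * (sq x.2 / x.2 0)))
          (f := fun t : ℝ => Real.exp (-t)) (f' := fun t => - Real.exp (-t)) (C := gau κ₀ x.2)
          (x := Q s false x) (y := Q s true x)
          (fun t ht => by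
            have := ((hasDerivAt_id t).neg.exp).hasDerivWithinAt (s := Set.Ici (κ₀ * (sq x.2 / x.2 0)))
            simpa using this)
          (fun t ht => by
            rw [norm_neg, Real.norm_eq_abs, abs_of_pos (Real.exp_pos _)]
            exact Real.exp_le_exp.2 (neg_le_neg ht)) (convex_Ici _)
          (hQ0 s false x hx) (hQ0 s true x hx)
        simp only [Real.norm_eq_abs] at hmv
        have h3 := mul_le_mul_of_nonneg_left hbb.2 (gau_pos κ₀ x.2).le
        have e : gau κ₀ x.2 * (↑(δ s) * (M * gau (-ε) x.2)) = δ s * (M * gau (κ₀ - ε) x.2) := by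
          rw [sub_eq_add_neg κ₀ ε, gau_add]; ring
        have h4 : 0 ≤ (δ s : ℝ) * gau (κ₀ - ε) x.2 := mul_nonneg (δ s).2 hgp.le
        calc _ ≤ gau κ₀ x.2 * |Q s true x - Q s false x| := hmv
          _ ≤ _ := h3
          _ = _ := e
          _ ≤ _ := by rw [add_mul, mul_add, one_mul]; linarith
    · have h3 := HasDerivAt.exp (HasDerivAt.neg (h1 D hD s b x hx))
      have h4 : HasLineDerivAt ℝ (fun y : XX d => Real.exp (-Q s b y)) _ x (ee D) := h3
      convert h4 using 1
      simp; ring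
    · have hp := wt_pos D
      have h3 := ih (n - wt D) (by omega) (fun ε hε => (hQ ε hε).of_le (Nat.sub_le n (wt D)))
        (ε / 2) (half_pos hε)
      have h4 := ((h2 D hD).mul hT h3).neg
      refine h4.mono hT (by linarith) (by linarith)

end VarBPHZ

open MeasureTheory Filter
open scoped BigOperators ENNReal

namespace VarBPHZ

set_option linter.unusedVariables false
set_option linter.unusedSimpArgs false
set_option linter.unusedSectionVars false

variable {d : ℕ}
variable {S : Type*} {δ : S → NNReal} {T κ κ' κ₁ κ₂ γ γ' γ₁ γ₂ C C' C₁ C₂ : ℝ} {n n' : ℕ}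
  {Φ Φ' Ψ Ψ' : Ker S d}

/-! ## Coefficients -/

lemma pdeg_add (k : Fin (d + 1) → ℕ) (i : Fin (d + 1)) :
    pdeg (k + Pi.single i 1) = pdeg k + wi i := by
  unfold pdeg wi
  simp only [Pi.add_apply, Finset.sum_add_distrib, Finset.sum_pi_single', Finset.mem_univ, if_true]
  by_cases h : i = 0
  · subst h; simp; omega
  · have : (Pi.single i 1 : Fin (d + 1) → ℕ) 0 = 0 := by simp [Pi.single_apply, Ne.symm h]
    simp [this, h]; omega

lemma foldr_congr_mem {α β : Type*} (l : List α) (F G : α → β → β) (b : β)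
    (h : ∀ a ∈ l, F a = G a) : l.foldr F b = l.foldr G b := by
  induction l with
  | nil => rfl
  | cons a l ih =>
    simp only [List.foldr_cons]
    rw [ih fun a ha => h a (by simp [ha]), h a (by simp)]

lemma mderiv_succ (k : Fin (d + 1) → ℕ) (i : Fin (d + 1)) (hk : ∀ j < i, k j = 0)
    (f : Pt d → ℝ) : mderiv (k + Pi.single i 1) f = pd i (mderiv k f) := by
  unfold mderiv
  obtain ⟨s, t, hst⟩ := List.append_of_mem (List.mem_finRange i)
  have hp := List.pairwise_lt_finRange (d + 1)
  rw [hst] at hp ⊢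
  rw [List.pairwise_append, List.pairwise_cons] at hp
  obtain ⟨_, ⟨h2, _⟩, h3⟩ := hp
  simp only [List.foldr_append, List.foldr_cons]
  have hs : ∀ a ∈ s, k a = 0 := fun a ha => hk a (h3 a ha i (by simp))
  have e1 : ∀ (k' : Fin (d + 1) → ℕ) (b : Pt d → ℝ), (∀ a ∈ s, k' a = 0) →
      s.foldr (fun i g => (pd i)^[k' i] g) b = b := by
    intro k' b hk'
    rw [foldr_congr_mem s _ (fun _ g => g) b (fun a ha => by funext g; simp [hk' a ha])]
    exact List.foldr_fixed s
  rw [e1 k _ hs, e1 _ _ (fun a ha => by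
    have : a ≠ i := (h3 a ha i (by simp)).ne
    simp [hs a ha, Pi.single_apply, this])]
  rw [foldr_congr_mem t _ (fun i g => (pd i)^[k i] g) f (fun a ha => by
    have : a ≠ i := (h2 a ha).ne'
    funext g; simp [Pi.single_apply, this])]
  simp only [Pi.add_apply, Pi.single_eq_same, Function.iterate_succ_apply']

lemma mderiv_zero (f : Pt d → ℝ) : mderiv (0 : Fin (d + 1) → ℕ) f = f := by
  unfold mderiv
  simp only [Pi.zero_apply, Function.iterate_zero, id]
  exact List.foldr_fixed _

/-- Decompose a nonzero multi-index canonically. -/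
lemma exists_canon (k : Fin (d + 1) → ℕ) (hk : k ≠ 0) :
    ∃ (j : Fin (d + 1)) (k' : Fin (d + 1) → ℕ), k = k' + Pi.single j 1 ∧ ∀ l < j, k' l = 0 := by
  classical
  have hne : (Finset.univ.filter fun j => k j ≠ 0).Nonempty := by
    by_contra h
    rw [Finset.not_nonempty_iff_eq_empty, Finset.filter_eq_empty_iff] at h
    apply hk; funext j; simpa using h (Finset.mem_univ j)
  set j := (Finset.univ.filter fun j => k j ≠ 0).min' hne with hj
  have h1 : k j ≠ 0 := by
    have := Finset.min'_mem _ hne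
    exact (Finset.mem_filter.1 this).2
  have h2 : ∀ l < j, k l = 0 := by
    intro l hl
    by_contra h
    have := Finset.min'_le (Finset.univ.filter fun j => k j ≠ 0) l
      (Finset.mem_filter.2 ⟨Finset.mem_univ l, h⟩)
    exact absurd hl (not_lt.2 this)
  refine ⟨j, k - Pi.single j 1, ?_, fun l hl => ?_⟩
  · funext l
    by_cases h : l = j
    · subst h; simp; omega
    · simp [Pi.single_apply, h]
  · simp [h2 l hl]

lemma canon_ind {P : (Fin (d + 1) → ℕ) → Prop} (h0 : P 0)
    (hs : ∀ k j, (∀ l < j, k l = 0) → P k → P (k + Pi.single j 1)) : ∀ k, P k := by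
  have : ∀ m k, pdeg k = m → P k := by
    intro m
    induction m using Nat.strong_induction_on with
    | _ m ih =>
      intro k hk
      by_cases h : k = 0
      · subst h; exact h0
      · obtain ⟨j, k', rfl, hj⟩ := exists_canon k h
        rw [pdeg_add] at hk
        have := wi_pos j
        exact hs k' j hj (ih _ (by omega) k' rfl)
  exact fun k => this _ k rfl

lemma hasLine_pd {f : Pt d → ℝ} {z : Pt d} (h : DifferentiableAt ℝ f z) (i : Fin (d + 1)) :
    HasLineDerivAt ℝ f (pd i f z) z (Pi.single i 1) := h.hasFDerivAt.hasLineDerivAt _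

/-- The tower property. -/
lemma MemCpar.tower {ρ : ℕ} {f : Pt d → ℝ} (hf : MemCpar ρ f) : ∀ (k : Fin (d + 1) → ℕ)
    (i : Fin (d + 1)), pdeg k + wi i ≤ ρ → ∀ z,
    HasLineDerivAt ℝ (mderiv k f) (mderiv (k + Pi.single i 1) f z) z (Pi.single i 1) := by
  have canon : ∀ (k : Fin (d + 1) → ℕ) (i : Fin (d + 1)), (∀ l < i, k l = 0) →
      pdeg k + wi i ≤ ρ → ∀ z,
      HasLineDerivAt ℝ (mderiv k f) (mderiv (k + Pi.single i 1) f z) z (Pi.single i 1) := by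
    intro k i hk hd z
    rw [mderiv_succ k i hk]
    have := wi_pos i
    exact hasLine_pd (hf.1 k (by omega) z) i
  intro k
  induction k using canon_ind with
  | h0 => intro i; exact canon 0 i (fun _ _ => rfl)
  | hs k j hj ih =>
    intro i hd
    by_cases hij : ∀ l < i, (k + Pi.single j 1 : Fin (d + 1) → ℕ) l = 0
    · exact canon _ i hij hd
    · have hji : j < i := by
        by_contra h
        apply hij
        intro l hl
        have : l < j := lt_of_lt_of_le hl (not_lt.1 h)
        simp [hj l this, Pi.single_apply, this.ne]
      rw [pdeg_add] at hd
      have e : k + Pi.single j 1 + Pi.single i 1 = k + Pi.single i 1 + Pi.single j 1 := by abel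
      rw [e]
      have h1 := ih i (by omega)
      have h2 := ih j (by omega)
      have h3 := canon (k + Pi.single i 1) j (fun l hl => by
        simp [hj l hl, Pi.single_apply, (hl.trans hji).ne]) (by rw [pdeg_add]; omega)
      have h4 := (hf.2 (k + Pi.single i 1 + Pi.single j 1) (by rw [pdeg_add, pdeg_add]; omega)).1
      intro z
      exact line_comm isOpen_univ (fun x _ => h1 x) (fun x _ => h2 x) (fun x _ => h3 x)
        h4.continuousOn z trivial

lemma mderiv_sub {ρ : ℕ} {f g : Pt d → ℝ} (hf : MemCpar ρ f) (hg : MemCpar ρ g) :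
    ∀ k, pdeg k ≤ ρ → mderiv k (fun z => f z - g z) = fun z => mderiv k f z - mderiv k g z := by
  intro k
  induction k using canon_ind with
  | h0 => intro _; simp only [mderiv_zero]
  | hs k j hj ih =>
    intro hk
    rw [pdeg_add] at hk
    have := wi_pos j
    rw [mderiv_succ k j hj, mderiv_succ k j hj, mderiv_succ k j hj, ih (by omega)]
    funext z
    unfold pd
    have := fderiv_sub (hf.1 k (by omega) z) (hg.1 k (by omega) z)
    have e : (fun z => mderiv k f z - mderiv k g z) = mderiv k f - mderiv k g := rfl
    rw [e, this]; rfl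

lemma MemCpar.sub {ρ : ℕ} {f g : Pt d → ℝ} (hf : MemCpar ρ f) (hg : MemCpar ρ g) :
    MemCpar ρ (fun z => f z - g z) := by
  refine ⟨fun k hk => ?_, fun k hk => ?_⟩
  · rw [mderiv_sub hf hg k hk.le]; exact (hf.1 k hk).sub (hg.1 k hk)
  · rw [mderiv_sub hf hg k hk]
    refine ⟨(hf.2 k hk).1.sub (hg.2 k hk).1, ?_⟩
    obtain ⟨M, hM⟩ := (hf.2 k hk).2
    obtain ⟨N, hN⟩ := (hg.2 k hk).2
    exact ⟨M + N, fun z => (abs_sub _ _).trans (add_le_add (hM z) (hN z))⟩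

lemma pdeg_finite (ρ : ℕ) : {k : Fin (d + 1) → ℕ | pdeg k ≤ ρ}.Finite := by
  refine (Set.finite_Iic (fun _ => ρ : Fin (d + 1) → ℕ)).subset fun k hk i => ?_
  have h1 : k i ≤ ∑ i, k i := Finset.single_le_sum (fun _ _ => Nat.zero_le _) (Finset.mem_univ i)
  have : pdeg k ≤ ρ := hk
  unfold pdeg at this
  show k i ≤ ρ
  omega

lemma MemCpar.bddAbove {ρ : ℕ} {f : Pt d → ℝ} (hf : MemCpar ρ f) :
    BddAbove {y | ∃ (k : Fin (d + 1) → ℕ) (z : Pt d), pdeg k ≤ ρ ∧ y = |mderiv k f z|} := by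
  have h := fun k (hk : pdeg k ≤ ρ) => (hf.2 k hk).2
  choose! M hM using h
  refine ⟨∑ k ∈ (pdeg_finite ρ).toFinset, |M k|, ?_⟩
  rintro y ⟨k, z, hk, rfl⟩
  refine ((hM k hk z).trans (le_abs_self _)).trans ?_
  exact Finset.single_le_sum (f := fun k => |M k|) (fun _ _ => abs_nonneg _)
    ((pdeg_finite ρ).mem_toFinset.2 hk)

lemma MemCpar.le_norm {ρ : ℕ} {f : Pt d → ℝ} (hf : MemCpar ρ f) {k : Fin (d + 1) → ℕ}
    (hk : pdeg k ≤ ρ) (z : Pt d) : |mderiv k f z| ≤ cparNorm ρ f :=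
  le_csSup hf.bddAbove ⟨k, z, hk, rfl⟩

lemma cparNorm_nonneg (ρ : ℕ) (f : Pt d → ℝ) : 0 ≤ cparNorm ρ f := by
  apply Real.sSup_nonneg
  rintro y ⟨k, z, -, rfl⟩
  exact abs_nonneg _

lemma Fcl.of_bounds {ρ : ℕ} {f : S → Bool → Pt d → ℝ} {M : ℝ} (hf : ∀ s b, MemCpar ρ (f s b))
    (hb : ∀ k, pdeg k ≤ ρ → ∀ s z, Bd (δ s) M (fun b => mderiv k (f s b) z)) :
    Fcl δ M ρ f := by
  have key : ∀ m k, pdeg k + m = ρ → Fcl δ M m (fun s b => mderiv k (f s b)) := by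
    intro m
    induction m using Nat.strong_induction_on with
    | _ m ih =>
      intro k hk
      refine .mk (fun s b => ((hf s b).2 k (by omega)).1) (hb k (by omega))
        (fun i s b => mderiv (k + Pi.single i 1) (f s b))
        (fun i hi s b z => (hf s b).tower k i (by omega) z) (fun i hi => ?_)
      have := wi_pos i
      exact ih (m - wi i) (by omega) _ (by rw [pdeg_add]; omega)
  have := key ρ 0 (by simp [pdeg])
  simpa only [mderiv_zero] using this

lemma Fcl.of_two {ρ : ℕ} {f : S → Bool → Pt d → ℝ} {M : ℝ} (hM : 1 ≤ M)
    (hf : ∀ s b, MemCpar ρ (f s b)) (h1 : ∀ s b, cparNorm ρ (f s b) ≤ M)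
    (h2 : ∀ s, cparNorm ρ (fun z => f s true z - f s false z) ≤ δ s) : Fcl δ M ρ f := by
  refine Fcl.of_bounds hf fun k hk s z => ⟨fun b => ((hf s b).le_norm hk z).trans (h1 s b), ?_⟩
  have := ((hf s true).sub (hf s false)).le_norm hk z
  rw [mderiv_sub (hf s true) (hf s false) k hk] at this
  refine (this.trans (h2 s)).trans ?_
  have := (δ s).2
  exact le_mul_of_one_le_right this hM

/-- Standing assumptions on a family of pairs of coefficient fields. -/
structure Dat (δ : S → NNReal) (lam : ℝ) (ρ : ℕ) (M : ℝ) (A : S → Bool → Coeffs d) : Prop where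
  par : ∀ s b, ParReg lam ρ (A s b)
  fa : ∀ i j, Fcl δ M ρ (fun s b z => (A s b).a z i j)
  fb : ∀ i, Fcl δ M ρ (fun s b z => (A s b).b z i)
  fc : Fcl δ M ρ (fun s b z => (A s b).c z)

lemma cparNorm_le_add {ρ : ℕ} {f g : Pt d → ℝ} (hf : MemCpar ρ f) (hg : MemCpar ρ g) :
    cparNorm ρ g ≤ cparNorm ρ f + cparNorm ρ (fun z => f z - g z) := by
  refine Real.sSup_le ?_ (add_nonneg (cparNorm_nonneg _ _) (cparNorm_nonneg _ _))
  rintro y ⟨k, z, hk, rfl⟩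
  have h1 := hf.le_norm hk z
  have h2 := (hf.sub hg).le_norm hk z
  rw [mderiv_sub hf hg k hk] at h2
  have : mderiv k g z = mderiv k f z - (mderiv k f z - mderiv k g z) := by ring
  rw [this]
  exact (abs_sub _ _).trans (add_le_add h1 h2)

lemma coeff_parts {ρ : ℕ} (A : Coeffs d) :
    (∀ i j, cparNorm ρ (fun z => A.a z i j) ≤ coeffNorm ρ A) ∧
    (∀ i, cparNorm ρ (fun z => A.b z i) ≤ coeffNorm ρ A) ∧ cparNorm ρ A.c ≤ coeffNorm ρ A := by
  have b1 : BddAbove {y | ∃ i j, y = cparNorm ρ fun z => A.a z i j} := by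
    refine (Set.Finite.subset (Set.finite_range fun p : Fin d × Fin d =>
      cparNorm ρ fun z => A.a z p.1 p.2) ?_).bddAbove
    rintro y ⟨i, j, rfl⟩; exact ⟨(i, j), rfl⟩
  have b2 : BddAbove {y | ∃ i, y = cparNorm ρ fun z => A.b z i} := by
    refine (Set.Finite.subset (Set.finite_range fun p : Fin d =>
      cparNorm ρ fun z => A.b z p) ?_).bddAbove
    rintro y ⟨i, rfl⟩; exact ⟨i, rfl⟩
  have n1 : 0 ≤ sSup {y | ∃ i j, y = cparNorm ρ fun z => A.a z i j} :=
    Real.sSup_nonneg (by rintro y ⟨i, j, rfl⟩; exact cparNorm_nonneg _ _)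
  have n2 : 0 ≤ sSup {y | ∃ i, y = cparNorm ρ fun z => A.b z i} :=
    Real.sSup_nonneg (by rintro y ⟨i, rfl⟩; exact cparNorm_nonneg _ _)
  have n3 := cparNorm_nonneg ρ A.c
  unfold coeffNorm
  refine ⟨fun i j => ?_, fun i => ?_, ?_⟩
  · have := le_csSup b1 ⟨i, j, rfl⟩; linarith
  · have := le_csSup b2 ⟨i, rfl⟩; linarith
  · linarith

lemma coeffNorm_nonneg (ρ : ℕ) (A : Coeffs d) : 0 ≤ coeffNorm ρ A :=
  (cparNorm_nonneg _ _).trans (coeff_parts A).2.2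

lemma mkDat {lam : ℝ} {ρ : ℕ} {A₀ : Coeffs d} (hA : ParReg lam ρ A₀) (B : S → Coeffs d)
    (hB : ∀ s, ParReg lam ρ (B s)) (h1 : ∀ s, coeffDist ρ A₀ (B s) ≤ 1) :
    ∃ M, Dat (fun s => (coeffDist ρ A₀ (B s)).toNNReal) lam ρ M
      (fun s b => if b then A₀ else B s) := by
  set M := coeffNorm ρ A₀ + 1
  have hM : 1 ≤ M := by have := coeffNorm_nonneg ρ A₀; simp only [M]; linarith
  have hδ : ∀ s, ((coeffDist ρ A₀ (B s)).toNNReal : ℝ) = coeffDist ρ A₀ (B s) := fun s =>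
    Real.coe_toNNReal _ (coeffNorm_nonneg _ _)
  obtain ⟨pa, pb, pc⟩ := coeff_parts (ρ := ρ) A₀
  refine ⟨M, ⟨fun s b => ?_, fun i j => ?_, fun i => ?_, ?_⟩⟩
  · cases b
    · simpa using hB s
    · simpa using hA
  · refine Fcl.of_two hM (fun s b => ?_) (fun s b => ?_) (fun s => ?_)
    · cases b
      · simpa using (hB s).areg i j
      · simpa using hA.areg i j
    · cases b
      · have := cparNorm_le_add (hA.areg i j) ((hB s).areg i j)
        have h3 := (coeff_parts (ρ := ρ) (coeffSub A₀ (B s))).1 i j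
        have h4 : cparNorm ρ (fun z => A₀.a z i j - (B s).a z i j) ≤ 1 := h3.trans (h1 s)
        have h5 := pa i j
        simp only [M, Bool.false_eq_true, if_false]; linarith
      · have := pa i j
        simp only [M, if_true]; linarith
    · rw [hδ]; exact (coeff_parts (ρ := ρ) (coeffSub A₀ (B s))).1 i j
  · refine Fcl.of_two hM (fun s b => ?_) (fun s b => ?_) (fun s => ?_)
    · cases b
      · simpa using (hB s).breg i
      · simpa using hA.breg i
    · cases b
      · have := cparNorm_le_add (hA.breg i) ((hB s).breg i)
        have h3 := (coeff_parts (ρ := ρ) (coeffSub A₀ (B s))).2.1 i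
        have h4 : cparNorm ρ (fun z => A₀.b z i - (B s).b z i) ≤ 1 := h3.trans (h1 s)
        have h5 := pb i
        simp only [M, Bool.false_eq_true, if_false]; linarith
      · have := pb i
        simp only [M, if_true]; linarith
    · rw [hδ]; exact (coeff_parts (ρ := ρ) (coeffSub A₀ (B s))).2.1 i
  · refine Fcl.of_two hM (fun s b => ?_) (fun s b => ?_) (fun s => ?_)
    · cases b
      · simpa using (hB s).creg
      · simpa using hA.creg
    · cases b
      · have := cparNorm_le_add (hA.creg) ((hB s).creg)
        have h3 := (coeff_parts (ρ := ρ) (coeffSub A₀ (B s))).2.2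
        have h4 : cparNorm ρ (fun z => A₀.c z - (B s).c z) ≤ 1 := h3.trans (h1 s)
        simp only [M, Bool.false_eq_true, if_false]; linarith
      · simp only [M, if_true]; linarith
    · rw [hδ]; exact (coeff_parts (ρ := ρ) (coeffSub A₀ (B s))).2.2

end VarBPHZ

open MeasureTheory Filter
open scoped BigOperators ENNReal

namespace VarBPHZ

set_option linter.unusedVariables false
set_option linter.unusedSimpArgs false
set_option linter.unusedSectionVars false

variable {d : ℕ}
variable {S : Type*} {δ : S → NNReal} {T κ κ' κ₁ κ₂ γ γ' γ₁ γ₂ C C' C₁ C₂ : ℝ} {n n' : ℕ}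
  {Φ Φ' Ψ Ψ' : Ker S d}

/-! ## The kernels `Z` and `E` in (base, difference) coordinates -/

lemma UC.det (hT : 1 ≤ T) {Mx : Fin d → Fin d → Ker S d} (h : ∀ i j, UC δ T 0 n 0 (Mx i j)) :
    UC δ T 0 n 0 (fun s b x => Matrix.det (Matrix.of fun i j => Mx i j s b x) : Ker S d) := by
  have h1 : UC δ T 0 n 0 (∑ σ : Equiv.Perm (Fin d), ((Equiv.Perm.sign σ : ℤ) : ℝ) •
      ∏ i, Mx (σ i) i) :=
    UC.sum hT _ fun σ _ => (UC.prod hT _ fun i _ => h _ _).smul _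
  refine h1.congr fun s b x _ => ?_
  rw [Matrix.det_apply]
  simp only [Finset.sum_apply, Pi.smul_apply, Finset.prod_apply, Matrix.of_apply, smul_eq_mul]
  refine Finset.sum_congr rfl fun σ _ => ?_
  rw [Units.smul_def, zsmul_eq_mul]

lemma det_pos_lower {lam : ℝ} (hlam : 0 < lam) {M : Matrix (Fin d) (Fin d) ℝ} (hs : M.IsSymm)
    (hl : ∀ ζ : Fin d → ℝ, lam * ∑ i, ζ i ^ 2 ≤ ∑ i, ∑ j, M i j * ζ i * ζ j) :
    lam ^ d ≤ M.det := by
  have hH : M.IsHermitian := by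
    rw [Matrix.IsHermitian, Matrix.conjTranspose_eq_transpose_of_trivial]; exact hs
  rw [hH.det_eq_prod_eigenvalues]
  have : ∀ i, lam ≤ hH.eigenvalues i := by
    intro i
    have h1 := hH.eigenvalues_eq i
    have h2 := hl (hH.eigenvectorBasis i)
    have h3 : ∑ j, (hH.eigenvectorBasis i : EuclideanSpace ℝ (Fin d)) j ^ 2 = 1 := by
      have := hH.eigenvectorBasis.orthonormal.1 i
      rw [EuclideanSpace.norm_eq, Real.sqrt_eq_one] at this
      simpa using this
    rw [h3, mul_one] at h2
    refine h2.trans (le_of_eq ?_)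
    rw [h1]
    simp only [dotProduct, Matrix.mulVec, Finset.mul_sum]
    simp
    refine Finset.sum_congr rfl fun a _ => Finset.sum_congr rfl fun b _ => by ring
  calc lam ^ d = ∏ _i : Fin d, lam := by simp
    _ ≤ ∏ i, hH.eigenvalues i := Finset.prod_le_prod (fun _ _ => hlam.le) fun i _ => this i
    _ = _ := by simp

lemma inv_lower {lam : ℝ} (hlam : 0 < lam) {M : Matrix (Fin d) (Fin d) ℝ} (hs : M.IsSymm)
    (hl : ∀ ζ : Fin d → ℝ, lam * ∑ i, ζ i ^ 2 ≤ ∑ i, ∑ j, M i j * ζ i * ζ j)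
    (hu : ∀ ζ : Fin d → ℝ, ∑ i, ∑ j, M i j * ζ i * ζ j ≤ lam⁻¹ * ∑ i, ζ i ^ 2) (ζ : Fin d → ℝ) :
    lam * ∑ i, ζ i ^ 2 ≤ ∑ i, ∑ j, M⁻¹ i j * ζ i * ζ j := by
  have hdet : IsUnit M.det := by
    have := det_pos_lower hlam hs hl
    have h0 : 0 < lam ^ d := by positivity
    exact (ne_of_gt (h0.trans_le this)).isUnit
  have form : ∀ (N : Matrix (Fin d) (Fin d) ℝ) (x y : Fin d → ℝ),
      ∑ i, ∑ j, N i j * x i * y j = x ⬝ᵥ (N.mulVec y) := by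
    intro N x y
    simp only [dotProduct, Matrix.mulVec, Finset.mul_sum]
    exact Finset.sum_congr rfl fun a _ => Finset.sum_congr rfl fun b _ => by ring
  have hsq : ∀ x : Fin d → ℝ, ∑ i, x i ^ 2 = x ⬝ᵥ x := by
    intro x; simp only [dotProduct, pow_two]
  set y := M⁻¹.mulVec ζ with hy
  have hMy : M.mulVec y = ζ := by
    rw [hy, Matrix.mulVec_mulVec, Matrix.mul_nonsing_inv _ hdet, Matrix.one_mulVec]
  have h1 := hl (lam • ζ - y)
  have h0 : 0 ≤ lam * ∑ i, (lam • ζ - y) i ^ 2 :=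
    mul_nonneg hlam.le (Finset.sum_nonneg fun _ _ => sq_nonneg _)
  have h2 := hu ζ
  rw [form] at h1 h2 ⊢
  rw [hsq] at h2 ⊢
  have hsym : y ⬝ᵥ M.mulVec ζ = ζ ⬝ᵥ ζ := by
    rw [Matrix.dotProduct_mulVec, ← Matrix.mulVec_transpose, hs, hMy]
  have e : (lam • ζ - y) ⬝ᵥ M.mulVec (lam • ζ - y) =
      lam ^ 2 * (ζ ⬝ᵥ M.mulVec ζ) - 2 * lam * (ζ ⬝ᵥ ζ) + ζ ⬝ᵥ y := by
    rw [Matrix.mulVec_sub, Matrix.mulVec_smul, hMy]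
    simp only [sub_dotProduct, dotProduct_sub, smul_dotProduct, dotProduct_smul, smul_eq_mul, hsym]
    rw [dotProduct_comm y ζ]; ring
  have h3 := h0.trans h1
  rw [e] at h3
  have h4 : lam ^ 2 * (ζ ⬝ᵥ M.mulVec ζ) ≤ lam * (ζ ⬝ᵥ ζ) := by
    calc _ ≤ lam ^ 2 * (lam⁻¹ * (ζ ⬝ᵥ ζ)) := mul_le_mul_of_nonneg_left h2 (sq_nonneg _)
      _ = _ := by field_simp
  linarith

section kernels

variable (A : S → Bool → Coeffs d)

noncomputable def kai (i j : Fin d) : Ker S d := fun s b x => ((A s b).a x.1)⁻¹ i j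

noncomputable def kQ : Ker S d := fun s b x =>
  (∑ i, ∑ j, kai A i j s b x * x.2 i.succ * x.2 j.succ) / (4 * x.2 0)

noncomputable def kW : Ker S d := fun s b x =>
  (4 * Real.pi) ^ (-(d : ℝ) / 2) * ((A s b).a x.1).det ^ (-(1 : ℝ) / 2) * x.2 0 ^ (-(d : ℝ) / 2) *
      Real.exp (-kQ A s b x)

noncomputable def kL (j : Fin d) : Ker S d := fun s b x =>
  (∑ k, (kai A j k s b x + kai A k j s b x) * x.2 k.succ) / (4 * x.2 0)

noncomputable def kD (j : Fin d) : Ker S d := - (kL A j * kW A)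

noncomputable def kLL (i j : Fin d) : Ker S d := fun s b x =>
  (kai A j i s b x + kai A i j s b x) / (4 * x.2 0)

noncomputable def kDD (i j : Fin d) : Ker S d :=
  - (kLL A i j * kW A + kL A j * kD A i)

noncomputable def ka (i j : Fin d) : Ker S d := fun s b x =>
  (A s b).a x.1 i j - (A s b).a (x.1 + x.2) i j

noncomputable def kb (i : Fin d) : Ker S d := fun s b x => (A s b).b (x.1 + x.2) i

noncomputable def kc : Ker S d := fun s b x => (A s b).c (x.1 + x.2)

noncomputable def kE : Ker S d :=
  (∑ i, ∑ j, ka A i j * kDD A i j) - (∑ i, kb A i * kD A i) - kc A * kW A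

variable {A} {lam M : ℝ} {ρ : ℕ}

lemma Dat.det_uc (hT : 1 ≤ T) (h : Dat δ lam ρ M A) :
    UC δ T 0 ρ 0 (fun s b x => ((A s b).a x.1).det : Ker S d) :=
  UC.det hT (Mx := fun i j s b x => (A s b).a x.1 i j) fun i j => UC.fp hT (h.fa i j)

lemma Dat.kai_uc (hlam : 0 < lam) (hT : 1 ≤ T) (h : Dat δ lam ρ M A) (i j : Fin d) :
    UC δ T 0 ρ 0 (kai A i j) := by
  have h1 : UC δ T 0 ρ 0 (fun s b x => ((A s b).a x.1).det ^ (-1 : ℝ) : Ker S d) :=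
    UC.rpow hT (c := lam ^ d) (by positivity) ρ (-1) (h.det_uc hT) fun s b x _ =>
      det_pos_lower hlam ((h.par s b).symm _) ((h.par s b).lower _)
  have h2 : UC δ T 0 ρ 0 (fun s b x => Matrix.adjugate ((A s b).a x.1) i j : Ker S d) := by
    have := UC.det hT (δ := δ) (T := T) (n := ρ) (Mx := fun k l =>
      if k = j then (fun _ _ _ => (Pi.single i 1 : Fin d → ℝ) l : Ker S d)
      else fun s b x => (A s b).a x.1 k l) (fun k l => by
        split_ifs
        · exact UC.const hT _ _
        · exact UC.fp hT (h.fa k l))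
    refine this.congr fun s b x _ => ?_
    rw [Matrix.adjugate_apply]
    congr 1
    ext k l
    simp only [Matrix.of_apply, Matrix.updateRow_apply]
    split_ifs <;> rfl
  have h3 := h1.mul hT h2
  simp only [add_zero] at h3
  refine h3.congr fun s b x _ => ?_
  simp only [kai, Pi.mul_apply, Matrix.inv_def, Matrix.smul_apply, smul_eq_mul,
    Ring.inverse_eq_inv', Real.rpow_neg_one]

lemma Dat.kQ_uc (hlam : 0 < lam) (hT : 1 ≤ T) (h : Dat δ lam ρ M A) {ε : ℝ} (hε : 0 < ε) :
    UC δ T (-ε) ρ 0 (kQ A) := by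
  have h1 : UC δ T (-ε) ρ 0 ((1 / 4 : ℝ) • ((∑ i, ∑ j, kai A i j *
      ((fun _ _ x => x.2 i.succ) * (fun _ _ x => x.2 j.succ))) * (fun _ _ x => x.2 0 ^ (-1 : ℝ)))) := by
    refine UC.smul _ ?_
    have hs : UC δ T (-ε) ρ 1 (∑ i, ∑ j, kai A i j *
        ((fun _ _ x => x.2 i.succ) * (fun _ _ x => x.2 j.succ))) := by
      refine UC.sum hT _ fun i _ => UC.sum hT _ fun j _ => ?_
      refine ((h.kai_uc hlam hT i j).mul hT ((UC.coord hT (half_pos hε) ρ i).mul hT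
        (UC.coord hT (half_pos hε) ρ j))).mono hT (by linarith) (by norm_num)
    exact (hs.mul hT (UC.upow hT ρ (-1))).mono hT (by linarith) (by norm_num)
  refine h1.congr fun s b x hx => ?_
  simp only [Pi.smul_apply, Pi.mul_apply, Finset.sum_apply, kQ, smul_eq_mul, Real.rpow_neg_one]
  have := hx.1.ne'
  simp only [mul_assoc]
  field_simp

lemma Dat.kQ_lower (hlam : 0 < lam) (h : Dat δ lam ρ M A) (s : S) (b : Bool) (x : XX d)
    (hx : 0 < x.2 0) : lam / 4 * (sq x.2 / x.2 0) ≤ kQ A s b x := by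
  unfold kQ sq kai
  have := inv_lower hlam ((h.par s b).symm x.1) ((h.par s b).lower x.1) ((h.par s b).upper x.1)
    (fun i => x.2 i.succ)
  rw [le_div_iff₀ (by positivity)]
  refine le_trans (le_of_eq ?_) this
  field_simp

lemma Dat.kW_uc (hlam : 0 < lam) (hT : 1 ≤ T) (h : Dat δ lam ρ M A) (hκ : κ < lam / 4) :
    UC δ T κ ρ (-(d : ℝ) / 2) (kW A) := by
  have h1 : UC δ T 0 ρ 0 (fun s b x => ((A s b).a x.1).det ^ (-(1 : ℝ) / 2) : Ker S d) :=
    UC.rpow hT (c := lam ^ d) (by positivity) ρ _ (h.det_uc hT) fun s b x _ =>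
      det_pos_lower hlam ((h.par s b).symm _) ((h.par s b).lower _)
  have h2 := UC.exp hT (κ₀ := lam / 4) (Q := kQ A) (fun s b x hx => h.kQ_lower hlam s b x hx.1) ρ
    (fun ε hε => h.kQ_uc hlam hT hε) (lam / 4 - κ) (by linarith)
  have h3 := (((h1.mul hT (UC.upow hT ρ (-(d : ℝ) / 2))).mul hT h2).smul
    ((4 * Real.pi) ^ (-(d : ℝ) / 2)))
  refine (h3.mono hT (κ' := κ) (by linarith) (by linarith)).congr fun s b x hx => ?_
  simp only [Pi.smul_apply, Pi.mul_apply, kW, smul_eq_mul]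
  ring

lemma Dat.kL_uc (hlam : 0 < lam) (hT : 1 ≤ T) (h : Dat δ lam ρ M A) {ε : ℝ} (hε : 0 < ε)
    (j : Fin d) : UC δ T (-ε) ρ (-1 / 2) (kL A j) := by
  have h1 : UC δ T (-ε) ρ (-1 / 2) ((1 / 4 : ℝ) • ((∑ k, (kai A j k + kai A k j) *
      (fun _ _ x => x.2 k.succ)) * (fun _ _ x => x.2 0 ^ (-1 : ℝ)))) := by
    refine UC.smul _ ?_
    have hs : UC δ T (-ε) ρ (1 / 2) (∑ k, (kai A j k + kai A k j) * (fun _ _ x => x.2 k.succ)) := by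
      refine UC.sum hT _ fun k _ => ?_
      refine (((h.kai_uc hlam hT j k).add hT (h.kai_uc hlam hT k j)).mul hT
        (UC.coord hT hε ρ k)).mono hT (by linarith) (by norm_num)
    exact (hs.mul hT (UC.upow hT ρ (-1))).mono hT (by linarith) (by norm_num)
  refine h1.congr fun s b x hx => ?_
  simp only [Pi.smul_apply, Pi.mul_apply, Pi.add_apply, Finset.sum_apply, kL, smul_eq_mul,
    Real.rpow_neg_one]
  have := hx.1.ne'
  field_simp

lemma Dat.kLL_uc (hlam : 0 < lam) (hT : 1 ≤ T) (h : Dat δ lam ρ M A)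
    (i j : Fin d) : UC δ T 0 ρ (-1) (kLL A i j) := by
  have h1 := (((h.kai_uc hlam hT j i).add hT (h.kai_uc hlam hT i j)).mul hT
    (UC.upow hT ρ (-1))).smul (1 / 4)
  refine (h1.mono hT (by linarith) (by norm_num)).congr fun s b x hx => ?_
  simp only [Pi.smul_apply, Pi.mul_apply, Pi.add_apply, Finset.sum_apply, kLL, smul_eq_mul,
    Real.rpow_neg_one]
  have := hx.1.ne'
  field_simp

lemma Dat.kD_uc (hlam : 0 < lam) (hT : 1 ≤ T) (h : Dat δ lam ρ M A) (hκ : κ < lam / 4)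
    (j : Fin d) : UC δ T κ ρ (-1 / 2 - (d : ℝ) / 2) (kD A j) := by
  obtain ⟨κ₁, h1, h2⟩ := exists_between hκ
  refine (((h.kL_uc hlam hT (ε := κ₁ - κ) (by linarith) j).mul hT
    (h.kW_uc hlam hT h2)).neg).mono hT (by linarith) (by linarith)

lemma Dat.kDD_uc (hlam : 0 < lam) (hT : 1 ≤ T) (h : Dat δ lam ρ M A) (hκ : κ < lam / 4)
    (i j : Fin d) : UC δ T κ ρ (-1 - (d : ℝ) / 2) (kDD A i j) := by
  obtain ⟨κ₁, h1, h2⟩ := exists_between hκ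
  refine UC.neg (UC.add hT ?_ ?_)
  · exact ((h.kLL_uc hlam hT i j).mul hT (h.kW_uc hlam hT hκ)).mono hT (by linarith) (by linarith)
  · refine (((h.kL_uc hlam hT (ε := κ₁ - κ) (by linarith) j).mul hT
      (h.kD_uc hlam hT h2 i))).mono hT (by linarith) (by linarith)

lemma Dat.ka_uc (hT : 1 ≤ T) (h : Dat δ lam (n + 2) M A) {ε : ℝ} (hε : 0 < ε) (i j : Fin d) :
    UC δ T (-ε) n (1 / 2) (ka A i j) := UC.fdiff hT hε n (h.fa i j)

lemma Dat.kE_uc (hlam : 0 < lam) (hT : 1 ≤ T) (h : Dat δ lam (n + 2) M A) (hκ : κ < lam / 4) :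
    UC δ T κ n (-1 / 2 - (d : ℝ) / 2) (kE A) := by
  obtain ⟨κ₁, h1, h2⟩ := exists_between hκ
  refine UC.sub hT (UC.sub hT ?_ ?_) ?_
  · refine UC.sum hT _ fun i _ => UC.sum hT _ fun j _ => ?_
    exact ((h.ka_uc hT (ε := κ₁ - κ) (by linarith) i j).mul hT
      ((h.kDD_uc hlam hT h2 i j).of_le (by omega))).mono hT (by linarith) (by linarith)
  · refine UC.sum hT _ fun i _ => ?_
    have hb : UC δ T 0 (n + 2) 0 (kb A i) := UC.fpv hT (h.fb i)
    exact ((hb.mul hT (h.kD_uc hlam hT hκ i)).of_le (by omega)).mono hT (by linarith) (by linarith)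
  · have hc : UC δ T 0 (n + 2) 0 (kc A) := UC.fpv hT h.fc
    exact ((hc.mul hT (h.kW_uc hlam hT hκ)).of_le (by omega)).mono hT (by linarith) (by linarith)

end kernels

end VarBPHZ

open MeasureTheory Filter
open scoped BigOperators ENNReal

namespace VarBPHZ

set_option linter.unusedVariables false
set_option linter.unusedSimpArgs false
set_option linter.unusedSectionVars false

variable {d : ℕ}
variable {S : Type*} {δ : S → NNReal} {T κ κ' κ₁ κ₂ γ γ' γ₁ γ₂ C C' C₁ C₂ : ℝ} {n n' : ℕ}
  {Φ Φ' Ψ Ψ' : Ker S d}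

/-! ## Identification of `Z`, its derivatives and `E` -/

section ident

variable (A : S → Bool → Coeffs d)

lemma kQ_line (j : Fin d) (s : S) (b : Bool) (x : XX d) (hx : x.2 0 ≠ 0) :
    HasLineDerivAt ℝ (kQ A s b) (kL A j s b x) x (ee (Sum.inr j.succ)) := by
  have hc : ∀ k : Fin d, HasDerivAt (fun t : ℝ => (x + t • ee (Sum.inr j.succ)).2 k.succ)
      (if k = j then 1 else 0) 0 := by
    intro k
    have := hasLine_coord k.succ (Sum.inr j.succ) x
    have e : ((ee (Sum.inr j.succ) : XX d).2 k.succ) = if k = j then 1 else 0 := by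
      simp [ee, Pi.single_apply]
    rw [← e]; exact this
  have hu : ∀ t : ℝ, (x + t • ee (Sum.inr j.succ)).2 0 = x.2 0 := by
    intro t; simp [ee, Pi.single_apply]
  have ha : ∀ (k l : Fin d) (t : ℝ), kai A k l s b (x + t • ee (Sum.inr j.succ)) = kai A k l s b x := by
    intro k l t; simp [kai, ee]
  unfold HasLineDerivAt
  have : (fun t : ℝ => kQ A s b (x + t • ee (Sum.inr j.succ))) = fun t =>
      (∑ k, ∑ l, kai A k l s b x * (x + t • ee (Sum.inr j.succ)).2 k.succ *
        (x + t • ee (Sum.inr j.succ)).2 l.succ) / (4 * x.2 0) := by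
    ext t; simp only [kQ, hu, ha]
  rw [this]
  have h1 : HasDerivAt (fun t : ℝ => ∑ k, ∑ l, kai A k l s b x * (x + t • ee (Sum.inr j.succ)).2 k.succ *
        (x + t • ee (Sum.inr j.succ)).2 l.succ)
      (∑ k, ∑ l, ((kai A k l s b x * (if k = j then 1 else 0)) * (x + (0:ℝ) • ee (Sum.inr j.succ)).2 l.succ +
        kai A k l s b x * (x + (0:ℝ) • ee (Sum.inr j.succ)).2 k.succ * (if l = j then 1 else 0))) 0 :=
    HasDerivAt.fun_sum fun k _ => HasDerivAt.fun_sum fun l _ =>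
      ((hc k).const_mul _).mul (hc l)
  refine (h1.div_const (4 * x.2 0)).congr_deriv ?_
  simp only [kL]
  congr 1
  simp [Finset.sum_add_distrib, add_mul, zero_smul]

lemma kL_line (i j : Fin d) (s : S) (b : Bool) (x : XX d) (hx : x.2 0 ≠ 0) :
    HasLineDerivAt ℝ (kL A j s b) (kLL A i j s b x) x (ee (Sum.inr i.succ)) := by
  have hc : ∀ k : Fin d, HasDerivAt (fun t : ℝ => (x + t • ee (Sum.inr i.succ)).2 k.succ)
      (if k = i then 1 else 0) 0 := by
    intro k
    have := hasLine_coord k.succ (Sum.inr i.succ) x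
    have e : ((ee (Sum.inr i.succ) : XX d).2 k.succ) = if k = i then 1 else 0 := by
      simp [ee, Pi.single_apply]
    rw [← e]; exact this
  have hu : ∀ t : ℝ, (x + t • ee (Sum.inr i.succ)).2 0 = x.2 0 := by
    intro t; simp [ee, Pi.single_apply]
  have ha : ∀ (k l : Fin d) (t : ℝ), kai A k l s b (x + t • ee (Sum.inr i.succ)) = kai A k l s b x := by
    intro k l t; simp [kai, ee]
  unfold HasLineDerivAt
  have : (fun t : ℝ => kL A j s b (x + t • ee (Sum.inr i.succ))) = fun t =>
      (∑ k, (kai A j k s b x + kai A k j s b x) * (x + t • ee (Sum.inr i.succ)).2 k.succ) / (4 * x.2 0) := by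
    ext t; simp only [kL, hu, ha]
  rw [this]
  have h1 : HasDerivAt (fun t : ℝ => ∑ k, (kai A j k s b x + kai A k j s b x) * (x + t • ee (Sum.inr i.succ)).2 k.succ)
      (∑ k, (kai A j k s b x + kai A k j s b x) * (if k = i then 1 else 0)) 0 :=
    HasDerivAt.fun_sum fun k _ => (hc k).const_mul _
  refine (h1.div_const (4 * x.2 0)).congr_deriv ?_
  simp [kLL]

lemma kW_line (j : Fin d) (s : S) (b : Bool) (x : XX d) (hx : x.2 0 ≠ 0) :
    HasLineDerivAt ℝ (kW A s b) (kD A j s b x) x (ee (Sum.inr j.succ)) := by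
  have h1 := kQ_line A j s b x hx
  have hu : ∀ t : ℝ, (x + t • ee (Sum.inr j.succ)).2 0 = x.2 0 := by
    intro t; simp [ee, Pi.single_apply]
  have hp : ∀ t : ℝ, (x + t • ee (Sum.inr j.succ)).1 = x.1 := by
    intro t; simp [ee]
  unfold HasLineDerivAt at h1 ⊢
  have h2 := (h1.fun_neg.exp).const_mul ((4 * Real.pi) ^ (-(d : ℝ) / 2) *
    ((A s b).a x.1).det ^ (-(1 : ℝ) / 2) * x.2 0 ^ (-(d : ℝ) / 2))
  have e : (fun t : ℝ => kW A s b (x + t • ee (Sum.inr j.succ))) = fun t =>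
      (4 * Real.pi) ^ (-(d : ℝ) / 2) * ((A s b).a x.1).det ^ (-(1 : ℝ) / 2) * x.2 0 ^ (-(d : ℝ) / 2) *
        Real.exp (-kQ A s b (x + t • ee (Sum.inr j.succ))) := by
    ext t; simp only [kW, hu, hp]
  rw [e]
  refine h2.congr_deriv ?_
  · simp only [kD, kW, Pi.neg_apply, Pi.mul_apply, zero_smul, add_zero]; ring

lemma kD_line (i j : Fin d) (s : S) (b : Bool) (x : XX d) (hx : x.2 0 ≠ 0) :
    HasLineDerivAt ℝ (kD A j s b) (kDD A i j s b x) x (ee (Sum.inr i.succ)) := by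
  have h1 := kL_line A i j s b x hx
  have h2 := kW_line A i s b x hx
  unfold HasLineDerivAt at h1 h2 ⊢
  refine ((h1.mul h2).neg).congr_deriv ?_
  simp only [kDD, Pi.neg_apply, Pi.mul_apply, Pi.add_apply, zero_smul, add_zero]

lemma kQ_diff (s : S) (b : Bool) (p v : Pt d) (hv : v 0 ≠ 0) :
    DifferentiableAt ℝ (fun v => kQ A s b (p, v)) v := by
  unfold kQ kai
  have h4 : (4 * v 0) ≠ 0 := by simpa using hv
  simp only [div_eq_mul_inv]
  apply DifferentiableAt.fun_mul
  · fun_prop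
  · exact DifferentiableAt.fun_inv (by fun_prop) h4

lemma kL_diff (j : Fin d) (s : S) (b : Bool) (p v : Pt d) (hv : v 0 ≠ 0) :
    DifferentiableAt ℝ (fun v => kL A j s b (p, v)) v := by
  unfold kL kai
  have h4 : (4 * v 0) ≠ 0 := by simpa using hv
  simp only [div_eq_mul_inv]
  apply DifferentiableAt.fun_mul
  · fun_prop
  · exact DifferentiableAt.fun_inv (by fun_prop) h4

lemma kW_diff (s : S) (b : Bool) (p v : Pt d) (hv : v 0 ≠ 0) :
    DifferentiableAt ℝ (fun v => kW A s b (p, v)) v := by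
  unfold kW
  dsimp only
  refine DifferentiableAt.fun_mul (DifferentiableAt.fun_mul (differentiableAt_const _) ?_) ?_
  · exact DifferentiableAt.rpow_const (by fun_prop) (Or.inl hv)
  · exact (kQ_diff A s b p v hv).neg.exp

lemma kD_diff (j : Fin d) (s : S) (b : Bool) (p v : Pt d) (hv : v 0 ≠ 0) :
    DifferentiableAt ℝ (fun v => kD A j s b (p, v)) v :=
  ((kL_diff A j s b p v hv).mul (kW_diff A s b p v hv)).neg

lemma Has_kW (j : Fin d) : Has T (Sum.inr j.succ) (kW A) (kD A j) :=
  fun s b x hx => kW_line A j s b x hx.1.ne'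

lemma Has_kD (i j : Fin d) : Has T (Sum.inr i.succ) (kD A j) (kDD A i j) :=
  fun s b x hx => kD_line A i j s b x hx.1.ne'

end ident

lemma pd_ident {F : Pt d → ℝ} {zb : Pt d} {g g' : XX d → ℝ} (j : Fin d)
    (hF : ∀ z, F z = if zb 0 < z 0 then g (zb, z - zb) else 0)
    (hd : ∀ v : Pt d, 0 < v 0 → DifferentiableAt ℝ (fun v => g (zb, v)) v)
    (hl : ∀ v : Pt d, 0 < v 0 → HasLineDerivAt ℝ g (g' (zb, v)) (zb, v) (ee (Sum.inr j.succ)))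
    (z : Pt d) : pd j.succ F z = if zb 0 < z 0 then g' (zb, z - zb) else 0 := by
  split_ifs with h
  · have hv : 0 < (z - zb) 0 := by simpa using h
    have he : F =ᶠ[nhds z] fun y => g (zb, y - zb) := by
      have : ∀ᶠ y : Pt d in nhds z, zb 0 < y 0 :=
        (isOpen_lt continuous_const (continuous_apply 0)).mem_nhds h
      filter_upwards [this] with y hy
      rw [hF, if_pos hy]
    have hdF : DifferentiableAt ℝ F z := by
      refine DifferentiableAt.congr_of_eventuallyEq ?_ he
      exact DifferentiableAt.comp z (g := fun v => g (zb, v)) (f := fun y => y - zb) (hd _ hv) (by fun_prop)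
    have h1 : HasLineDerivAt ℝ F (pd j.succ F z) z (Pi.single j.succ 1) := hasLine_pd hdF _
    have h2 := hl _ hv
    have h3 : HasLineDerivAt ℝ F (g' (zb, z - zb)) z (Pi.single j.succ 1) := by
      unfold HasLineDerivAt at h2 ⊢
      convert h2 using 1
      ext t
      rw [hF, if_pos]
      · congr 1
        simp only [ee, Prod.smul_mk, smul_zero, Prod.mk_add_mk, add_zero, Prod.mk.injEq, true_and]
        abel
      · simpa using h
    exact HasDerivAt.unique h1 h3
  · by_cases hdF : DifferentiableAt ℝ F z
    · have h1 : HasLineDerivAt ℝ F (pd j.succ F z) z (Pi.single j.succ 1) := hasLine_pd hdF _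
      have h3 : HasLineDerivAt ℝ F 0 z (Pi.single j.succ 1) := by
        unfold HasLineDerivAt
        convert hasDerivAt_const (0:ℝ) (0:ℝ) using 1
        ext t
        rw [hF, if_neg]
        simpa using h
      exact HasDerivAt.unique h1 h3
    · simp [pd, fderiv_zero_of_not_differentiableAt hdF]

lemma Zker_eq (A : S → Bool → Coeffs d) (s : S) (b : Bool) (z zb : Pt d) :
    Zker (A s b) z zb = if zb 0 < z 0 then kW A s b (zb, z - zb) else 0 := by
  simp only [Zker, Wker, kW, kQ, kai, Pi.sub_apply, sub_pos, neg_div]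

lemma ZkerD_eq (A : S → Bool → Coeffs d) (j : Fin d) (s : S) (b : Bool) (z zb : Pt d) :
    ZkerD (A s b) j z zb = if zb 0 < z 0 then kD A j s b (zb, z - zb) else 0 :=
  pd_ident j (fun z => Zker_eq A s b z zb) (fun v hv => kW_diff A s b zb v hv.ne')
    (fun v hv => kW_line A j s b (zb, v) hv.ne') z

lemma ZkerDD_eq (A : S → Bool → Coeffs d) (i j : Fin d) (s : S) (b : Bool) (z zb : Pt d) :
    ZkerDD (A s b) i j z zb = if zb 0 < z 0 then kDD A i j s b (zb, z - zb) else 0 :=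
  pd_ident i (fun z => ZkerD_eq A j s b z zb) (fun v hv => kD_diff A j s b zb v hv.ne')
    (fun v hv => kD_line A i j s b (zb, v) hv.ne') z

lemma Eker_eq (A : S → Bool → Coeffs d) (s : S) (b : Bool) (z zb : Pt d) :
    Eker (A s b) z zb = if zb 0 < z 0 then kE A s b (zb, z - zb) else 0 := by
  simp only [Eker, Zker_eq, ZkerD_eq, ZkerDD_eq]
  split_ifs with h
  · simp only [kE, Pi.sub_apply, Finset.sum_apply, Pi.mul_apply, ka, kb, kc, add_sub_cancel]
  · simp
end VarBPHZ

open MeasureTheory Filter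
open scoped BigOperators ENNReal

namespace VarBPHZ

set_option linter.unusedVariables false
set_option linter.unusedSimpArgs false
set_option linter.unusedSectionVars false

variable {d : ℕ}
variable {S : Type*} {δ : S → NNReal} {T κ κ' κ₁ κ₂ γ γ' γ₁ γ₂ C C' C₁ C₂ : ℝ} {n n' : ℕ}
  {Φ Φ' Ψ Ψ' : Ker S d}

/-! ## Time derivatives of `E` -/

lemma Has.neg {D : Dir d} (h : Has T D Φ Φ') : Has T D (-Φ) (-Φ') := by
  have := h.smul (-1)
  simpa using this

lemma Has.sub {D : Dir d} (h : Has T D Φ Φ') (h' : Has T D Ψ Ψ') :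
    Has T D (Φ - Ψ) (Φ' - Ψ') := by
  rw [sub_eq_add_neg, sub_eq_add_neg]; exact h.add h'.neg

lemma Has.sum {D : Dir d} {ι : Type*} (s : Finset ι) {F F' : ι → Ker S d}
    (h : ∀ i ∈ s, Has T D (F i) (F' i)) : Has T D (∑ i ∈ s, F i) (∑ i ∈ s, F' i) := by
  classical
  induction s using Finset.induction_on with
  | empty => simpa using Has.zero
  | insert a s ha ih =>
    rw [Finset.sum_insert ha, Finset.sum_insert ha]
    exact (h a (by simp)).add (ih fun i hi => h i (by simp [hi]))

lemma Has.fp_inl {f f' : S → Bool → Pt d → ℝ} {i : Fin (d + 1)}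
    (h : ∀ s b z, HasLineDerivAt ℝ (f s b) (f' s b z) z (Pi.single i 1)) :
    Has T (Sum.inl i) (fun s b x => f s b x.1) (fun s b x => f' s b x.1) := by
  intro s b x hx
  have := h s b x.1
  unfold HasLineDerivAt at this ⊢
  simpa [ee] using this

lemma Has.fp_inr {f : S → Bool → Pt d → ℝ} {i : Fin (d + 1)} :
    Has T (Sum.inr i) (fun s b x => f s b x.1) (0 : Ker S d) := by
  intro s b x hx
  unfold HasLineDerivAt
  simpa [ee] using hasDerivAt_const (0:ℝ) (f s b x.1)

lemma Has.fpv_inl {f f' : S → Bool → Pt d → ℝ} {i : Fin (d + 1)}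
    (h : ∀ s b z, HasLineDerivAt ℝ (f s b) (f' s b z) z (Pi.single i 1)) :
    Has T (Sum.inl i) (fun s b x => f s b (x.1 + x.2)) (fun s b x => f' s b (x.1 + x.2)) := by
  intro s b x hx
  have := h s b (x.1 + x.2)
  unfold HasLineDerivAt at this ⊢
  convert this using 3 with t
  simp only [ee, Prod.fst_add, Prod.snd_add, Prod.smul_mk, smul_zero, add_zero]
  abel

lemma Has.fpv_inr {f f' : S → Bool → Pt d → ℝ} {i : Fin (d + 1)}
    (h : ∀ s b z, HasLineDerivAt ℝ (f s b) (f' s b z) z (Pi.single i 1)) :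
    Has T (Sum.inr i) (fun s b x => f s b (x.1 + x.2)) (fun s b x => f' s b (x.1 + x.2)) := by
  intro s b x hx
  have := h s b (x.1 + x.2)
  unfold HasLineDerivAt at this ⊢
  convert this using 3 with t
  simp only [ee, Prod.fst_add, Prod.snd_add, Prod.smul_mk, smul_zero, add_zero]
  abel

structure EDat (δ : S → NNReal) (T κ : ℝ) (r : ℕ) (C : ℝ) (E : Ker S d) : Prop where
  main : Cls δ T κ r (-1 / 2 - (d : ℝ) / 2) C E
  tim : ∀ m, r = m + 1 → ∃ (G0 Ev : Ker S d) (P dP : Fin d → Ker S d),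
    Has T (Sum.inl 0) E (G0 + ∑ i, dP i) ∧ (∀ i, Has T (Sum.inr i.succ) (P i) (dP i)) ∧
    Cls δ T κ m (-1 / 2 - (d : ℝ) / 2) C G0 ∧
    (∀ i, Cls δ T κ (m + 1) (-1 / 2 - (d : ℝ) / 2) C (P i)) ∧
    Has T (Sum.inr 0) E Ev ∧ Cls δ T κ m (-3 / 2 - (d : ℝ) / 2) C Ev

lemma Dat.time {A : S → Bool → Coeffs d} {lam M : ℝ} {m : ℕ}
    (hlam : 0 < lam) (hT : 1 ≤ T) (h : Dat δ lam (m + 3) M A) (hκ : κ < lam / 4) :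
    ∃ (G0 Ev : Ker S d) (P dP : Fin d → Ker S d),
    Has T (Sum.inl 0) (kE A) (G0 + ∑ i, dP i) ∧ (∀ i, Has T (Sum.inr i.succ) (P i) (dP i)) ∧
    UC δ T κ m (-1 / 2 - (d : ℝ) / 2) G0 ∧
    (∀ i, UC δ T κ (m + 1) (-1 / 2 - (d : ℝ) / 2) (P i)) ∧
    Has T (Sum.inr 0) (kE A) Ev ∧ UC δ T κ m (-3 / 2 - (d : ℝ) / 2) Ev := by
  obtain ⟨κ₁, hκ1, hκ2⟩ := exists_between hκ
  choose da hda hda' using fun i j => (h.fa i j).exd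
  choose db hdb hdb' using fun i => (h.fb i).exd
  obtain ⟨dc, hdc, hdc'⟩ := h.fc.exd
  have ta : ∀ i j, Fcl δ M (m + 1) (da i j 0) := fun i j => hda' i j 0 (by simp)
  have tb : ∀ i, Fcl δ M (m + 1) (db i 0) := fun i => hdb' i 0 (by simp)
  have tc : Fcl δ M (m + 1) (dc 0) := hdc' 0 (by simp)
  choose dta hdta hdta' using fun i j => (ta i j).exd
  have tax : ∀ i j (k : Fin d), Fcl δ M m (dta i j k.succ) := fun i j k => hdta' i j k.succ (by simp)
  obtain ⟨dW, hW, hW'⟩ := (h.kW_uc (T := T) hlam hT hκ).exd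
  choose dD hD hD' using fun j => (h.kD_uc (T := T) hlam hT hκ j).exd
  choose dDD hDD hDD' using fun i j => (h.kDD_uc (T := T) hlam hT hκ2 i j).exd
  set kta : Fin d → Fin d → Ker S d := fun i j s b x => da i j 0 s b x.1 - da i j 0 s b (x.1 + x.2)
    with hkta
  set ktav : Fin d → Fin d → Ker S d := fun i j s b x => da i j 0 s b (x.1 + x.2) with hktav
  set ktx : Fin d → Fin d → Ker S d := fun i j s b x => dta i j i.succ s b (x.1 + x.2) with hktx
  set ktb : Fin d → Ker S d := fun i s b x => db i 0 s b (x.1 + x.2) with hktb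
  set ktc : Ker S d := fun s b x => dc 0 s b (x.1 + x.2) with hktc
  have e2 : wt (Sum.inl 0 : Dir d) ≤ m + 3 := by simp
  have e2' : wt (Sum.inr 0 : Dir d) ≤ m + 3 := by simp
  -- uniform class facts
  have ukb : ∀ i, UC δ T 0 (m + 3) 0 (kb A i) := fun i => UC.fpv hT (h.fb i)
  have ukc : UC δ T 0 (m + 3) 0 (kc A) := UC.fpv hT h.fc
  have uktb : ∀ i, UC δ T 0 (m + 1) 0 (ktb i) := fun i => UC.fpv hT (tb i)
  have uktc : UC δ T 0 (m + 1) 0 ktc := UC.fpv hT tc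
  have uktav : ∀ i j, UC δ T 0 (m + 1) 0 (ktav i j) := fun i j => UC.fpv hT (ta i j)
  have ukta : ∀ i j, UC δ T 0 (m + 1) 0 (kta i j) := fun i j =>
    (UC.fp hT (ta i j)).sub hT (UC.fpv hT (ta i j))
  have uktx : ∀ i j, UC δ T 0 m 0 (ktx i j) := fun i j => UC.fpv hT (tax i j i)
  have uka : ∀ i j, UC δ T (-(κ₁ - κ)) (m + 1) (1 / 2) (ka A i j) := fun i j =>
    Dat.ka_uc hT h (by linarith) i j
  have uW := h.kW_uc (T := T) hlam hT hκ
  have uD := fun j => h.kD_uc (T := T) hlam hT hκ j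
  have uDD := fun i j => h.kDD_uc (T := T) hlam hT hκ i j
  -- derivatives in time of the coefficients
  have hka : ∀ i j, Has T (Sum.inl 0) (ka A i j) (kta i j) := fun i j =>
    (Has.fp_inl (hda i j 0 (by simp))).sub (Has.fpv_inl (hda i j 0 (by simp)))
  have hkb : ∀ i, Has T (Sum.inl 0) (kb A i) (ktb i) := fun i => Has.fpv_inl (hdb i 0 (by simp))
  have hkc : Has T (Sum.inl 0) (kc A) ktc := Has.fpv_inl (hdc 0 (by simp))
  have hka' : ∀ i j, Has T (Sum.inr 0) (ka A i j) (0 - ktav i j) := fun i j =>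
    (Has.fp_inr (f := fun s b z => (A s b).a z i j)).sub (Has.fpv_inr (hda i j 0 (by simp)))
  have hkb' : ∀ i, Has T (Sum.inr 0) (kb A i) (ktb i) := fun i => Has.fpv_inr (hdb i 0 (by simp))
  have hkc' : Has T (Sum.inr 0) (kc A) ktc := Has.fpv_inr (hdc 0 (by simp))
  have hkta : ∀ i j, Has T (Sum.inr i.succ) (kta i j) (0 - ktx i j) := fun i j =>
    Has.fp_inr.sub (Has.fpv_inr (hdta i j i.succ (by simp)))
  have hE1 : Has T (Sum.inl 0) (kE A) ((∑ i, ∑ j, (kta i j * kDD A i j + ka A i j * dDD i j (Sum.inl 0)))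
      - (∑ i, (ktb i * kD A i + kb A i * dD i (Sum.inl 0)))
      - (ktc * kW A + kc A * dW (Sum.inl 0))) := by
    refine Has.sub (Has.sub (Has.sum _ fun i _ => Has.sum _ fun j _ => ?_) (Has.sum _ fun i _ => ?_)) ?_
    · exact (hka i j).mul (hDD i j _ e2)
    · exact (hkb i).mul (hD i _ e2)
    · exact hkc.mul (hW _ e2)
  have hE2 : Has T (Sum.inr 0) (kE A)
      ((∑ i, ∑ j, ((0 - ktav i j) * kDD A i j + ka A i j * dDD i j (Sum.inr 0)))
      - (∑ i, (ktb i * kD A i + kb A i * dD i (Sum.inr 0)))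
      - (ktc * kW A + kc A * dW (Sum.inr 0))) := by
    refine Has.sub (Has.sub (Has.sum _ fun i _ => Has.sum _ fun j _ => ?_) (Has.sum _ fun i _ => ?_)) ?_
    · exact (hka' i j).mul (hDD i j _ e2')
    · exact (hkb' i).mul (hD i _ e2')
    · exact hkc'.mul (hW _ e2')
  have vDD : ∀ i j, UC δ T κ₁ (m + 1) (-1 - (d : ℝ) / 2) (dDD i j (Sum.inl 0)) := fun i j => by
    have := hDD' i j _ e2; simpa using this
  have vD : ∀ j, UC δ T κ (m + 1) (-1 / 2 - (d : ℝ) / 2) (dD j (Sum.inl 0)) := fun j => by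
    have := hD' j _ e2; simpa using this
  have vW : UC δ T κ (m + 1) (- (d : ℝ) / 2) (dW (Sum.inl 0)) := by
    have := hW' _ e2; simpa using this
  have wDD : ∀ i j, UC δ T κ₁ (m + 1) (-1 - (d : ℝ) / 2 - 1) (dDD i j (Sum.inr 0)) := fun i j => by
    have := hDD' i j _ e2'; simpa using this
  have wD : ∀ j, UC δ T κ (m + 1) (-1 / 2 - (d : ℝ) / 2 - 1) (dD j (Sum.inr 0)) := fun j => by
    have := hD' j _ e2'; simpa using this
  have wW : UC δ T κ (m + 1) (- (d : ℝ) / 2 - 1) (dW (Sum.inr 0)) := by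
    have := hW' _ e2'; simpa using this
  refine ⟨(∑ i, ∑ j, (ktx i j * kD A j + ka A i j * dDD i j (Sum.inl 0)))
      - (∑ i, (ktb i * kD A i + kb A i * dD i (Sum.inl 0)))
      - (ktc * kW A + kc A * dW (Sum.inl 0)), _, fun i => ∑ j, kta i j * kD A j,
      fun i => ∑ j, ((0 - ktx i j) * kD A j + kta i j * kDD A i j), ?_, ?_, ?_, ?_, hE2, ?_⟩
  · refine hE1.congr (fun s b x _ => rfl) fun s b x hx => ?_
    simp only [Pi.add_apply, Pi.sub_apply, Finset.sum_apply, Pi.mul_apply, Pi.zero_apply,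
      Finset.sum_add_distrib, Finset.sum_sub_distrib, zero_sub, neg_mul, Finset.sum_neg_distrib]
    simp only [Pi.neg_apply, Finset.sum_apply, Pi.mul_apply]
    ring
  · intro i
    exact Has.sum _ fun j _ => (hkta i j).mul (Has_kD A i j)
  · refine UC.sub hT (UC.sub hT (UC.sum hT _ fun i _ => UC.sum hT _ fun j _ => UC.add hT ?_ ?_)
      (UC.sum hT _ fun i _ => UC.add hT ?_ ?_)) (UC.add hT ?_ ?_)
    · exact ((uktx i j).mul hT ((uD j).of_le (by omega))).mono hT (by linarith) (by linarith)
    · exact (((uka i j).mul hT (vDD i j)).of_le (by omega)).mono hT (by linarith) (by linarith)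
    · exact (((uktb i).mul hT ((uD i).of_le (by omega))).of_le (by omega)).mono hT (by linarith) (by linarith)
    · exact ((((ukb i).of_le (by omega)).mul hT (vD i)).of_le (by omega)).mono hT (by linarith) (by linarith)
    · exact ((uktc.mul hT (uW.of_le (by omega))).of_le (by omega)).mono hT (by linarith) (by linarith)
    · exact (((ukc.of_le (by omega)).mul hT vW).of_le (by omega)).mono hT (by linarith) (by linarith)
  · intro i
    refine UC.sum hT _ fun j _ => ?_
    exact ((ukta i j).mul hT ((uD j).of_le (by omega))).mono hT (by linarith) (by linarith)
  · refine UC.sub hT (UC.sub hT (UC.sum hT _ fun i _ => UC.sum hT _ fun j _ => UC.add hT ?_ ?_)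
      (UC.sum hT _ fun i _ => UC.add hT ?_ ?_)) (UC.add hT ?_ ?_)
    · rw [zero_sub]
      exact (((uktav i j).neg.mul hT ((uDD i j).of_le (by omega))).of_le (by omega)).mono hT (by linarith) (by linarith)
    · exact (((uka i j).mul hT (wDD i j)).of_le (by omega)).mono hT (by linarith) (by linarith)
    · exact (((uktb i).mul hT ((uD i).of_le (by omega))).of_le (by omega)).mono hT (by linarith) (by linarith)
    · exact ((((ukb i).of_le (by omega)).mul hT (wD i)).of_le (by omega)).mono hT (by linarith) (by linarith)
    · exact ((uktc.mul hT (uW.of_le (by omega))).of_le (by omega)).mono hT (by linarith) (by linarith)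
    · exact (((ukc.of_le (by omega)).mul hT wW).of_le (by omega)).mono hT (by linarith) (by linarith)

lemma Dat.edat {A : S → Bool → Coeffs d} {lam M : ℝ} {r : ℕ}
    (hlam : 0 < lam) (hT : 1 ≤ T) (h : Dat δ lam (r + 2) M A) (hκ : κ < lam / 4) :
    ∃ C, EDat δ T κ r C (-kE A) := by
  obtain ⟨C0, h0⟩ := (h.kE_uc (T := T) hlam hT hκ).neg
  have n0 := h0.nn
  rcases r with _ | m
  · exact ⟨C0, h0, fun m hm => by omega⟩
  · obtain ⟨G0, Ev, P, dP, a1, a2, a3, a4, a5, a6⟩ := h.time (T := T) hlam hT hκ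
    obtain ⟨C1, h1⟩ := a3.neg
    obtain ⟨C2, h2⟩ := a6.neg
    choose CP hP using fun i => (a4 i).neg
    have nP : ∀ i, 0 ≤ CP i := fun i => (hP i).nn
    have n1 := h1.nn
    have n2 := h2.nn
    have n3 : 0 ≤ ∑ i, CP i := Finset.sum_nonneg fun i _ => nP i
    refine ⟨C0 + C1 + C2 + ∑ i, CP i, h0.monoC hT (by linarith), fun m' hm => ?_⟩
    obtain rfl : m = m' := by omega
    refine ⟨-G0, -Ev, fun i => -P i, fun i => -dP i, ?_, fun i => (a2 i).neg,
      h1.monoC hT (by linarith), fun i => (hP i).monoC hT ?_, a5.neg, h2.monoC hT (by linarith)⟩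
    · have := a1.neg
      rw [neg_add, ← Finset.sum_neg_distrib] at this
      exact this
    · have := Finset.single_le_sum (fun i _ => nP i) (Finset.mem_univ i)
      linarith
end VarBPHZ

open MeasureTheory Filter
open scoped BigOperators ENNReal

namespace VarBPHZ

set_option linter.unusedVariables false
set_option linter.unusedSimpArgs false
set_option linter.unusedSectionVars false

variable {d : ℕ}
variable {S : Type*} {δ : S → NNReal} {T κ κ' κ₁ κ₂ γ γ' γ₁ γ₂ C C' C₁ C₂ : ℝ} {n n' : ℕ}
  {Φ Φ' Ψ Ψ' : Ker S d}

/-! ## Integrals depending on a parameter -/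

section intlem

variable {E : Type*} [NormedAddCommGroup E] [NormedSpace ℝ E] {Y : Type*} [MeasurableSpace Y]
  {μ : Measure Y}

lemma int_cont {U : Set E} (hU : IsOpen U) {f : Y → E → ℝ} {g : E → ℝ} {h : Y → ℝ}
    (hm : ∀ x ∈ U, AEStronglyMeasurable (fun y => f y x) μ)
    (hc : ∀ᵐ y ∂μ, ContinuousOn (f y) U) (hg : ContinuousOn g U) (hh : Integrable h μ)
    (hb : ∀ᵐ y ∂μ, ∀ x ∈ U, |f y x| ≤ g x * h y) :
    ContinuousOn (fun x => ∫ y, f y x ∂μ) U := by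
  intro x₀ hx₀
  apply ContinuousAt.continuousWithinAt
  have hUn := hU.mem_nhds hx₀
  have hgn : ∀ᶠ x in nhds x₀, |g x| < |g x₀| + 1 :=
    ((hg.continuousAt hUn).abs.eventually_lt continuousAt_const (by simp))
  refine continuousAt_of_dominated (bound := fun y => (|g x₀| + 1) * |h y|) ?_ ?_ ?_ ?_
  · filter_upwards [hUn] with x hx using hm x hx
  · filter_upwards [hUn, hgn] with x hx hgx
    filter_upwards [hb] with y hy
    rw [Real.norm_eq_abs]
    refine (hy x hx).trans ((le_abs_self _).trans ?_)
    rw [abs_mul]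
    exact mul_le_mul_of_nonneg_right hgx.le (abs_nonneg _)
  · exact hh.abs.const_mul _
  · filter_upwards [hc] with y hy using hy.continuousAt hUn

lemma int_line {U : Set E} (hU : IsOpen U) {f f' : Y → E → ℝ} {g g' : E → ℝ} {h h' : Y → ℝ} {e : E}
    (hm : ∀ x ∈ U, AEStronglyMeasurable (fun y => f y x) μ)
    (hd : ∀ᵐ y ∂μ, ∀ x ∈ U, HasLineDerivAt ℝ (f y) (f' y x) x e)
    (hg' : ContinuousOn g' U) (hh : Integrable h μ) (hh' : Integrable h' μ)
    (hb : ∀ᵐ y ∂μ, ∀ x ∈ U, |f y x| ≤ g x * h y)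
    (hb' : ∀ᵐ y ∂μ, ∀ x ∈ U, |f' y x| ≤ g' x * h' y) :
    ∀ x ∈ U, Integrable (fun y => f' y x) μ ∧
      HasLineDerivAt ℝ (fun x => ∫ y, f y x ∂μ) (∫ y, f' y x ∂μ) x e := by
  intro x₀ hx₀
  have hl : Continuous fun t : ℝ => x₀ + t • e := by fun_prop
  have hl0 : x₀ + (0 : ℝ) • e = x₀ := by simp
  have hUn : ∀ᶠ t : ℝ in nhds 0, x₀ + t • e ∈ U :=
    hl.continuousAt.eventually_mem (by rw [hl0]; exact hU.mem_nhds hx₀)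
  have hgn : ∀ᶠ t : ℝ in nhds 0, |g' (x₀ + t • e)| < |g' x₀| + 1 := by
    have h1 : ContinuousAt g' (x₀ + (0 : ℝ) • e) := by
      rw [hl0]; exact hg'.continuousAt (hU.mem_nhds hx₀)
    have h2 : ContinuousAt (fun t : ℝ => g' (x₀ + t • e)) 0 :=
      ContinuousAt.comp (g := g') (f := fun t : ℝ => x₀ + t • e) h1 hl.continuousAt
    exact h2.abs.eventually_lt continuousAt_const (by simp)
  have hmeas : AEStronglyMeasurable (fun y => f' y x₀) μ := by
    classical
    refine aestronglyMeasurable_of_tendsto_ae (nhdsWithin (0 : ℝ) {0}ᶜ)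
      (f := fun t y => if x₀ + t • e ∈ U then t⁻¹ * (f y (x₀ + t • e) - f y x₀) else 0) ?_ ?_
    · intro t
      by_cases ht : x₀ + t • e ∈ U
      · simp only [ht, if_true]
        exact ((hm _ ht).sub (hm _ hx₀)).const_mul _
      · simp only [ht, if_false]; exact aestronglyMeasurable_const
    · filter_upwards [hd] with y hy
      have h1 := hy x₀ hx₀
      unfold HasLineDerivAt at h1
      rw [hasDerivAt_iff_tendsto_slope_zero] at h1
      refine h1.congr' ?_
      filter_upwards [nhdsWithin_le_nhds hUn] with t ht
      simp only [ht, if_true, zero_add, zero_smul, add_zero, smul_eq_mul]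
  have key := hasDerivAt_integral_of_dominated_loc_of_deriv_le (μ := μ) (𝕜 := ℝ)
    (F := fun t y => f y (x₀ + t • e)) (F' := fun t y => f' y (x₀ + t • e)) (x₀ := (0 : ℝ))
    (bound := fun y => (|g' x₀| + 1) * |h' y|) (hUn.and hgn)
    (by filter_upwards [hUn] with t ht using hm _ ht) ?_ (by simpa using hmeas) ?_
    (hh'.abs.const_mul _) ?_
  · simpa [HasLineDerivAt] using key
  · refine Integrable.mono' (hh.abs.const_mul |g x₀|) (by simpa using hm _ hx₀) ?_
    filter_upwards [hb] with y hy
    rw [hl0, Real.norm_eq_abs]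
    refine (hy _ hx₀).trans ((le_abs_self _).trans (le_of_eq (abs_mul _ _)))
  · filter_upwards [hb'] with y hy t ht
    rw [Real.norm_eq_abs]
    refine (hy _ ht.1).trans ((le_abs_self _).trans ?_)
    rw [abs_mul]
    exact mul_le_mul_of_nonneg_right ht.2.le (abs_nonneg _)
  · filter_upwards [hd] with y hy t ht
    exact hasDerivAt_line (hy _ ht.1)

lemma int_meas {U : Set E} (hU : IsOpen U) {f f' : Y → E → ℝ} {e : E}
    (hm : ∀ x ∈ U, AEStronglyMeasurable (fun y => f y x) μ)
    (hd : ∀ᵐ y ∂μ, ∀ x ∈ U, HasLineDerivAt ℝ (f y) (f' y x) x e) :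
    ∀ x ∈ U, AEStronglyMeasurable (fun y => f' y x) μ := by
  intro x₀ hx₀
  have hl : Continuous fun t : ℝ => x₀ + t • e := by fun_prop
  have hl0 : x₀ + (0 : ℝ) • e = x₀ := by simp
  have hUn : ∀ᶠ t : ℝ in nhds 0, x₀ + t • e ∈ U :=
    hl.continuousAt.eventually_mem (by rw [hl0]; exact hU.mem_nhds hx₀)
  classical
  refine aestronglyMeasurable_of_tendsto_ae (nhdsWithin (0 : ℝ) {0}ᶜ)
    (f := fun t y => if x₀ + t • e ∈ U then t⁻¹ * (f y (x₀ + t • e) - f y x₀) else 0) ?_ ?_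
  · intro t
    by_cases ht : x₀ + t • e ∈ U
    · simp only [ht, if_true]
      exact ((hm _ ht).sub (hm _ hx₀)).const_mul _
    · simp only [ht, if_false]; exact aestronglyMeasurable_const
  · filter_upwards [hd] with y hy
    have h1 := hy x₀ hx₀
    unfold HasLineDerivAt at h1
    rw [hasDerivAt_iff_tendsto_slope_zero] at h1
    refine h1.congr' ?_
    filter_upwards [nhdsWithin_le_nhds hUn] with t ht
    simp only [ht, if_true, zero_add, zero_smul, add_zero, smul_eq_mul]

end intlem

lemma gcont (T κ γ : ℝ) :
    ContinuousOn (fun x : XX d => x.2 0 ^ γ * gau κ x.2) (UU d T) := by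
  have h0 : ContinuousOn (fun x : XX d => x.2 0) (UU d T) := by fun_prop
  refine ContinuousOn.mul (h0.rpow_const fun x hx => Or.inl hx.1.ne') ?_
  unfold gau sq
  refine Real.continuous_exp.comp_continuousOn (ContinuousOn.neg (continuousOn_const.mul
    (ContinuousOn.div ?_ h0 fun x hx => hx.1.ne')))
  fun_prop

section outer

variable {Y : Type*} [MeasurableSpace Y] {μ : Measure Y} {w w' : Y → ℝ} {I I' : Y → Ker S d}

lemma Base.abs_le (h : Base δ T κ γ C Φ) (s : S) (b : Bool) (x : XX d) (hx : x ∈ UU d T) :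
    |Φ s b x| ≤ (x.2 0 ^ γ * gau κ x.2) * C := by
  refine ((h.bd s x hx).1 b).trans (le_of_eq (by ring))

lemma Base.integrable (hw : Integrable w μ) (h : ∀ᵐ y ∂μ, Base δ T κ γ (C * w y) (I y))
    (hm : ∀ s b, ∀ x ∈ UU d T, AEStronglyMeasurable (fun y => I y s b x) μ) :
    ∀ s b, ∀ x ∈ UU d T, Integrable (fun y => I y s b x) μ := by
  intro s b x hx
  refine Integrable.mono' ((hw.const_mul C).const_mul (x.2 0 ^ γ * gau κ x.2)) (hm s b x hx) ?_
  filter_upwards [h] with y hy using hy.abs_le s b x hx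

lemma Base.integral (hw : Integrable w μ) (h : ∀ᵐ y ∂μ, Base δ T κ γ (C * w y) (I y))
    (hm : ∀ s b, ∀ x ∈ UU d T, AEStronglyMeasurable (fun y => I y s b x) μ) :
    Base δ T κ γ (C * ∫ y, w y ∂μ) (fun s b x => ∫ y, I y s b x ∂μ) := by
  have hi := Base.integrable hw h hm
  refine ⟨?_, ?_, ?_⟩
  · rw [← integral_const_mul]
    exact integral_nonneg_of_ae (by filter_upwards [h] with y hy using hy.nn)
  · intro s b
    refine int_cont (isOpen_UU T) (hm s b) ?_ (gcont T κ γ) (hw.const_mul C) ?_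
    · filter_upwards [h] with y hy using hy.cont s b
    · filter_upwards [h] with y hy x hx using hy.abs_le s b x hx
  · intro s x hx
    have e : ∀ c : ℝ, c * (C * (∫ y, w y ∂μ) * x.2 0 ^ γ * gau κ x.2)
        = ∫ y, c * (C * w y * x.2 0 ^ γ * gau κ x.2) ∂μ := by
      intro c
      simp only [← integral_const_mul, ← integral_mul_const]
    have hIntb : ∀ c : ℝ, Integrable (fun y => c * (C * w y * x.2 0 ^ γ * gau κ x.2)) μ := fun c =>
      (((hw.const_mul C).mul_const _).mul_const _).const_mul c
    refine ⟨fun b => ?_, ?_⟩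
    · have e1 := e 1
      rw [one_mul] at e1
      rw [e1, ← Real.norm_eq_abs]
      refine norm_integral_le_of_norm_le (hIntb 1) ?_
      filter_upwards [h] with y hy
      rw [one_mul, Real.norm_eq_abs]
      exact (hy.bd s x hx).1 b
    · rw [e, ← integral_sub (hi s true x hx) (hi s false x hx), ← Real.norm_eq_abs]
      refine norm_integral_le_of_norm_le (hIntb _) ?_
      filter_upwards [h] with y hy
      rw [Real.norm_eq_abs]
      exact (hy.bd s x hx).2

lemma Has.integral {D : Dir d} (hw : Integrable w μ) (hw' : Integrable w' μ)
    (h : ∀ᵐ y ∂μ, Base δ T κ γ (C * w y) (I y))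
    (h' : ∀ᵐ y ∂μ, Base δ T κ γ' (C' * w' y) (I' y))
    (hm : ∀ s b, ∀ x ∈ UU d T, AEStronglyMeasurable (fun y => I y s b x) μ)
    (hd : ∀ᵐ y ∂μ, Has T D (I y) (I' y)) :
    Has T D (fun s b x => ∫ y, I y s b x ∂μ) (fun s b x => ∫ y, I' y s b x ∂μ) := by
  intro s b x hx
  refine (int_line (isOpen_UU T) (f := fun y => I y s b) (f' := fun y => I' y s b)
    (g := fun x : XX d => x.2 0 ^ γ * gau κ x.2) (hm s b) ?_
    (gcont T κ γ') (hw.const_mul C)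
    (hw'.const_mul C') ?_ ?_ x hx).2
  · filter_upwards [hd] with y hy using hy s b
  · filter_upwards [h] with y hy x hx using hy.abs_le s b x hx
  · filter_upwards [h'] with y hy x hx using hy.abs_le s b x hx

lemma Has.meas {D : Dir d} 
    (hm : ∀ s b, ∀ x ∈ UU d T, AEStronglyMeasurable (fun y => I y s b x) μ)
    (hd : ∀ᵐ y ∂μ, Has T D (I y) (I' y)) :
    ∀ s b, ∀ x ∈ UU d T, AEStronglyMeasurable (fun y => I' y s b x) μ := by
  intro s b
  refine int_meas (isOpen_UU T) (e := ee D) (hm s b) ?_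
  filter_upwards [hd] with y hy using hy s b

lemma Cls.integral (hw : Integrable w μ) : ∀ (n : ℕ) {γ : ℝ} {I : Y → Ker S d},
    (∀ᵐ y ∂μ, Cls δ T κ n γ (C * w y) (I y)) →
    (∀ s b, ∀ x ∈ UU d T, AEStronglyMeasurable (fun y => I y s b x) μ) →
    Cls δ T κ n γ (C * ∫ y, w y ∂μ) (fun s b x => ∫ y, I y s b x ∂μ) := by
  classical
  intro n
  induction n using Nat.strong_induction_on with
  | _ n ih =>
    intro γ I h hm
    set dI : Dir d → Y → Ker S d := fun D y =>
      if hh : ∃ Φ', Has T D (I y) Φ' ∧ Cls δ T κ (n - wt D) (γ - cost D) (C * w y) Φ' then hh.choose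
      else 0 with hdI
    have hspec : ∀ D, wt D ≤ n → ∀ᵐ y ∂μ, Has T D (I y) (dI D y) ∧
        Cls δ T κ (n - wt D) (γ - cost D) (C * w y) (dI D y) := by
      intro D hD
      filter_upwards [h] with y hy
      obtain ⟨dΦ, h1, h2⟩ := hy.exd
      have hh : ∃ Φ', Has T D (I y) Φ' ∧ Cls δ T κ (n - wt D) (γ - cost D) (C * w y) Φ' :=
        ⟨dΦ D, h1 D hD, h2 D hD⟩
      simp only [hdI, dif_pos hh]
      exact hh.choose_spec
    have hbase : ∀ᵐ y ∂μ, Base δ T κ γ (C * w y) (I y) := by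
      filter_upwards [h] with y hy using hy.base
    have hmeas : ∀ D, wt D ≤ n → ∀ s b, ∀ x ∈ UU d T,
        AEStronglyMeasurable (fun y => dI D y s b x) μ := fun D hD =>
      Has.meas hm (by filter_upwards [hspec D hD] with y hy using hy.1)
    refine Cls.mk (Base.integral hw hbase hm) (fun D s b x => ∫ y, dI D y s b x ∂μ) ?_ ?_
    · intro D hD
      refine Has.integral hw hw hbase (C' := C) (γ' := γ - cost D) ?_ hm ?_
      · filter_upwards [hspec D hD] with y hy using hy.2.base
      · filter_upwards [hspec D hD] with y hy using hy.1
    · intro D hD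
      have := wt_pos D
      refine ih (n - wt D) (by omega) ?_ (hmeas D hD)
      filter_upwards [hspec D hD] with y hy using hy.2

end outer
end VarBPHZ

open MeasureTheory Filter
open scoped BigOperators ENNReal

namespace VarBPHZ

set_option linter.unusedVariables false
set_option linter.unusedSimpArgs false
set_option linter.unusedSectionVars false

variable {d : ℕ}
variable {S : Type*} {δ : S → NNReal} {T κ κ' κ₁ κ₂ γ γ' γ₁ γ₂ C C' C₁ C₂ : ℝ} {n n' : ℕ}
  {Φ Φ' Ψ Ψ' : Ker S d}


/-! ## The inner (spatial) convolution at a fixed time fraction -/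

def io (η : Fin d → ℝ) : Pt d := Fin.cons 0 η

@[simp] lemma io_zero (η : Fin d → ℝ) : io η 0 = 0 := rfl
@[simp] lemma io_succ (η : Fin d → ℝ) (i : Fin d) : io η i.succ = η i := rfl

lemma io_add (η η' : Fin d → ℝ) : io (η + η') = io η + io η' := by
  ext i; refine Fin.cases ?_ (fun j => ?_) i <;> simp

lemma io_smul (c : ℝ) (η : Fin d → ℝ) : io (c • η) = c • io η := by
  ext i; refine Fin.cases ?_ (fun j => ?_) i <;> simp

lemma io_single (i : Fin d) : io (Pi.single i (1 : ℝ)) = Pi.single i.succ 1 := by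
  ext j; refine Fin.cases ?_ (fun j => ?_) j
  · simp [Pi.single_apply, Fin.succ_ne_zero, eq_comm]
  · simp [Pi.single_apply, Fin.succ_inj]

lemma continuous_io : Continuous (io : (Fin d → ℝ) → Pt d) := by
  refine continuous_pi fun i => ?_
  refine Fin.cases ?_ (fun j => ?_) i
  · simpa using continuous_const
  · simpa using continuous_apply j

noncomputable def LL (θ : ℝ) (η : Fin d → ℝ) (x : XX d) : XX d :=
  (x.1 + θ • x.2 + io η, (1 - θ) • x.2 - io η)

noncomputable def RR (θ : ℝ) (η : Fin d → ℝ) (x : XX d) : XX d := (x.1, θ • x.2 + io η)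

noncomputable def jj (θ : ℝ) (η : Fin d → ℝ) (Φ Ψ : Ker S d) : Ker S d :=
  fun s b x => Φ s b (LL θ η x) * Ψ s b (RR θ η x)

noncomputable def II (θ : ℝ) (Φ Ψ : Ker S d) : Ker S d :=
  fun s b x => ∫ η : Fin d → ℝ, jj θ η Φ Ψ s b x

variable {θ : ℝ} {η : Fin d → ℝ}

lemma LL_mem (h0 : 0 < θ) (h1 : θ < 1) {x : XX d} (hx : x ∈ UU d T) : LL θ η x ∈ UU d T := by
  obtain ⟨a, b⟩ := hx
  refine ⟨?_, ?_⟩ <;> simp only [LL, Pi.sub_apply, Pi.smul_apply, io_zero, smul_eq_mul, sub_zero]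
  · exact mul_pos (by linarith) a
  · nlinarith

lemma RR_mem (h0 : 0 < θ) (h1 : θ < 1) {x : XX d} (hx : x ∈ UU d T) : RR θ η x ∈ UU d T := by
  obtain ⟨a, b⟩ := hx
  refine ⟨?_, ?_⟩ <;> simp only [RR, Pi.add_apply, Pi.smul_apply, io_zero, smul_eq_mul, add_zero]
  · exact mul_pos (by linarith) a
  · nlinarith

lemma continuous_LR : Continuous (fun q : (ℝ × (Fin d → ℝ)) × XX d => LL q.1.1 q.1.2 q.2) ∧
    Continuous (fun q : (ℝ × (Fin d → ℝ)) × XX d => RR q.1.1 q.1.2 q.2) := by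
  have := continuous_io (d := d)
  unfold LL RR
  constructor <;> fun_prop

/-- the gaussian weight in the inner variable -/
noncomputable def hg (κ θ u : ℝ) (η : Fin d → ℝ) : ℝ :=
  ∏ i, Real.exp (-(κ / (θ * (1 - θ) * u)) * η i ^ 2)

lemma hg_eq (κ θ u : ℝ) (η : Fin d → ℝ) :
    hg κ θ u η = Real.exp (-(κ / (θ * (1 - θ) * u)) * ∑ i, η i ^ 2) := by
  rw [hg, ← Real.exp_sum, Finset.mul_sum]

lemma hg_pos (κ θ u : ℝ) (η : Fin d → ℝ) : 0 < hg κ θ u η := by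
  rw [hg_eq]; exact Real.exp_pos _

lemma hg_integrable (hκ : 0 < κ) (h0 : 0 < θ) (h1 : θ < 1) {u : ℝ} (hu : 0 < u) :
    Integrable (hg (d := d) κ θ u) := by
  have h1' : 0 < 1 - θ := by linarith
  exact Integrable.fintype_prod (f := fun _ (y : ℝ) => Real.exp (-(κ / (θ * (1 - θ) * u)) * y ^ 2))
    fun i => integrable_exp_neg_mul_sq (by positivity)

lemma hg_integral (hκ : 0 < κ) (h0 : 0 < θ) (h1 : θ < 1) {u : ℝ} (hu : 0 < u) :
    ∫ η, hg (d := d) κ θ u η =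
      (Real.pi / κ) ^ ((d : ℝ) / 2) * (1 - θ) ^ ((d : ℝ) / 2) * θ ^ ((d : ℝ) / 2)
        * u ^ ((d : ℝ) / 2) := by
  have h1' : 0 < 1 - θ := by linarith
  unfold hg
  rw [integral_fintype_prod_volume_eq_pow (fun y : ℝ => Real.exp (-(κ / (θ * (1 - θ) * u)) * y ^ 2)),
    integral_gaussian, Fintype.card_fin, Real.sqrt_eq_rpow, ← Real.rpow_natCast, ← Real.rpow_mul
    (by positivity), ← Real.mul_rpow (by positivity) (by positivity),
    ← Real.mul_rpow (by positivity) (by positivity),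
    ← Real.mul_rpow (by positivity) (by positivity)]
  congr 1
  · field_simp
  · ring

lemma hg_mono (hκ : 0 < κ) (h0 : 0 < θ) (h1 : θ < 1) {u : ℝ} (hu : 0 < u) (hT : u ≤ T) :
    hg κ θ u η ≤ hg κ θ T η := by
  have h1' : 0 < 1 - θ := by linarith
  rw [hg_eq, hg_eq]
  apply Real.exp_le_exp.2
  have : 0 ≤ ∑ i, η i ^ 2 := Finset.sum_nonneg fun _ _ => sq_nonneg _
  apply mul_le_mul_of_nonneg_right _ this
  apply neg_le_neg
  have : 0 < θ * (1 - θ) * u := by positivity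
  gcongr

lemma gau_LR (h0 : 0 < θ) (h1 : θ < 1) {x : XX d} (hx : 0 < x.2 0) :
    gau κ (LL θ η x).2 * gau κ (RR θ η x).2 = gau κ x.2 * hg κ θ (x.2 0) η := by
  have h1' : 0 < 1 - θ := by linarith
  rw [hg_eq]
  unfold gau
  rw [← Real.exp_add, ← Real.exp_add]
  congr 1
  have key : sq (LL θ η x).2 / (LL θ η x).2 0 + sq (RR θ η x).2 / (RR θ η x).2 0
      = sq x.2 / x.2 0 + (∑ i, η i ^ 2) / (θ * (1 - θ) * x.2 0) := by
    unfold sq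
    simp only [Finset.sum_div]
    rw [← Finset.sum_add_distrib, ← Finset.sum_add_distrib]
    refine Finset.sum_congr rfl fun i _ => ?_
    simp only [LL, RR, Pi.sub_apply, Pi.add_apply, Pi.smul_apply, io_zero, io_succ, smul_eq_mul,
      sub_zero, add_zero]
    field_simp
    ring
  calc _ = -(κ * (sq (LL θ η x).2 / (LL θ η x).2 0 + sq (RR θ η x).2 / (RR θ η x).2 0)) := by ring
    _ = _ := by rw [key]; ring

noncomputable def qq (θ γ₁ γ₂ : ℝ) : ℝ := (1 - θ) ^ γ₁ * θ ^ γ₂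

lemma qq_pos (h0 : 0 < θ) (h1 : θ < 1) : 0 < qq θ γ₁ γ₂ :=
  mul_pos (Real.rpow_pos_of_pos (by linarith) _) (Real.rpow_pos_of_pos h0 _)

lemma jj_bd (h0 : 0 < θ) (h1 : θ < 1) (h : Base δ T κ γ₁ C₁ Φ) (h' : Base δ T κ γ₂ C₂ Ψ)
    (s : S) (x : XX d) (hx : x ∈ UU d T) :
    Bd (δ s) (2 * (C₁ * C₂) * qq θ γ₁ γ₂ * x.2 0 ^ (γ₁ + γ₂) * gau κ x.2 * hg κ θ (x.2 0) η)
      (fun b => jj θ η Φ Ψ s b x) := by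
  have h1' : 0 < 1 - θ := by linarith
  have := Bd.mul (δ s).2 (h.bd s _ (LL_mem (η := η) h0 h1 hx)) (h'.bd s _ (RR_mem (η := η) h0 h1 hx))
  refine this.mono (δ s).2 (le_of_eq ?_)
  have e1 : (LL θ η x).2 0 = (1 - θ) * x.2 0 := by simp [LL]
  have e2 : (RR θ η x).2 0 = θ * x.2 0 := by simp [RR]
  rw [e1, e2, Real.mul_rpow h1'.le hx.1.le, Real.mul_rpow h0.le hx.1.le, Real.rpow_add hx.1]
  have := gau_LR (κ := κ) (η := η) h0 h1 hx.1
  calc _ = 2 * (C₁ * C₂) * qq θ γ₁ γ₂ * (x.2 0 ^ γ₁ * x.2 0 ^ γ₂) *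
        (gau κ (LL θ η x).2 * gau κ (RR θ η x).2) := by unfold qq; ring
    _ = _ := by rw [this]; ring

lemma jj_cont (h0 : 0 < θ) (h1 : θ < 1) {s : S} {b : Bool} (h : ContinuousOn (Φ s b) (UU d T))
    (h' : ContinuousOn (Ψ s b) (UU d T)) : ContinuousOn (jj θ η Φ Ψ s b) (UU d T) := by
  refine ContinuousOn.mul (h.comp ?_ fun x hx => LL_mem h0 h1 hx)
    (h'.comp ?_ fun x hx => RR_mem h0 h1 hx)
  · exact (continuous_LR.1.comp (Continuous.prodMk (continuous_const (y := (θ, η)))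
      continuous_id)).continuousOn
  · exact (continuous_LR.2.comp (Continuous.prodMk (continuous_const (y := (θ, η)))
      continuous_id)).continuousOn

lemma jj_base (hκ : 0 < κ) (h0 : 0 < θ) (h1 : θ < 1) (h : Base δ T κ γ₁ C₁ Φ)
    (h' : Base δ T κ γ₂ C₂ Ψ) :
    Base δ T κ (γ₁ + γ₂) (2 * (C₁ * C₂) * qq θ γ₁ γ₂ * hg κ θ T η) (jj θ η Φ Ψ) := by
  have hn := h.nn
  have hn' := h'.nn
  have hq := qq_pos (γ₁ := γ₁) (γ₂ := γ₂) h0 h1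
  refine ⟨mul_nonneg (by positivity) (hg_pos _ _ _ _).le,
    fun s b => jj_cont h0 h1 (h.cont s b) (h'.cont s b), fun s x hx => ?_⟩
  refine (jj_bd h0 h1 h h' s x hx).mono (δ s).2 ?_
  have e := hg_mono (η := η) hκ h0 h1 hx.1 hx.2.le
  have hu : 0 < x.2 0 ^ (γ₁ + γ₂) := Real.rpow_pos_of_pos hx.1 _
  have hg := gau_pos κ x.2
  calc _ ≤ 2 * (C₁ * C₂) * qq θ γ₁ γ₂ * x.2 0 ^ (γ₁ + γ₂) * gau κ x.2 * VarBPHZ.hg κ θ T η := by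
        gcongr
    _ = _ := by ring

/-- joint continuity in `(θ, η)` -/
lemma jj_contθ {s : S} {b : Bool} (h : ContinuousOn (Φ s b) (UU d T))
    (h' : ContinuousOn (Ψ s b) (UU d T)) {x : XX d} (hx : x ∈ UU d T) :
    ContinuousOn (fun q : ℝ × (Fin d → ℝ) => jj q.1 q.2 Φ Ψ s b x) (Set.Ioo 0 1 ×ˢ Set.univ) := by
  refine ContinuousOn.mul
    (h.comp (f := fun q : ℝ × (Fin d → ℝ) => LL q.1 q.2 x) ?_ fun q hq => LL_mem hq.1.1 hq.1.2 hx)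
    (h'.comp (f := fun q : ℝ × (Fin d → ℝ) => RR q.1 q.2 x) ?_ fun q hq => RR_mem hq.1.1 hq.1.2 hx)
  · exact (continuous_LR.1.comp (Continuous.prodMk continuous_id continuous_const)).continuousOn
  · exact (continuous_LR.2.comp (Continuous.prodMk continuous_id continuous_const)).continuousOn

lemma jj_meas (h0 : 0 < θ) (h1 : θ < 1) (h : ∀ s b, ContinuousOn (Φ s b) (UU d T))
    (h' : ∀ s b, ContinuousOn (Ψ s b) (UU d T)) :
    ∀ s b, ∀ x ∈ UU d T, AEStronglyMeasurable (fun η : Fin d → ℝ => jj θ η Φ Ψ s b x) := by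
  intro s b x hx
  apply Continuous.aestronglyMeasurable
  have := jj_contθ (h s b) (h' s b) hx
  refine continuousOn_univ.1 (this.comp (f := fun η : Fin d → ℝ => (θ, η)) (by fun_prop) ?_)
  exact fun η _ => ⟨⟨h0, h1⟩, trivial⟩

lemma II_measθ (h : ∀ s b, ContinuousOn (Φ s b) (UU d T))
    (h' : ∀ s b, ContinuousOn (Ψ s b) (UU d T)) :
    ∀ s b, ∀ x ∈ UU d T, AEStronglyMeasurable (fun θ : ℝ => II θ Φ Ψ s b x)
      (volume.restrict (Set.Ioo 0 1)) := by
  intro s b x hx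
  have := (jj_contθ (h s b) (h' s b) hx).aestronglyMeasurable (μ := volume)
    (measurableSet_Ioo.prod MeasurableSet.univ)
  rw [Measure.volume_eq_prod, ← Measure.prod_restrict, Measure.restrict_univ] at this
  exact this.integral_prod_right'

lemma jj_integrable (hκ : 0 < κ) (hT : 0 < T) (h0 : 0 < θ) (h1 : θ < 1) (h : Base δ T κ γ₁ C₁ Φ)
    (h' : Base δ T κ γ₂ C₂ Ψ) :
    ∀ s b, ∀ x ∈ UU d T, Integrable (fun η : Fin d → ℝ => jj θ η Φ Ψ s b x) :=
  Base.integrable (hg_integrable hκ h0 h1 hT)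
    (Eventually.of_forall fun η => jj_base hκ h0 h1 h h') (jj_meas h0 h1 h.cont h'.cont)

noncomputable def c0 (d : ℕ) (κ : ℝ) : ℝ := 2 * (Real.pi / κ) ^ ((d : ℝ) / 2)

lemma c0_pos (hκ : 0 < κ) : 0 < c0 d κ := by unfold c0; positivity

lemma II_base (hκ : 0 < κ) (hT : 0 < T) (h0 : 0 < θ) (h1 : θ < 1) (h : Base δ T κ γ₁ C₁ Φ)
    (h' : Base δ T κ γ₂ C₂ Ψ) :
    Base δ T κ (γ₁ + γ₂ + d / 2) (c0 d κ * (C₁ * C₂) * qq θ (γ₁ + d / 2) (γ₂ + d / 2))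
      (II θ Φ Ψ) := by
  have hn := h.nn
  have hn' := h'.nn
  have h1' : 0 < 1 - θ := by linarith
  have hb := Base.integral (hg_integrable hκ h0 h1 hT)
    (Eventually.of_forall fun η => jj_base (d := d) hκ h0 h1 h h') (jj_meas h0 h1 h.cont h'.cont)
  have hi := jj_integrable hκ hT h0 h1 h h'
  refine ⟨?_, hb.cont, ?_⟩
  · exact mul_nonneg (mul_nonneg (c0_pos hκ).le (by positivity)) (qq_pos h0 h1).le
  · intro s x hx
    have e : ∀ c : ℝ, c * (c0 d κ * (C₁ * C₂) * qq θ (γ₁ + d / 2) (γ₂ + d / 2) *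
        x.2 0 ^ (γ₁ + γ₂ + d / 2) * gau κ x.2)
        = ∫ η : Fin d → ℝ, c * (2 * (C₁ * C₂) * qq θ γ₁ γ₂ * x.2 0 ^ (γ₁ + γ₂) * gau κ x.2
          * hg κ θ (x.2 0) η) := by
      intro c
      rw [integral_const_mul, integral_const_mul, hg_integral hκ h0 h1 hx.1]
      unfold qq c0
      rw [Real.rpow_add h1', Real.rpow_add h0, Real.rpow_add hx.1]
      ring
    have hIntb : ∀ c : ℝ, Integrable (fun η : Fin d → ℝ => c * (2 * (C₁ * C₂) * qq θ γ₁ γ₂ *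
        x.2 0 ^ (γ₁ + γ₂) * gau κ x.2 * hg κ θ (x.2 0) η)) := fun c =>
      ((hg_integrable hκ h0 h1 hx.1).const_mul _).const_mul _
    refine ⟨fun b => ?_, ?_⟩
    · have e1 := e 1
      rw [one_mul] at e1
      rw [e1, ← Real.norm_eq_abs]
      refine norm_integral_le_of_norm_le (hIntb 1) (Eventually.of_forall fun η => ?_)
      rw [one_mul, Real.norm_eq_abs]
      exact (jj_bd h0 h1 h h' s x hx).1 b
    · rw [e]
      simp only [II]
      rw [← integral_sub (hi s true x hx) (hi s false x hx), ← Real.norm_eq_abs]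
      refine norm_integral_le_of_norm_le (hIntb _) (Eventually.of_forall fun η => ?_)
      rw [Real.norm_eq_abs]
      exact (jj_bd h0 h1 h h' s x hx).2

end VarBPHZ

open MeasureTheory Filter
open scoped BigOperators ENNReal

namespace VarBPHZ

set_option linter.unusedVariables false
set_option linter.unusedSimpArgs false
set_option linter.unusedSectionVars false

variable {d : ℕ}
variable {S : Type*} {δ : S → NNReal} {T κ κ' κ₁ κ₂ γ γ' γ₁ γ₂ C C' C₁ C₂ : ℝ} {n n' : ℕ}
  {Φ Φ' Ψ Ψ' : Ker S d}


/-! ## Differentiating the inner convolution -/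

variable {θ : ℝ} {η : Fin d → ℝ}

lemma line_comp {E F : Type*} [NormedAddCommGroup E] [NormedSpace ℝ E] [NormedAddCommGroup F]
    [NormedSpace ℝ F] {f : F → ℝ} {f' : ℝ} {g : E → F} {x e : E} {e' : F}
    (h : HasLineDerivAt ℝ f f' (g x) e') (hg : ∀ t : ℝ, g (x + t • e) = g x + t • e') :
    HasLineDerivAt ℝ (fun y => f (g y)) f' x e := by
  unfold HasLineDerivAt at h ⊢
  simpa only [hg] using h

lemma line_mul {E : Type*} [NormedAddCommGroup E] [NormedSpace ℝ E] {f g : E → ℝ} {f' g' : ℝ}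
    {x e : E} (h : HasLineDerivAt ℝ f f' x e) (h' : HasLineDerivAt ℝ g g' x e) :
    HasLineDerivAt ℝ (fun y => f y * g y) (f' * g x + f x * g') x e := by
  unfold HasLineDerivAt at h h' ⊢
  exact (h.mul h').congr_deriv (by simp)

lemma LL_inl (i : Fin (d + 1)) (x : XX d) (t : ℝ) :
    LL θ η (x + t • ee (Sum.inl i)) = LL θ η x + t • ee (Sum.inl i) := by
  ext j <;> simp [LL, ee] <;> ring

lemma RR_inl (i : Fin (d + 1)) (x : XX d) (t : ℝ) :
    RR θ η (x + t • ee (Sum.inl i)) = RR θ η x + t • ee (Sum.inl i) := by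
  ext j <;> simp [RR, ee]

lemma LL_inr (i : Fin (d + 1)) (x : XX d) (t : ℝ) :
    LL θ η (x + t • ee (Sum.inr i)) =
      LL θ η x + t • (θ • ee (Sum.inl i) + (1 - θ) • ee (Sum.inr i)) := by
  ext j <;> simp [LL, ee] <;> ring

lemma RR_inr (i : Fin (d + 1)) (x : XX d) (t : ℝ) :
    RR θ η (x + t • ee (Sum.inr i)) = RR θ η x + t • (θ • ee (Sum.inr i)) := by
  ext j <;> simp [RR, ee] <;> ring

lemma jj_inl {i : Fin (d + 1)} {Φp Ψp : Ker S d} (h0 : 0 < θ) (h1 : θ < 1)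
    (h : Has T (Sum.inl i) Φ Φp) (h' : Has T (Sum.inl i) Ψ Ψp) :
    Has T (Sum.inl i) (jj θ η Φ Ψ) (jj θ η Φp Ψ + jj θ η Φ Ψp) := by
  intro s b x hx
  exact line_mul (line_comp (h s b _ (LL_mem h0 h1 hx)) (LL_inl i x))
    (line_comp (h' s b _ (RR_mem h0 h1 hx)) (RR_inl i x))

lemma jj_inr {i : Fin (d + 1)} {Φp Φv Ψv : Ker S d} (h0 : 0 < θ) (h1 : θ < 1)
    (h : Has T (Sum.inl i) Φ Φp) (hv : Has T (Sum.inr i) Φ Φv)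
    (hc : ∀ s b, ContinuousOn (Φv s b) (UU d T)) (h' : Has T (Sum.inr i) Ψ Ψv) :
    Has T (Sum.inr i) (jj θ η Φ Ψ)
      (θ • jj θ η Φp Ψ + (1 - θ) • jj θ η Φv Ψ + θ • jj θ η Φ Ψv) := by
  intro s b x hx
  have e1 := line_add (isOpen_UU T) (a := θ • ee (Sum.inl i)) (b := (1 - θ) • ee (Sum.inr i))
    (A := fun x => θ * Φp s b x) (B := fun x => (1 - θ) * Φv s b x)
    (fun x hx => line_smul (h s b x hx)) (fun x hx => line_smul (hv s b x hx))
    (continuousOn_const.mul (hc s b)) _ (LL_mem (η := η) h0 h1 hx)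
  have e2 := line_smul (c := θ) (h' s b _ (RR_mem (η := η) h0 h1 hx))
  have := line_mul (line_comp e1 (LL_inr i x)) (line_comp e2 (RR_inr i x))
  refine HasDerivAt.congr_deriv this ?_
  simp only [jj, Pi.add_apply, Pi.smul_apply, smul_eq_mul]
  ring

lemma II_add_left (hκ : 0 < κ) (hT : 0 < T) (h0 : 0 < θ) (h1 : θ < 1) {Φ₂ : Ker S d}
    (h : Base δ T κ γ₁ C₁ Φ) (h₂ : Base δ T κ γ C Φ₂) (h' : Base δ T κ γ₂ C₂ Ψ) :
    ∀ s b, ∀ x ∈ UU d T, II θ (Φ + Φ₂) Ψ s b x = II θ Φ Ψ s b x + II θ Φ₂ Ψ s b x := by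
  intro s b x hx
  simp only [II]
  rw [← integral_add (jj_integrable hκ hT h0 h1 h h' s b x hx)
    (jj_integrable hκ hT h0 h1 h₂ h' s b x hx)]
  simp [jj, add_mul]

lemma II_inl (hκ : 0 < κ) (hT : 1 ≤ T) (h0 : 0 < θ) (h1 : θ < 1)
    {i : Fin (d + 1)} {Φp Ψp : Ker S d} {γ₃ γ₄ C₃ C₄ : ℝ}
    (b1 : Base δ T κ γ₁ C₁ Φ) (b2 : Base δ T κ γ₂ C₂ Ψ)
    (b3 : Base δ T κ γ₃ C₃ Φp) (b4 : Base δ T κ γ₄ C₄ Ψp)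
    (h : Has T (Sum.inl i) Φ Φp) (h' : Has T (Sum.inl i) Ψ Ψp) :
    Has T (Sum.inl i) (II θ Φ Ψ) (II θ Φp Ψ + II θ Φ Ψp) := by
  have hT0 : 0 < T := by linarith
  obtain ⟨g, hg1⟩ : ∃ g, g ≤ γ₃ + γ₂ ∧ g ≤ γ₁ + γ₄ :=
    ⟨min (γ₃ + γ₂) (γ₁ + γ₄), by simp⟩
  have mon : ∀ {Φ Ψ : Ker S d} {γ γ' C C' : ℝ}, Base δ T κ γ C Φ → Base δ T κ γ' C' Ψ → g ≤ γ + γ' →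
      ∀ η, Base δ T κ g (2 * (C * C') * qq θ γ γ' * T ^ (γ + γ' - g) * hg κ θ T η) (jj θ η Φ Ψ) :=
    fun {Φ Ψ γ γ' C C'} a a' hg η => (jj_base hκ h0 h1 a a').mono hT le_rfl hg (le_of_eq (by ring))
  have key := Has.integral (δ := δ) (T := T) (κ := κ) (w := hg (d := d) κ θ T) (w' := hg κ θ T)
    (I := fun η => jj θ η Φ Ψ) (I' := fun η => jj θ η Φp Ψ + jj θ η Φ Ψp)
    (γ := γ₁ + γ₂) (γ' := g) (C := 2 * (C₁ * C₂) * qq θ γ₁ γ₂)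
    (C' := 2 * (C₃ * C₂) * qq θ γ₃ γ₂ * T ^ (γ₃ + γ₂ - g) +
      2 * (C₁ * C₄) * qq θ γ₁ γ₄ * T ^ (γ₁ + γ₄ - g))
    (D := Sum.inl i) (hg_integrable hκ h0 h1 hT0) (hg_integrable hκ h0 h1 hT0)
    (Eventually.of_forall fun η => jj_base hκ h0 h1 b1 b2)
    (Eventually.of_forall fun η => by
      rw [add_mul]
      exact (mon b3 b2 hg1.1 η).add (mon b1 b4 hg1.2 η))
    (jj_meas h0 h1 b1.cont b2.cont) (Eventually.of_forall fun η => jj_inl h0 h1 h h')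
  refine key.congr (fun _ _ _ _ => rfl) fun s b x hx => ?_
  exact integral_add (jj_integrable hκ hT0 h0 h1 b3 b2 s b x hx)
    (jj_integrable hκ hT0 h0 h1 b1 b4 s b x hx)

lemma II_inr (hκ : 0 < κ) (hT : 1 ≤ T) (h0 : 0 < θ) (h1 : θ < 1)
    {i : Fin (d + 1)} {Φp Φv Ψv : Ker S d} {γ₃ γ₄ γ₅ C₃ C₄ C₅ : ℝ}
    (b1 : Base δ T κ γ₁ C₁ Φ) (b2 : Base δ T κ γ₂ C₂ Ψ)
    (b3 : Base δ T κ γ₃ C₃ Φp) (b4 : Base δ T κ γ₄ C₄ Φv) (b5 : Base δ T κ γ₅ C₅ Ψv)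
    (h : Has T (Sum.inl i) Φ Φp) (hv : Has T (Sum.inr i) Φ Φv) (h' : Has T (Sum.inr i) Ψ Ψv) :
    Has T (Sum.inr i) (II θ Φ Ψ) (θ • II θ Φp Ψ + (1 - θ) • II θ Φv Ψ + θ • II θ Φ Ψv) := by
  have hT0 : 0 < T := by linarith
  obtain ⟨g, hg1⟩ : ∃ g, g ≤ γ₃ + γ₂ ∧ g ≤ γ₄ + γ₂ ∧ g ≤ γ₁ + γ₅ :=
    ⟨min (γ₃ + γ₂) (min (γ₄ + γ₂) (γ₁ + γ₅)), by simp⟩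
  have mon : ∀ {Φ Ψ : Ker S d} {γ γ' C C' : ℝ}, Base δ T κ γ C Φ → Base δ T κ γ' C' Ψ → g ≤ γ + γ' →
      ∀ η, Base δ T κ g (2 * (C * C') * qq θ γ γ' * T ^ (γ + γ' - g) * hg κ θ T η) (jj θ η Φ Ψ) :=
    fun {Φ Ψ γ γ' C C'} a a' hg η => (jj_base hκ h0 h1 a a').mono hT le_rfl hg (le_of_eq (by ring))
  have key := Has.integral (δ := δ) (T := T) (κ := κ) (w := hg (d := d) κ θ T) (w' := hg κ θ T)
    (I := fun η => jj θ η Φ Ψ)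
    (I' := fun η => θ • jj θ η Φp Ψ + (1 - θ) • jj θ η Φv Ψ + θ • jj θ η Φ Ψv)
    (γ := γ₁ + γ₂) (γ' := g) (C := 2 * (C₁ * C₂) * qq θ γ₁ γ₂)
    (C' := |θ| * (2 * (C₃ * C₂) * qq θ γ₃ γ₂ * T ^ (γ₃ + γ₂ - g)) +
      |1 - θ| * (2 * (C₄ * C₂) * qq θ γ₄ γ₂ * T ^ (γ₄ + γ₂ - g)) +
      |θ| * (2 * (C₁ * C₅) * qq θ γ₁ γ₅ * T ^ (γ₁ + γ₅ - g)))
    (D := Sum.inr i) (hg_integrable hκ h0 h1 hT0) (hg_integrable hκ h0 h1 hT0)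
    (Eventually.of_forall fun η => jj_base hκ h0 h1 b1 b2)
    (Eventually.of_forall fun η => by
      rw [add_mul, add_mul, mul_assoc |θ|, mul_assoc |1 - θ|, mul_assoc |θ|]
      exact (((mon b3 b2 hg1.1 η).smul θ).add ((mon b4 b2 hg1.2.1 η).smul (1 - θ))).add
        ((mon b1 b5 hg1.2.2 η).smul θ))
    (jj_meas h0 h1 b1.cont b2.cont) (Eventually.of_forall fun η => jj_inr h0 h1 h hv b4.cont h')
  refine key.congr (fun _ _ _ _ => rfl) fun s b x hx => ?_
  have i3 := jj_integrable hκ hT0 h0 h1 b3 b2 s b x hx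
  have i4 := jj_integrable hκ hT0 h0 h1 b4 b2 s b x hx
  have i5 := jj_integrable hκ hT0 h0 h1 b1 b5 s b x hx
  simp only [Pi.add_apply, Pi.smul_apply, smul_eq_mul, II]
  have i34 : Integrable (fun η : Fin d → ℝ => θ * jj θ η Φp Ψ s b x +
      (1 - θ) * jj θ η Φv Ψ s b x) := (i3.const_mul θ).add (i4.const_mul (1 - θ))
  rw [integral_add i34 (i5.const_mul θ),
    integral_add (i3.const_mul θ) (i4.const_mul (1 - θ)), integral_const_mul, integral_const_mul,
    integral_const_mul]

lemma II_cls (hκ : 0 < κ) (hT : 1 ≤ T) (h0 : 0 < θ) (h1 : θ < 1) : ∀ (n : ℕ) {γ₁ γ₂ : ℝ}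
    {Φ Ψ : Ker S d}, Cls δ T κ n γ₁ C₁ Φ → Cls δ T κ n γ₂ C₂ Ψ →
    Cls δ T κ n (γ₁ + γ₂ + d / 2) ((3 * T) ^ n * (c0 d κ * (C₁ * C₂)) *
      qq θ (γ₁ + d / 2) (γ₂ + d / 2)) (II θ Φ Ψ) := by
  have hT0 : 0 < T := by linarith
  have h1' : 0 < 1 - θ := by linarith
  intro n
  induction n using Nat.strong_induction_on with
  | _ n ih =>
    intro γ₁ γ₂ Φ Ψ h h'
    have hn := h.nn
    have hn' := h'.nn
    have hc0 : 0 ≤ c0 d κ * (C₁ * C₂) := mul_nonneg (c0_pos hκ).le (by positivity)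
    obtain ⟨dΦ, a1, a2⟩ := h.exd
    obtain ⟨dΨ, a1', a2'⟩ := h'.exd
    have hq : 0 < qq θ (γ₁ + d / 2) (γ₂ + d / 2) := qq_pos h0 h1
    set Q := c0 d κ * (C₁ * C₂) with hQ
    set q := qq θ (γ₁ + d / 2) (γ₂ + d / 2) with hqd
    have pw : ∀ m, m + 1 ≤ n → (3 * T) ^ m * Q * q * (3 * T) ≤ (3 * T) ^ n * Q * q := by
      intro m hm
      calc _ = (3 * T) ^ (m + 1) * (Q * q) := by ring
        _ ≤ (3 * T) ^ n * (Q * q) :=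
          mul_le_mul_of_nonneg_right (pow_le_pow_right₀ (by linarith) hm) (by positivity)
        _ = _ := by ring
    refine Cls.mk ((II_base hκ hT0 h0 h1 h.base h'.base).mono hT le_rfl le_rfl ?_)
      (fun D => match D with
        | Sum.inl i => II θ (dΦ (Sum.inl i)) Ψ + II θ Φ (dΨ (Sum.inl i))
        | Sum.inr i => θ • II θ (dΦ (Sum.inl i)) Ψ + (1 - θ) • II θ (dΦ (Sum.inr i)) Ψ +
            θ • II θ Φ (dΨ (Sum.inr i))) ?_ ?_
    · rw [sub_self, Real.rpow_zero, mul_one]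
      refine mul_le_mul_of_nonneg_right (le_mul_of_one_le_left hc0 ?_) hq.le
      exact one_le_pow₀ (by linarith)
    · rintro (i | i) hD
      · exact II_inl hκ hT h0 h1 h.base h'.base (a2 _ hD).base (a2' _ hD).base (a1 _ hD) (a1' _ hD)
      · have hD' : wt (Sum.inl i : Dir d) ≤ n := hD
        exact II_inr hκ hT h0 h1 h.base h'.base (a2 _ hD').base (a2 _ hD).base (a2' _ hD).base
          (a1 _ hD') (a1 _ hD) (a1' _ hD)
    · rintro (i | i) hD
      · have hp := wt_pos (Sum.inl i : Dir d)
        have k1 := ih (n - wt (Sum.inl i : Dir d)) (by omega) (a2 _ hD) (h'.of_le (Nat.sub_le _ _))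
        have k2 := ih (n - wt (Sum.inl i : Dir d)) (by omega) (h.of_le (Nat.sub_le _ _)) (a2' _ hD)
        simp only [cost_inl, sub_zero] at k1 k2 ⊢
        refine (k1.add k2).monoC hT ?_
        refine le_trans ?_ (pw (n - wt (Sum.inl i : Dir d)) (by omega))
        have : 0 ≤ (3 * T) ^ (n - wt (Sum.inl i : Dir d)) * Q * q := by positivity
        nlinarith
      · have hp := wt_pos (Sum.inr i : Dir d)
        have hD' : wt (Sum.inl i : Dir d) ≤ n := hD
        set N := n - wt (Sum.inr i : Dir d) with hN
        have hNlt : N < n := by omega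
        set c := cost (Sum.inr i : Dir d) with hc
        have hc0' : 0 ≤ c := cost_nonneg _
        have hc1 : c ≤ 1 := by
          have := wi_le i
          have : (wi i : ℝ) ≤ 2 := by exact_mod_cast this
          rw [hc, cost_inr]; linarith
        have a2p := a2 (Sum.inl i) hD'
        rw [show n - wt (Sum.inl i : Dir d) = N from rfl, cost_inl, sub_zero] at a2p
        have k1 := ih N hNlt a2p (h'.of_le (Nat.sub_le _ _))
        have k2 := ih N hNlt (a2 _ hD) (h'.of_le (Nat.sub_le _ _))
        have k3 := ih N hNlt (h.of_le (Nat.sub_le _ _)) (a2' _ hD)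
        rw [← hc] at k2 k3
        rw [show γ₁ - c + γ₂ + (d : ℝ) / 2 = γ₁ + γ₂ + d / 2 - c by ring] at k2
        rw [show γ₁ + (γ₂ - c) + (d : ℝ) / 2 = γ₁ + γ₂ + d / 2 - c by ring] at k3
        set X := (3 * T) ^ N * Q with hX
        have hX0 : 0 ≤ X := by positivity
        have hTc : T ^ c ≤ T := by
          calc T ^ c ≤ T ^ (1 : ℝ) := Real.rpow_le_rpow_of_exponent_le hT hc1
            _ = T := Real.rpow_one T
        have k1' : Cls δ T κ N (γ₁ + γ₂ + d / 2 - c) (X * q * T) (II θ (dΦ (Sum.inl i)) Ψ) := by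
          refine k1.mono hT le_rfl (by linarith) ?_
          rw [show γ₁ + γ₂ + (d : ℝ) / 2 - (γ₁ + γ₂ + d / 2 - c) = c by ring]
          exact mul_le_mul_of_nonneg_left hTc (by positivity)
        have q2 : (1 - θ) * qq θ (γ₁ - c + d / 2) (γ₂ + d / 2) ≤ q := by
          rw [hqd]; unfold qq
          rw [← mul_assoc]
          refine mul_le_mul_of_nonneg_right ?_ (Real.rpow_nonneg h0.le _)
          rw [show (1 - θ) * (1 - θ) ^ (γ₁ - c + (d : ℝ) / 2)
            = (1 - θ) ^ (1 + (γ₁ - c + (d : ℝ) / 2)) by rw [Real.rpow_add h1' 1, Real.rpow_one]]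
          exact Real.rpow_le_rpow_of_exponent_ge h1' (by linarith) (by linarith)
        have q3 : θ * qq θ (γ₁ + d / 2) (γ₂ - c + d / 2) ≤ q := by
          rw [hqd]; unfold qq
          rw [mul_left_comm]
          refine mul_le_mul_of_nonneg_left ?_ (Real.rpow_nonneg h1'.le _)
          rw [show θ * θ ^ (γ₂ - c + (d : ℝ) / 2)
            = θ ^ (1 + (γ₂ - c + (d : ℝ) / 2)) by rw [Real.rpow_add h0 1, Real.rpow_one]]
          exact Real.rpow_le_rpow_of_exponent_ge h0 (by linarith) (by linarith)
        refine (((k1'.smul θ).add (k2.smul (1 - θ))).add (k3.smul θ)).monoC hT ?_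
        rw [abs_of_pos h0, abs_of_pos h1']
        refine le_trans ?_ (pw N (by omega))
        have z2 := mul_le_mul_of_nonneg_left q2 hX0
        have z3 := mul_le_mul_of_nonneg_left q3 hX0
        have z1 : θ * (X * q * T) ≤ X * q * T :=
          mul_le_of_le_one_left (by positivity) h1.le
        have z4 : X * q ≤ X * q * T := le_mul_of_one_le_right (by positivity) hT
        calc _ = θ * (X * q * T) + X * ((1 - θ) * qq θ (γ₁ - c + d / 2) (γ₂ + d / 2))
              + X * (θ * qq θ (γ₁ + d / 2) (γ₂ - c + d / 2)) := by ring
          _ ≤ X * q * T + X * q * T + X * q * T := by linarith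
          _ = _ := by ring

/-- integration by parts in the inner variable -/
lemma II_ibp (hκ : 0 < κ) (hT : 0 < T) (h0 : 0 < θ) (h1 : θ < 1) {i : Fin d}
    {Φp Φv P dP : Ker S d} {γ₃ γ₄ γ₅ C₃ C₄ C₅ : ℝ}
    (b1 : Base δ T κ γ₁ C₁ Φ) (b2 : Base δ T κ γ₂ C₂ P) (b3 : Base δ T κ γ₃ C₃ dP)
    (b4 : Base δ T κ γ₄ C₄ Φp) (b5 : Base δ T κ γ₅ C₅ Φv)
    (hp : Has T (Sum.inl i.succ) Φ Φp) (hv : Has T (Sum.inr i.succ) Φ Φv)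
    (hP : Has T (Sum.inr i.succ) P dP) :
    ∀ s b, ∀ x ∈ UU d T, II θ Φ dP s b x = II θ Φv P s b x - II θ Φp P s b x := by
  intro s b x hx
  have eL : ∀ (η : Fin d → ℝ) (t : ℝ), LL θ (η + t • Pi.single i 1) x =
      LL θ η x + t • (ee (Sum.inl i.succ) + (-1 : ℝ) • ee (Sum.inr i.succ)) := by
    intro η t
    simp only [LL, io_add, io_smul, io_single]
    ext j <;> simp [ee] <;> ring
  have eR : ∀ (η : Fin d → ℝ) (t : ℝ), RR θ (η + t • Pi.single i 1) x =
      RR θ η x + t • ee (Sum.inr i.succ) := by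
    intro η t
    simp only [RR, io_add, io_smul, io_single]
    ext j <;> simp [ee] <;> ring
  have i4 := jj_integrable hκ hT h0 h1 b4 b2 s b x hx
  have i5 := jj_integrable hκ hT h0 h1 b5 b2 s b x hx
  have key := integral_bilinear_hasLineDerivAt_right_eq_neg_left_of_integrable
    (μ := (volume : Measure (Fin d → ℝ))) (v := Pi.single i 1) (B := ContinuousLinearMap.mul ℝ ℝ)
    (f := fun η => Φ s b (LL θ η x)) (g := fun η => P s b (RR θ η x))
    (f' := fun η => Φp s b (LL θ η x) + (-1) * Φv s b (LL θ η x))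
    (g' := fun η => dP s b (RR θ η x)) ?_ ?_ ?_ ?_ ?_
  · simp only [ContinuousLinearMap.mul_apply'] at key
    simp only [jj] at i4 i5
    simp only [II, jj]
    rw [key, ← integral_sub i5 i4, ← integral_neg]
    congr 1; ext η; ring
  · simp only [ContinuousLinearMap.mul_apply']
    refine (i4.sub i5).congr (Eventually.of_forall fun η => ?_)
    simp only [jj, Pi.sub_apply]; ring
  · exact jj_integrable hκ hT h0 h1 b1 b3 s b x hx
  · exact jj_integrable hκ hT h0 h1 b1 b2 s b x hx
  · intro η _
    refine line_comp ?_ (eL η)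
    exact line_add (isOpen_UU T) (B := fun x => (-1) * Φv s b x) (fun x hx => hp s b x hx)
      (fun x hx => line_smul (hv s b x hx))
      (continuousOn_const.mul (b5.cont s b)) _ (LL_mem (η := η) h0 h1 hx)
  · intro η _
    exact line_comp (hP s b _ (RR_mem h0 h1 hx)) (eR η)

end VarBPHZ

open MeasureTheory Filter
open scoped BigOperators ENNReal

namespace VarBPHZ

set_option linter.unusedVariables false
set_option linter.unusedSimpArgs false
set_option linter.unusedSectionVars false

set_option linter.unnecessarySeqFocus false

variable {d : ℕ}
variable {S : Type*} {δ : S → NNReal} {T κ κ' κ₁ κ₂ γ γ' γ₁ γ₂ C C' C₁ C₂ : ℝ} {n n' : ℕ}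
  {Φ Φ' Ψ Ψ' : Ker S d}

/-! ## One step of the Volterra iteration -/

variable {θ : ℝ} {η : Fin d → ℝ}

/-- The class together with one extra time derivative. -/
def ClsP (δ : S → NNReal) (T κ : ℝ) (r : ℕ) (γ C : ℝ) (Φ : Ker S d) : Prop :=
  Cls δ T κ r γ C Φ ∧ ∀ m, r = m + 1 →
    (∃ Φt, Has T (Sum.inl 0) Φ Φt ∧ Cls δ T κ m (γ - 1 / 2) C Φt) ∧
    (∃ Φv, Has T (Sum.inr 0) Φ Φv ∧ Cls δ T κ m (γ - 1) C Φv)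

lemma II_piece (hκ : 0 < κ) (hT : 1 ≤ T) (h0 : 0 < θ) (h1 : θ < 1) {m r : ℕ} (hm : m ≤ r)
    {s g w : ℝ} (hs : 0 ≤ s) (hw : s * qq θ (γ₁ + d / 2) (γ₂ + d / 2) ≤ w)
    (hg : g ≤ γ₁ + γ₂ + d / 2) (hg' : γ₁ + γ₂ + d / 2 ≤ g + 1)
    (h : Cls δ T κ m γ₁ C₁ Φ) (h' : Cls δ T κ m γ₂ C₂ Ψ) :
    Cls δ T κ m g ((3 * T) ^ r * c0 d κ * C₂ * T * C₁ * w) (s • II θ Φ Ψ) := by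
  have hn := h.nn
  have hn' := h'.nn
  have hc := c0_pos (d := d) hκ
  have hq : 0 < qq θ (γ₁ + d / 2) (γ₂ + d / 2) := qq_pos h0 h1
  refine ((II_cls hκ hT h0 h1 m h h').smul s).mono hT le_rfl hg ?_
  have hTc : T ^ (γ₁ + γ₂ + d / 2 - g) ≤ T := by
    calc _ ≤ T ^ (1 : ℝ) := Real.rpow_le_rpow_of_exponent_le hT (by linarith)
      _ = T := Real.rpow_one T
  have hp : (3 * T) ^ m ≤ (3 * T) ^ r := pow_le_pow_right₀ (by linarith) hm
  rw [abs_of_nonneg hs]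
  calc _ = (3 * T) ^ m * (c0 d κ * (C₁ * C₂)) * T ^ (γ₁ + γ₂ + d / 2 - g) *
        (s * qq θ (γ₁ + d / 2) (γ₂ + d / 2)) := by ring
    _ ≤ (3 * T) ^ r * (c0 d κ * (C₁ * C₂)) * T * w := by gcongr
    _ = _ := by ring

lemma II_piece1 (hκ : 0 < κ) (hT : 1 ≤ T) (h0 : 0 < θ) (h1 : θ < 1) {m r : ℕ} (hm : m ≤ r)
    {g w : ℝ} (hw : qq θ (γ₁ + d / 2) (γ₂ + d / 2) ≤ w)
    (hg : g ≤ γ₁ + γ₂ + d / 2) (hg' : γ₁ + γ₂ + d / 2 ≤ g + 1)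
    (h : Cls δ T κ m γ₁ C₁ Φ) (h' : Cls δ T κ m γ₂ C₂ Ψ) :
    Cls δ T κ m g ((3 * T) ^ r * c0 d κ * C₂ * T * C₁ * w) (II θ Φ Ψ) := by
  have := II_piece (s := 1) (w := w) hκ hT h0 h1 hm zero_le_one (by rwa [one_mul]) hg hg' h h'
  rwa [one_smul] at this

lemma qq_mono (h0 : 0 < θ) (h1 : θ < 1) (h : γ ≤ γ₁) (h' : γ' ≤ γ₂) :
    qq θ γ₁ γ₂ ≤ qq θ γ γ' := by
  have h1' : 0 < 1 - θ := by linarith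
  exact mul_le_mul (Real.rpow_le_rpow_of_exponent_ge h1' (by linarith) h)
    (Real.rpow_le_rpow_of_exponent_ge h0 h1.le h') (Real.rpow_nonneg h0.le _)
    (Real.rpow_nonneg h1'.le _)

lemma qq_left (h1 : θ < 1) : (1 - θ) * qq θ γ₁ γ₂ = qq θ (γ₁ + 1) γ₂ := by
  unfold qq; rw [Real.rpow_add (by linarith), Real.rpow_one]; ring

lemma qq_right (h0 : 0 < θ) : θ * qq θ γ₁ γ₂ = qq θ γ₁ (γ₂ + 1) := by
  unfold qq; rw [Real.rpow_add h0, Real.rpow_one]; ring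

noncomputable def cst (d : ℕ) (κ T : ℝ) (r : ℕ) (C : ℝ) : ℝ :=
  (3 * T) ^ r * c0 d κ * C * T * (2 * d + 3)

lemma II_sum_right (hκ : 0 < κ) (hT : 1 ≤ T) (h0 : 0 < θ) (h1 : θ < 1) {G0 : Ker S d}
    {dP : Fin d → Ker S d} {γ₃ C₃ : ℝ}
    (b1 : Base δ T κ γ₁ C₁ Φ) (b2 : Base δ T κ γ₂ C₂ G0) (b3 : ∀ i, Base δ T κ γ₃ C₃ (dP i)) :
    ∀ s b, ∀ x ∈ UU d T, II θ Φ (G0 + ∑ i, dP i) s b x =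
      II θ Φ G0 s b x + ∑ i, II θ Φ (dP i) s b x := by
  intro s b x hx
  have hT0 : 0 < T := by linarith
  have i2 := jj_integrable hκ hT0 h0 h1 b1 b2 s b x hx
  have i3 := fun i => jj_integrable hκ hT0 h0 h1 b1 (b3 i) s b x hx
  simp only [II]
  rw [← integral_finsetSum _ fun i _ => i3 i, ← integral_add i2 (integrable_finsetSum _ fun i _ => i3 i)]
  congr 1; ext η
  simp only [jj, Pi.add_apply, Finset.sum_apply, mul_add, Finset.mul_sum]

lemma inner_step (hκ : 0 < κ) (hT : 1 ≤ T) (h0 : 0 < θ) (h1 : θ < 1) {r : ℕ} {a CE : ℝ}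
    {E : Ker S d} (hE : EDat δ T κ r CE E) (h : ClsP δ T κ r (a - d / 2) C Φ) :
    Cls δ T κ r (a - 1 / 2 - d / 2) (cst d κ T r CE * C * qq θ (a - 1 / 2) (-1 / 2)) (II θ Φ E) ∧
    ∀ m, r = m + 1 →
    (∃ J, Has T (Sum.inl 0) (II θ Φ E) J ∧
      Cls δ T κ m (a - 1 - d / 2) (cst d κ T r CE * C * qq θ (a - 1 / 2) (-1 / 2)) J) ∧
    (∃ J, Has T (Sum.inr 0) (II θ Φ E) J ∧
      Cls δ T κ m (a - 3 / 2 - d / 2) (cst d κ T r CE * C * qq θ (a - 1 / 2) (-1 / 2)) J) := by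
  have h1' : 0 < 1 - θ := by linarith
  have hT0 : 0 < T := by linarith
  set w := qq θ (a - 1 / 2) (-1 / 2) with hw
  have hw0 : 0 < w := qq_pos h0 h1
  have hn := h.1.nn
  have hn' := hE.main.nn
  have hc := c0_pos (d := d) hκ
  have hB : cst d κ T r CE * C * w = (3 * T) ^ r * c0 d κ * CE * T * C * w * (2 * d + 3) := by
    unfold cst; ring
  set B := (3 * T) ^ r * c0 d κ * CE * T * C * w with hBd
  have hB0 : 0 ≤ B := by positivity
  have hd0 : (0 : ℝ) ≤ d := Nat.cast_nonneg d
  rw [hB]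
  refine ⟨?_, ?_⟩
  · refine (II_piece1 (w := w) hκ hT h0 h1 le_rfl ?_ (by linarith) (by linarith) h.1 hE.main).monoC hT ?_
    · rw [hw]; exact qq_mono h0 h1 (by linarith) (by linarith)
    · nlinarith
  · intro m hm
    obtain ⟨⟨Φt, ht, ht'⟩, ⟨Φv, hv, hv'⟩⟩ := h.2 m hm
    obtain ⟨G0, Ev, P, dP, e1, e2, e3, e4, e5, e6⟩ := hE.tim m hm
    obtain ⟨dΦ, a1, a2⟩ := h.1.exd
    have hr1 : ∀ D : Dir d, wt D = 1 → wt D ≤ r := fun D hD => by omega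
    have hmr : m ≤ r := by omega
    have e4' : ∀ i, Cls δ T κ m (-1 / 2 - (d : ℝ) / 2 - 1 / 2) CE (dP i) := fun i => by
      have := (e4 i).sub_of_has (by simp) (e2 i)
      simpa using this
    have ePm : ∀ i, Cls δ T κ m (-1 / 2 - (d : ℝ) / 2) CE (P i) := fun i => (e4 i).of_le (by omega)
    have hΦ : Cls δ T κ m (a - d / 2) C Φ := h.1.of_le hmr
    have hEm : Cls δ T κ m (-1 / 2 - (d : ℝ) / 2) CE E := hE.main.of_le hmr
    have hvi : ∀ i : Fin d, Cls δ T κ m (a - d / 2 - 1 / 2) C (dΦ (Sum.inr i.succ)) := fun i => by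
      have := a2 (Sum.inr i.succ) (hr1 _ (by simp))
      subst hm
      simpa using this
    have hpi : ∀ i : Fin d, Cls δ T κ m (a - d / 2) C (dΦ (Sum.inl i.succ)) := fun i => by
      have := a2 (Sum.inl i.succ) (hr1 _ (by simp))
      subst hm
      simpa using this
    refine ⟨⟨II θ Φt E + (II θ Φ G0 + ∑ i : Fin d, (II θ (dΦ (Sum.inr i.succ)) (P i) +
      (-1 : ℝ) • II θ (dΦ (Sum.inl i.succ)) (P i))), ?_, ?_⟩,
      ⟨θ • II θ Φt E + (1 - θ) • II θ Φv E + θ • II θ Φ Ev, ?_, ?_⟩⟩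
    · have bs : ∃ C, Base δ T κ (-1 / 2 - (d : ℝ) / 2 - 1 / 2) C (G0 + ∑ i, dP i) :=
        ⟨_, (((e3.mono hT le_rfl (by linarith) le_rfl).add
          (Cls.sum hT Finset.univ CE fun i _ => e4' i))).base⟩
      obtain ⟨C', bs⟩ := bs
      refine (II_inl hκ hT h0 h1 hΦ.base hEm.base ht'.base bs ht e1).congr (fun _ _ _ _ => rfl) ?_
      intro s b x hx
      simp only [Pi.add_apply, Finset.sum_apply, Pi.smul_apply, smul_eq_mul]
      rw [II_sum_right hκ hT h0 h1 hΦ.base e3.base (fun i => (e4' i).base) s b x hx]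
      congr 2
      refine Finset.sum_congr rfl fun i _ => ?_
      rw [II_ibp hκ hT0 h0 h1 hΦ.base (ePm i).base (e4' i).base (hpi i).base (hvi i).base
        (a1 _ (hr1 _ (by simp))) (a1 _ (hr1 _ (by simp))) (e2 i) s b x hx]
      ring
    · have p1 : Cls δ T κ m (a - 1 - d / 2) B (II θ Φt E) :=
        II_piece1 hκ hT h0 h1 hmr (by rw [hw]; exact qq_mono h0 h1 (by linarith) (by linarith))
          (by linarith) (by linarith) ht' hEm
      have p2 : Cls δ T κ m (a - 1 - d / 2) B (II θ Φ G0) :=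
        II_piece1 hκ hT h0 h1 hmr (by rw [hw]; exact qq_mono h0 h1 (by linarith) (by linarith))
          (by linarith) (by linarith) hΦ e3
      have p3 : ∀ i : Fin d, Cls δ T κ m (a - 1 - d / 2) B (II θ (dΦ (Sum.inr i.succ)) (P i)) := fun i =>
        II_piece1 hκ hT h0 h1 hmr (by rw [hw]; exact qq_mono h0 h1 (by linarith) (by linarith))
          (by linarith) (by linarith) (hvi i) (ePm i)
      have p4 : ∀ i : Fin d, Cls δ T κ m (a - 1 - d / 2) B (II θ (dΦ (Sum.inl i.succ)) (P i)) := fun i =>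
        II_piece1 hκ hT h0 h1 hmr (by rw [hw]; exact qq_mono h0 h1 (by linarith) (by linarith))
          (by linarith) (by linarith) (hpi i) (ePm i)
      refine (p1.add (p2.add (Cls.sum hT Finset.univ (B + |-1| * B) fun i _ =>
        (p3 i).add ((p4 i).smul (-1))))).monoC hT ?_
      simp only [Finset.card_univ, Fintype.card_fin, abs_neg, abs_one]
      nlinarith
    · exact II_inr hκ hT h0 h1 hΦ.base hEm.base ht'.base hv'.base e6.base ht hv e5
    · have p1 : Cls δ T κ m (a - 3 / 2 - d / 2) B (θ • II θ Φt E) :=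
        II_piece hκ hT h0 h1 hmr h0.le (by
          rw [hw, qq_right h0]; exact qq_mono h0 h1 (by linarith) (by linarith))
          (by linarith) (by linarith) ht' hEm
      have p2 : Cls δ T κ m (a - 3 / 2 - d / 2) B ((1 - θ) • II θ Φv E) :=
        II_piece hκ hT h0 h1 hmr h1'.le (by
          rw [hw, qq_left h1]; exact qq_mono h0 h1 (by linarith) (by linarith))
          (by linarith) (by linarith) hv' hEm
      have p3 : Cls δ T κ m (a - 3 / 2 - d / 2) B (θ • II θ Φ Ev) :=
        II_piece hκ hT h0 h1 hmr h0.le (by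
          rw [hw, qq_right h0]; exact qq_mono h0 h1 (by linarith) (by linarith))
          (by linarith) (by linarith) hΦ e6
      refine ((p1.add p2).add p3).monoC hT ?_
      nlinarith

lemma int_has {Y : Type*} [MeasurableSpace Y] {μ : Measure Y} {w : Y → ℝ} {I : Y → Ker S d} {m : ℕ}
    {D : Dir d} (hw : Integrable w μ) (h : ∀ᵐ y ∂μ, Base δ T κ γ (C * w y) (I y))
    (hJ : ∀ᵐ y ∂μ, ∃ J, Has T D (I y) J ∧ Cls δ T κ m γ' (C * w y) J)
    (hm : ∀ s b, ∀ x ∈ UU d T, AEStronglyMeasurable (fun y => I y s b x) μ) :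
    ∃ J, Has T D (fun s b x => ∫ y, I y s b x ∂μ) J ∧ Cls δ T κ m γ' (C * ∫ y, w y ∂μ) J := by
  classical
  set J : Y → Ker S d := fun y =>
    if hh : ∃ J, Has T D (I y) J ∧ Cls δ T κ m γ' (C * w y) J then hh.choose else 0 with hJd
  have hspec : ∀ᵐ y ∂μ, Has T D (I y) (J y) ∧ Cls δ T κ m γ' (C * w y) (J y) := by
    filter_upwards [hJ] with y hy
    simp only [hJd, dif_pos hy]
    exact hy.choose_spec
  have s1 : ∀ᵐ y ∂μ, Has T D (I y) (J y) := hspec.mono fun y hy => hy.1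
  have s2 : ∀ᵐ y ∂μ, Cls δ T κ m γ' (C * w y) (J y) := hspec.mono fun y hy => hy.2
  exact ⟨fun s b x => ∫ y, J y s b x ∂μ,
    Has.integral hw hw h (s2.mono fun y hy => hy.base) hm s1,
    Cls.integral hw m s2 (Has.meas hm s1)⟩

end VarBPHZ

open MeasureTheory Filter
open scoped BigOperators ENNReal

namespace VarBPHZ

set_option linter.unusedVariables false
set_option linter.unusedSimpArgs false
set_option linter.unusedSectionVars false

set_option linter.unnecessarySeqFocus false

variable {d : ℕ}
variable {S : Type*} {δ : S → NNReal} {T κ κ' κ₁ κ₂ γ γ' γ₁ γ₂ C C' C₁ C₂ : ℝ} {n n' : ℕ}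
  {Φ Φ' Ψ Ψ' : Ker S d}

variable {θ : ℝ} {η : Fin d → ℝ}

noncomputable def bb (a : ℝ) : ℝ := ∫ θ in Set.Ioo (0 : ℝ) 1, qq θ (a - 1 / 2) (-1 / 2)

lemma qq_measurable (g g' : ℝ) : Measurable fun θ : ℝ => qq θ g g' := by
  unfold qq; fun_prop

lemma qq_int0 : IntegrableOn (fun θ : ℝ => qq θ (-1 / 2) (-1 / 2)) (Set.Ioo 0 1) := by
  have i1 : IntervalIntegrable (fun θ : ℝ => θ ^ (-1 / 2 : ℝ)) volume 0 1 :=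
    intervalIntegral.intervalIntegrable_rpow' (by norm_num)
  have i2 : IntervalIntegrable (fun θ : ℝ => (1 - θ) ^ (-1 / 2 : ℝ)) volume 0 1 := by
    have := (i1.comp_sub_left 1).symm
    simpa using this
  have j1 := (intervalIntegrable_iff_integrableOn_Ioo_of_le zero_le_one).1 i1
  have j2 := (intervalIntegrable_iff_integrableOn_Ioo_of_le zero_le_one).1 i2
  refine (j1.add j2).mono' (qq_measurable _ _).aestronglyMeasurable ?_
  filter_upwards [ae_restrict_mem measurableSet_Ioo] with θ hθ
  have hp : 0 < qq θ (-1 / 2) (-1 / 2) := qq_pos hθ.1 hθ.2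
  rw [Real.norm_eq_abs, abs_of_pos hp]
  have e : qq θ (-1 / 2) (-1 / 2) = (1 - θ) * qq θ (-1 / 2) (-1 / 2) + θ * qq θ (-1 / 2) (-1 / 2) := by
    ring
  rw [e, qq_left hθ.2, qq_right hθ.1]
  have a1 : qq θ (-1 / 2 + 1) (-1 / 2) ≤ qq θ 0 (-1 / 2) := qq_mono hθ.1 hθ.2 (by norm_num) le_rfl
  have a2 : qq θ (-1 / 2) (-1 / 2 + 1) ≤ qq θ (-1 / 2) 0 := qq_mono hθ.1 hθ.2 le_rfl (by norm_num)
  refine (add_le_add a1 a2).trans (le_of_eq ?_)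
  simp [qq]

lemma qq_int {a : ℝ} (ha : 0 ≤ a) :
    IntegrableOn (fun θ : ℝ => qq θ (a - 1 / 2) (-1 / 2)) (Set.Ioo 0 1) := by
  refine qq_int0.mono' (qq_measurable _ _).aestronglyMeasurable ?_
  filter_upwards [ae_restrict_mem measurableSet_Ioo] with θ hθ
  rw [Real.norm_eq_abs, abs_of_pos (qq_pos hθ.1 hθ.2)]
  exact qq_mono hθ.1 hθ.2 (by linarith) le_rfl

lemma bb_nonneg (a : ℝ) : 0 ≤ bb a :=
  setIntegral_nonneg measurableSet_Ioo fun θ hθ => (qq_pos hθ.1 hθ.2).le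

lemma bb_tendsto : Tendsto (fun k : ℕ => bb ((k : ℝ) / 2)) atTop (nhds 0) := by
  have : Tendsto (fun k : ℕ => bb ((k : ℝ) / 2)) atTop
      (nhds (∫ θ in Set.Ioo (0 : ℝ) 1, (0 : ℝ))) := by
    unfold bb
    refine tendsto_integral_of_dominated_convergence _
      (fun k => (qq_measurable _ _).aestronglyMeasurable) qq_int0 (fun k => ?_) ?_
    · filter_upwards [ae_restrict_mem measurableSet_Ioo] with θ hθ
      rw [Real.norm_eq_abs, abs_of_pos (qq_pos hθ.1 hθ.2)]
      have : (0 : ℝ) ≤ k := Nat.cast_nonneg k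
      exact qq_mono hθ.1 hθ.2 (by linarith) le_rfl
    · filter_upwards [ae_restrict_mem measurableSet_Ioo] with θ hθ
      have h1 : 0 < 1 - θ := by linarith [hθ.2]
      have t := tendsto_rpow_atTop_of_base_lt_one (1 - θ) (by linarith) (by linarith [hθ.1])
      have t2 : Tendsto (fun k : ℕ => (k : ℝ) / 2 - 1 / 2) atTop atTop :=
        tendsto_atTop_add_const_right _ _
          (tendsto_natCast_atTop_atTop.atTop_div_const (by norm_num))
      have := (t.comp t2).mul_const (θ ^ (-1 / 2 : ℝ))
      simpa [qq, Function.comp_def] using this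
  simpa using this

/-- The time coordinate kernel. -/
def uK : Ker S d := fun _ _ x => x.2 0

noncomputable def cK (E Φ : Ker S d) : Ker S d := fun s b x => ∫ θ in Set.Ioo (0 : ℝ) 1, II θ Φ E s b x

noncomputable def nxt (E Φ : Ker S d) : Ker S d := uK * cK E Φ

lemma uK_uc (hT : 1 ≤ T) (n : ℕ) : UC δ T 0 n 1 (uK : Ker S d) :=
  (UC.upow hT n 1).congr fun s b x hx => by simp [uK]

lemma Has_uK0 : Has T (Sum.inl 0) (uK : Ker S d) 0 := fun s b x hx => by
  have := hasLine_coord 0 (Sum.inl 0) x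
  rw [show ((ee (Sum.inl 0) : XX d).2 0) = 0 by simp [ee]] at this
  exact this

lemma Has_uK1 : Has T (Sum.inr 0) (uK : Ker S d) 1 := fun s b x hx => by
  have := hasLine_coord 0 (Sum.inr 0) x
  rw [show ((ee (Sum.inr 0) : XX d).2 0) = 1 by simp [ee]] at this
  exact this

lemma outer_step (hκ : 0 < κ) (hT : 1 ≤ T) {r : ℕ} {CE : ℝ}
    {E : Ker S d} (hE : EDat δ T κ r CE E) :
    ∃ c : ℝ, 0 ≤ c ∧ ∀ (a C : ℝ) (Φ : Ker S d), 0 ≤ a → ClsP δ T κ r (a - d / 2) C Φ →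
      ClsP δ T κ r (a + 1 / 2 - d / 2) (c * C * bb a) (nxt E Φ) := by
  obtain ⟨Cu, hu⟩ := uK_uc (δ := δ) (d := d) hT r
  have hCu := hu.nn
  have hCE := hE.main.nn
  have hc0 := c0_pos (d := d) hκ
  have hcst : 0 ≤ cst d κ T r CE := by unfold cst; positivity
  refine ⟨(2 ^ (r + 1) * Cu + 1) * cst d κ T r CE, by positivity, fun a C Φ ha h => ?_⟩
  have hC := h.1.nn
  set w : ℝ → ℝ := fun θ => qq θ (a - 1 / 2) (-1 / 2) with hw
  have hwi : Integrable w (volume.restrict (Set.Ioo (0 : ℝ) 1)) := qq_int ha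
  have hb := bb_nonneg a
  have hm := II_measθ (T := T) (fun s b => h.1.base.cont s b) (fun s b => hE.main.base.cont s b)
  have st : ∀ᵐ θ ∂(volume.restrict (Set.Ioo (0 : ℝ) 1)), 0 < θ ∧ θ < 1 :=
    ae_restrict_mem measurableSet_Ioo
  set B := cst d κ T r CE * C with hB
  have hB0 : 0 ≤ B := by positivity
  have m1 : Cls δ T κ r (a - 1 / 2 - d / 2) (B * bb a) (cK E Φ) :=
    Cls.integral hwi r (st.mono fun θ hθ => (inner_step hκ hT hθ.1 hθ.2 hE h).1) hm
  have hBb : 0 ≤ B * bb a := by positivity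
  have hle : 2 ^ (r + 1) * (Cu * (B * bb a)) ≤ (2 ^ (r + 1) * Cu + 1) * cst d κ T r CE * C * bb a := by
    have : (2 ^ (r + 1) * Cu + 1) * cst d κ T r CE * C * bb a =
      2 ^ (r + 1) * (Cu * (B * bb a)) + B * bb a := by rw [hB]; ring
    linarith
  refine ⟨?_, fun m hmr => ?_⟩
  · have := Cls.mul hT r hu m1
    rw [zero_add] at this
    refine Cls.monoC hT ?_ hle
    rw [show a + 1 / 2 - (d : ℝ) / 2 = 1 + (a - 1 / 2 - d / 2) by ring]
    exact this
  · have hmle : m ≤ r := by omega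
    obtain ⟨Jt, t1, t2⟩ := int_has (T := T) hwi
      (st.mono fun θ hθ => (inner_step hκ hT hθ.1 hθ.2 hE h).1.base)
      (st.mono fun θ hθ => ((inner_step hκ hT hθ.1 hθ.2 hE h).2 m hmr).1) hm
    change Cls δ T κ m _ (B * bb a) _ at t2
    obtain ⟨Jv, v1, v2⟩ := int_has (T := T) hwi
      (st.mono fun θ hθ => (inner_step hκ hT hθ.1 hθ.2 hE h).1.base)
      (st.mono fun θ hθ => ((inner_step hκ hT hθ.1 hθ.2 hE h).2 m hmr).2) hm
    change Cls δ T κ m _ (B * bb a) _ at v2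
    have hp : (2 : ℝ) ^ (m + 1) ≤ 2 ^ (r + 1) := pow_le_pow_right₀ (by norm_num) (by omega)
    have hle' : 2 ^ (m + 1) * (Cu * (B * bb a)) ≤ 2 ^ (r + 1) * (Cu * (B * bb a)) := by gcongr
    refine ⟨⟨uK * Jt, ?_, ?_⟩, ⟨cK E Φ + uK * Jv, ?_, ?_⟩⟩
    · refine (Has_uK0.mul t1).congr (fun _ _ _ _ => rfl) fun s b x hx => ?_
      simp
    · have := Cls.mul hT m (hu.of_le hmle) t2
      rw [zero_add] at this
      refine Cls.monoC hT ?_ (hle'.trans hle)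
      convert this using 1
      ring
    · refine (Has_uK1.mul v1).congr (fun _ _ _ _ => rfl) fun s b x hx => ?_
      simp [cK]
    · have := Cls.mul hT m (hu.of_le hmle) v2
      rw [zero_add] at this
      have m1' : Cls δ T κ m (a + 1 / 2 - d / 2 - 1) (B * bb a) (cK E Φ) := by
        convert m1.of_le hmle using 1; ring
      have t2' : Cls δ T κ m (a + 1 / 2 - d / 2 - 1) (2 ^ (m + 1) * (Cu * (B * bb a))) (uK * Jv) := by
        convert this using 1; ring
      refine (m1'.add t2').monoC hT ?_
      have : (2 ^ (r + 1) * Cu + 1) * cst d κ T r CE * C * bb a =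
        2 ^ (r + 1) * (Cu * (B * bb a)) + B * bb a := by rw [hB]; ring
      linarith

/-- The Volterra kernels in shifted coordinates. -/
noncomputable def VV (A : S → Bool → Coeffs d) : ℕ → Ker S d
  | 0 => kW A
  | k + 1 => nxt (-kE A) (VV A k)

lemma ratio_summable {c C0 : ℝ} (hc : 0 ≤ c) (hC : 0 ≤ C0) :
    ∃ u : ℕ → ℝ, (∀ R : ℝ, 0 ≤ R → Summable fun k => u k * R ^ k) ∧ u 0 = C0 ∧
      ∀ k, u (k + 1) = c * u k * bb (k / 2) := by
  set u : ℕ → ℝ := fun k => Nat.rec C0 (fun k p => c * p * bb ((k : ℝ) / 2)) k with hu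
  have h1 : ∀ k, u (k + 1) = c * u k * bb (k / 2) := fun k => rfl
  refine ⟨u, fun R hR => ?_, rfl, h1⟩
  have t : Tendsto (fun k : ℕ => c * R * bb ((k : ℝ) / 2)) atTop (nhds 0) := by
    simpa using bb_tendsto.const_mul (c * R)
  have ev := t.eventually (gt_mem_nhds (show (0 : ℝ) < 1 / 2 by norm_num))
  refine summable_of_ratio_norm_eventually_le (r := 1 / 2) (by norm_num) ?_
  filter_upwards [ev] with k hk
  have := bb_nonneg ((k : ℝ) / 2)
  have e : u (k + 1) * R ^ (k + 1) = (c * R * bb ((k : ℝ) / 2)) * (u k * R ^ k) := by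
    rw [h1]; ring
  rw [e, norm_mul, Real.norm_eq_abs (c * R * _), abs_of_nonneg (by positivity)]
  have hn := norm_nonneg (u k * R ^ k)
  nlinarith

lemma Dat.VV_cls {lam M : ℝ} {r : ℕ} {A : S → Bool → Coeffs d} (hlam : 0 < lam) (hT : 1 ≤ T)
    (h : Dat δ lam (r + 2) M A) (hκ0 : 0 < κ) (hκ : κ < lam / 4) :
    ∃ u : ℕ → ℝ, (∀ R : ℝ, 0 ≤ R → Summable fun k => u k * R ^ k) ∧ ∀ k : ℕ, ClsP δ T κ r ((k : ℝ) / 2 - d / 2) (u k) (VV A k) := by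
  obtain ⟨CE, hE⟩ := h.edat hlam hT hκ
  obtain ⟨c, hc, hs⟩ := outer_step hκ0 hT hE
  obtain ⟨C0, h0⟩ := h.kW_uc hlam hT hκ
  have hC0 := h0.nn
  have hTp : 0 ≤ T := by linarith
  have hT2 : 1 ≤ T ^ (1 / 2 : ℝ) := Real.one_le_rpow hT (by norm_num)
  obtain ⟨u, u1, u2, u3⟩ := ratio_summable (C0 := C0 * T ^ (1 / 2 : ℝ)) hc (by positivity)
  have hle : C0 ≤ C0 * T ^ (1 / 2 : ℝ) := le_mul_of_one_le_right hC0 hT2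
  refine ⟨u, u1, fun k => ?_⟩
  induction k with
  | zero =>
    rw [u2]
    have e : ((0 : ℕ) : ℝ) / 2 - d / 2 = -(d : ℝ) / 2 := by push_cast; ring
    rw [e]
    refine ⟨(h0.of_le (by omega)).monoC hT hle, fun m hm => ?_⟩
    obtain ⟨dΦ, a1, a2⟩ := h0.exd
    have w1 : wt (Sum.inl 0 : Dir d) ≤ r + 2 := by simp
    have w2 : wt (Sum.inr 0 : Dir d) ≤ r + 2 := by simp
    refine ⟨⟨_, a1 _ w1, ?_⟩, ⟨_, a1 _ w2, ?_⟩⟩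
    · refine ((a2 _ w1).of_le (m := m) (by simp; omega)).mono hT le_rfl (by simp) ?_
      simp
    · refine ((a2 _ w2).of_le (m := m) (by simp; omega)).mono hT le_rfl (by simp) ?_
      simpa using hle
  | succ k ih =>
    rw [u3]
    have := hs _ _ _ (by positivity) ih
    rw [show ((k + 1 : ℕ) : ℝ) / 2 - (d : ℝ) / 2 = (k : ℝ) / 2 + 1 / 2 - d / 2 by push_cast; ring]
    exact this

end VarBPHZ

open MeasureTheory Filter
open scoped BigOperators ENNReal

namespace VarBPHZ

set_option linter.unusedVariables false
set_option linter.unusedSimpArgs false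
set_option linter.unusedSectionVars false

set_option linter.unnecessarySeqFocus false

variable {d : ℕ}
variable {S : Type*} {δ : S → NNReal} {T κ κ' κ₁ κ₂ γ γ' γ₁ γ₂ C C' C₁ C₂ : ℝ} {n n' : ℕ}
  {Φ Φ' Ψ Ψ' : Ker S d}

variable {θ : ℝ} {η : Fin d → ℝ}

lemma Base.abs (h : Base δ T κ γ C Φ) : Base δ T κ γ C (fun s b x => |Φ s b x|) where
  nn := h.nn
  cont s b := (h.cont s b).abs
  bd s x hx := by
    obtain ⟨h1, h2⟩ := h.bd s x hx
    refine ⟨fun b => ?_, ?_⟩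
    · have := h1 b; rwa [abs_abs]
    · exact (abs_abs_sub_abs_le _ _).trans h2

lemma jj_prod_integrable (hκ : 0 < κ) (hT : 0 < T) {a : ℝ} (ha : 0 ≤ a)
    (h : Base δ T κ (a - d / 2) C₁ Φ) (h' : Base δ T κ (-1 / 2 - d / 2) C₂ Ψ) (s : S) (b : Bool)
    (x : XX d) (hx : x ∈ UU d T) :
    Integrable (fun q : ℝ × (Fin d → ℝ) => jj q.1 q.2 Φ Ψ s b x)
      ((volume.restrict (Set.Ioo (0 : ℝ) 1)).prod volume) := by
  have st : ∀ᵐ θ ∂(volume.restrict (Set.Ioo (0 : ℝ) 1)), 0 < θ ∧ θ < 1 :=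
    ae_restrict_mem measurableSet_Ioo
  have hme : AEStronglyMeasurable (fun q : ℝ × (Fin d → ℝ) => jj q.1 q.2 Φ Ψ s b x)
      ((volume.restrict (Set.Ioo (0 : ℝ) 1)).prod volume) := by
    have e : (volume.restrict (Set.Ioo (0 : ℝ) 1)).prod (volume : Measure (Fin d → ℝ)) =
        (volume.prod volume).restrict (Set.Ioo 0 1 ×ˢ Set.univ) := by
      rw [← Measure.prod_restrict, Measure.restrict_univ]
    rw [e]
    exact (jj_contθ (h.cont s b) (h'.cont s b) hx).aestronglyMeasurable
      (measurableSet_Ioo.prod MeasurableSet.univ)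
  rw [integrable_prod_iff hme]
  refine ⟨st.mono fun θ hθ => jj_integrable hκ hT hθ.1 hθ.2 h h' s b x hx, ?_⟩
  have := Base.integrable (C := c0 d κ * (C₁ * C₂)) (w := fun θ => qq θ (a + 1 / 2 - 1 / 2) (-1 / 2))
    (I := fun θ => II θ (fun s b x => |Φ s b x|) (fun s b x => |Ψ s b x|))
    (qq_int (by linarith))
    (st.mono fun θ hθ => by
      have := II_base hκ hT hθ.1 hθ.2 h.abs h'.abs
      rw [show a - (d : ℝ) / 2 + d / 2 = a + 1 / 2 - 1 / 2 by ring,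
        show -1 / 2 - (d : ℝ) / 2 + d / 2 = -1 / 2 by ring] at this
      exact this)
    (II_measθ (fun s b => h.abs.cont s b) (fun s b => h'.abs.cont s b)) s b x hx
  refine this.congr (Eventually.of_forall fun θ => ?_)
  simp only [II]
  congr 1; ext η
  simp only [jj, Real.norm_eq_abs, abs_mul]

lemma cov_map {p v : Pt d} (hv : 0 < v 0) :
    MeasurableEmbedding (fun q : ℝ × (Fin d → ℝ) => p + q.1 • v + io q.2) ∧
    Measure.map (fun q : ℝ × (Fin d → ℝ) => p + q.1 • v + io q.2) (volume.prod volume) =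
      ENNReal.ofReal (v 0)⁻¹ • volume := by
  have hc : Continuous (fun q : ℝ × (Fin d → ℝ) => p + q.1 • v + io q.2) :=
    (continuous_const.add (continuous_fst.smul continuous_const)).add
      (continuous_io.comp continuous_snd)
  have hi : Function.Injective (fun q : ℝ × (Fin d → ℝ) => p + q.1 • v + io q.2) := by
    rintro ⟨t, e⟩ ⟨t', e'⟩ h
    have h0 := congrFun h 0
    simp only [Pi.add_apply, Pi.smul_apply, smul_eq_mul, io_zero, add_zero] at h0
    have ht : t = t' := by
      have : t * v 0 = t' * v 0 := by linarith
      exact mul_right_cancel₀ hv.ne' this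
    subst ht
    have : e = e' := by
      ext i
      have := congrFun h i.succ
      simpa using this
    rw [this]
  refine ⟨hc.measurableEmbedding hi, ?_⟩
  set Mx : Matrix (Fin (d + 1)) (Fin (d + 1)) ℝ := (1 : Matrix _ _ ℝ).updateCol 0 v with hMx
  have hdet : Mx.det = v 0 := by
    rw [hMx, ← Matrix.cramer_apply, Matrix.cramer_one]; rfl
  have hL := Real.map_matrix_volume_pi_eq_smul_volume_pi (M := Mx) (by rw [hdet]; exact hv.ne')
  rw [hdet, abs_of_pos (inv_pos.2 hv)] at hL
  have he := (volume_preserving_piFinSuccAbove (fun _ : Fin (d + 1) => ℝ) 0).symm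
  have hp := measurePreserving_add_left (volume : Measure (Pt d)) p
  have hcomp : (fun q : ℝ × (Fin d → ℝ) => p + q.1 • v + io q.2) =
      (fun y => p + y) ∘ (Matrix.toLin' Mx) ∘
        (MeasurableEquiv.piFinSuccAbove (fun _ : Fin (d + 1) => ℝ) 0).symm := by
    funext q
    ext i
    simp only [Function.comp_apply, Pi.add_apply, Matrix.toLin'_apply, Pi.smul_apply, smul_eq_mul,
      Matrix.mulVec, dotProduct, Fin.sum_univ_succ, hMx, Matrix.updateCol_apply]
    refine Fin.cases ?_ (fun j => ?_) i
    · have h0 : ∀ x : Fin d, (0 : Fin (d + 1)) ≠ x.succ := fun x => (Fin.succ_ne_zero x).symm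
      simp [Matrix.one_apply, MeasurableEquiv.piFinSuccAbove, Fin.insertNthEquiv, h0]
      ring
    · simp [Matrix.one_apply, MeasurableEquiv.piFinSuccAbove, Fin.insertNthEquiv]
      ring
  have mL : Measurable (Matrix.toLin' Mx) := (LinearMap.continuous_of_finiteDimensional _).measurable
  rw [hcomp, ← Measure.map_map hp.measurable (mL.comp (MeasurableEquiv.measurable _)),
    ← Measure.map_map mL (MeasurableEquiv.measurable _)]
  have h2 : Measure.map (MeasurableEquiv.piFinSuccAbove (fun _ : Fin (d + 1) => ℝ) 0).symm
    (volume.prod volume) = volume := he.map_eq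
  rw [h2, hL, Measure.map_smul, hp.map_eq]

lemma cov {p v : Pt d} (hv : 0 < v 0) (F : Pt d → ℝ) :
    ∫ ζ, F ζ = v 0 * ∫ q : ℝ × (Fin d → ℝ), F (p + q.1 • v + io q.2) ∂(volume.prod volume) := by
  obtain ⟨h1, h2⟩ := cov_map (p := p) hv
  have := h1.integral_map (μ := volume.prod volume) F
  rw [← this, h2, integral_smul_measure, ENNReal.toReal_ofReal (inv_pos.2 hv).le, smul_eq_mul]
  field_simp

lemma conv_eq (hκ : 0 < κ) {a : ℝ} (ha : 0 ≤ a) {s : S} {b : Bool} 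
    (hB : ∀ T, 1 ≤ T → ∃ C, Base δ T κ (a - d / 2) C Φ)
    (hB' : ∀ T, 1 ≤ T → ∃ C, Base δ T κ (-1 / 2 - d / 2) C Ψ) {F G : Pt d → Pt d → ℝ}
    (hF : ∀ z zb, F z zb = if zb 0 < z 0 then Φ s b (zb, z - zb) else 0)
    (hG : ∀ z zb, G z zb = if zb 0 < z 0 then Ψ s b (zb, z - zb) else 0) (z zb : Pt d) :
    conv F G z zb = if zb 0 < z 0 then nxt Ψ Φ s b (zb, z - zb) else 0 := by
  unfold conv
  split_ifs with hz
  · have hv : 0 < (z - zb) 0 := by simpa using hz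
    set T := max 1 ((z - zb) 0 + 1) with hT
    have hT1 : 1 ≤ T := le_max_left _ _
    obtain ⟨C₁, h1⟩ := hB T hT1
    obtain ⟨C₂, h2⟩ := hB' T hT1
    have hx : ((zb, z - zb) : XX d) ∈ UU d T :=
      ⟨hv, lt_of_lt_of_le (by simp) (le_max_right _ _)⟩
    have hIntb := jj_prod_integrable hκ (by linarith) ha h1 h2 s b _ hx
    rw [cov (p := zb) hv]
    change _ = (z - zb) 0 * ∫ θ in Set.Ioo (0 : ℝ) 1, ∫ η, jj θ η Φ Ψ s b (zb, z - zb)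
    congr 1
    rw [← integral_prod _ hIntb]
    have e : (volume.restrict (Set.Ioo (0 : ℝ) 1)).prod (volume : Measure (Fin d → ℝ)) =
        (volume.prod volume).restrict (Set.Ioo 0 1 ×ˢ Set.univ) := by
      rw [← Measure.prod_restrict, Measure.restrict_univ]
    rw [e, ← integral_indicator (measurableSet_Ioo.prod MeasurableSet.univ)]
    congr 1; funext q
    have c1 : (zb + q.1 • (z - zb) + io q.2) 0 < z 0 ↔ q.1 < 1 := by
      simp only [Pi.add_apply, Pi.smul_apply, Pi.sub_apply, smul_eq_mul, io_zero, add_zero] at hv ⊢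
      constructor <;> intro h <;> nlinarith
    have c2 : zb 0 < (zb + q.1 • (z - zb) + io q.2) 0 ↔ 0 < q.1 := by
      simp only [Pi.add_apply, Pi.smul_apply, Pi.sub_apply, smul_eq_mul, io_zero, add_zero] at hv ⊢
      constructor <;> intro h <;> nlinarith
    rw [hF, hG, Set.indicator_apply]
    simp only [c1, c2, Set.mem_prod, Set.mem_Ioo, Set.mem_univ, and_true]
    by_cases q0 : 0 < q.1 <;> by_cases q1 : q.1 < 1 <;> simp only [q0, q1, if_true, if_false, and_true,
      and_false, mul_zero, zero_mul, false_and, true_and]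
    simp only [jj, LL, RR]
    have e1 : z - (zb + q.1 • (z - zb) + io q.2) = (1 - q.1) • (z - zb) - io q.2 := by module
    have e2 : zb + q.1 • (z - zb) + io q.2 - zb = q.1 • (z - zb) + io q.2 := by module
    rw [e1, e2]
  · have : ∀ ζ, F z ζ * G ζ zb = 0 := fun ζ => by
      rw [hF, hG]
      by_cases h1 : ζ 0 < z 0
      · rw [if_neg (c := zb 0 < ζ 0) (by linarith), mul_zero]
      · rw [if_neg h1, zero_mul]
    simp [this]

lemma Dat.volterra_eq {lam M : ℝ} {r : ℕ} {A : S → Bool → Coeffs d} (hlam : 0 < lam)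
    (h : Dat δ lam (r + 2) M A) (k : ℕ) (s : S) (b : Bool) : ∀ z zb,
    volterra (A s b) k z zb = if zb 0 < z 0 then VV A k s b (zb, z - zb) else 0 := by
  induction k with
  | zero => exact fun z zb => Zker_eq A s b z zb
  | succ k ih =>
    refine conv_eq (δ := δ) (κ := lam / 8) (a := (k : ℝ) / 2) (by positivity) (by positivity) (fun T hT => ?_)
      (fun T hT => ?_) ih fun z zb => ?_
    · obtain ⟨u, u1, u2⟩ := h.VV_cls (κ := lam / 8) hlam hT (by positivity) (by linarith)
      exact ⟨_, (u2 k).1.base⟩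
    · obtain ⟨CE, hE⟩ := h.edat (κ := lam / 8) hlam hT (by linarith)
      exact ⟨_, hE.main.base⟩
    · rw [Eker_eq]
      split_ifs <;> simp

end VarBPHZ

open MeasureTheory Filter
open scoped BigOperators ENNReal

namespace VarBPHZ

set_option linter.unusedVariables false
set_option linter.unusedSimpArgs false
set_option linter.unusedSectionVars false

set_option linter.unnecessarySeqFocus false

variable {d : ℕ}
variable {S : Type*} {δ : S → NNReal} {T κ κ' κ₁ κ₂ γ γ' γ₁ γ₂ C C' C₁ C₂ : ℝ} {n n' : ℕ}
  {Φ Φ' Ψ Ψ' : Ker S d}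

/-! ## Properties of `ClsP` -/

lemma ClsP.mono {r : ℕ} (hT : 1 ≤ T) (h : ClsP δ T κ r γ C Φ) (hγ : γ' ≤ γ)
    (hC : C * T ^ (γ - γ') ≤ C') : ClsP δ T κ r γ' C' Φ := by
  refine ⟨h.1.mono hT le_rfl hγ hC, fun m hm => ?_⟩
  obtain ⟨⟨A, a1, a2⟩, ⟨B, b1, b2⟩⟩ := h.2 m hm
  refine ⟨⟨A, a1, a2.mono hT le_rfl (by linarith) (by simpa using hC)⟩,
    ⟨B, b1, b2.mono hT le_rfl (by linarith) (by simpa using hC)⟩⟩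

lemma ClsP.add {r : ℕ} (h : ClsP δ T κ r γ C₁ Φ) (h' : ClsP δ T κ r γ C₂ Ψ) :
    ClsP δ T κ r γ (C₁ + C₂) (Φ + Ψ) := by
  refine ⟨h.1.add h'.1, fun m hm => ?_⟩
  obtain ⟨⟨A, a1, a2⟩, ⟨B, b1, b2⟩⟩ := h.2 m hm
  obtain ⟨⟨A', a1', a2'⟩, ⟨B', b1', b2'⟩⟩ := h'.2 m hm
  exact ⟨⟨_, a1.add a1', a2.add a2'⟩, ⟨_, b1.add b1', b2.add b2'⟩⟩

lemma ClsP.neg {r : ℕ} (h : ClsP δ T κ r γ C Φ) : ClsP δ T κ r γ C (-Φ) := by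
  refine ⟨h.1.neg, fun m hm => ?_⟩
  obtain ⟨⟨A, a1, a2⟩, ⟨B, b1, b2⟩⟩ := h.2 m hm
  exact ⟨⟨-A, by simpa using a1.smul (-1), a2.neg⟩, ⟨-B, by simpa using b1.smul (-1), b2.neg⟩⟩

lemma ClsP.deriv {r : ℕ} {D : Dir d} (h : ClsP δ T κ r γ C Φ) (hD : wt D ≤ r)
    (hΨ : Has T D Φ Ψ) : ClsP δ T κ (r - wt D) (γ - cost D) C Ψ := by
  refine ⟨h.1.sub_of_has hD hΨ, fun m hm => ?_⟩
  have := wt_pos D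
  obtain ⟨r', rfl⟩ : ∃ r', r = r' + 1 := ⟨r - 1, by omega⟩
  obtain ⟨⟨A, a1, a2⟩, ⟨B, b1, b2⟩⟩ := h.2 r' rfl
  obtain ⟨dA, c1, c2⟩ := a2.exd
  obtain ⟨dB, e1, e2⟩ := b2.exd
  have hD' : wt D ≤ r' := by omega
  have hm' : r' - wt D = m := by omega
  have c2 := c2 D hD'
  have e2 := e2 D hD'
  rw [hm'] at c2 e2
  rw [sub_right_comm] at c2 e2
  exact ⟨⟨_, a1.comm hΨ (c1 D hD') c2.base.cont, c2⟩, ⟨_, b1.comm hΨ (e1 D hD') e2.base.cont, e2⟩⟩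

lemma ClsP.tsum {r : ℕ} {u : ℕ → ℝ} {I : ℕ → Ker S d} (hu : Summable u)
    (h : ∀ k, ClsP δ T κ r γ (u k) (I k)) :
    ClsP δ T κ r γ (∑' k, u k) (fun s b x => ∑' k, I k s b x) ∧
    ∀ s b, ∀ x ∈ UU d T, Summable fun k => I k s b x := by
  have hw : Integrable u Measure.count := by
    rw [integrable_count_iff]; exact hu.norm
  have hm : ∀ s b, ∀ x ∈ UU d T, AEStronglyMeasurable (fun y => I y s b x) Measure.count :=
    fun s b x hx => (measurable_from_nat).aestronglyMeasurable
  have hb : ∀ᵐ y ∂(Measure.count : Measure ℕ), Base δ T κ γ (1 * u y) (I y) :=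
    Eventually.of_forall fun y => by simpa using (h y).1.base
  have hi := Base.integrable hw hb hm
  have e : ∀ s b, ∀ x ∈ UU d T, ∫ y, I y s b x ∂Measure.count = ∑' k, I k s b x :=
    fun s b x hx => by rw [integral_countable (hi s b x hx)]; simp [Measure.real]
  have eu : ∫ y, u y ∂Measure.count = ∑' k, u k := by
    rw [integral_countable hw]; simp [Measure.real]
  refine ⟨⟨?_, fun m hm' => ⟨?_, ?_⟩⟩, fun s b x hx => (integrable_count_iff.1 (hi s b x hx)).of_norm⟩
  · have := Cls.integral (δ := δ) (T := T) (κ := κ) (C := 1) hw r (γ := γ) (I := I)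
      (Eventually.of_forall fun y => by simpa using (h y).1) hm
    rw [one_mul, eu] at this
    exact this.congr e
  · obtain ⟨J, j1, j2⟩ := int_has (m := m) (γ' := γ - 1 / 2) (D := Sum.inl 0) hw hb
      (Eventually.of_forall fun y => by simpa using ((h y).2 m hm').1) hm
    rw [one_mul, eu] at j2
    exact ⟨J, j1.congr e fun _ _ _ _ => rfl, j2⟩
  · obtain ⟨J, j1, j2⟩ := int_has (m := m) (γ' := γ - 1) (D := Sum.inr 0) hw hb
      (Eventually.of_forall fun y => by simpa using ((h y).2 m hm').2) hm
    rw [one_mul, eu] at j2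
    exact ⟨J, j1.congr e fun _ _ _ _ => rfl, j2⟩

lemma Dat.VV_cls' {lam M : ℝ} {r : ℕ} {A : S → Bool → Coeffs d} (hlam : 0 < lam) (hT : 1 ≤ T)
    (h : Dat δ lam (r + 2) M A) (hκ0 : 0 < κ) (hκ : κ < lam / 4) :
    ∃ u : ℕ → ℝ, Summable u ∧ (∀ k, 0 ≤ u k) ∧
      ∀ k : ℕ, ClsP δ T κ r ((r : ℝ) / 2 + 2) (u k) (VV A (d + r + 4 + k)) := by
  obtain ⟨u, u1, u2⟩ := h.VV_cls hlam hT hκ0 hκ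
  have hTp : 0 ≤ T := by linarith
  have hs := (summable_nat_add_iff (d + r + 4)).2 (u1 T hTp)
  have hu : ∀ k, 0 ≤ u k := fun k => (u2 k).1.nn
  refine ⟨_, hs, fun k => mul_nonneg (hu _) (pow_nonneg hTp _), fun k => ?_⟩
  have := u2 (d + r + 4 + k)
  rw [show d + r + 4 + k = k + (d + r + 4) by ring] at *
  refine this.mono hT ?_ (mul_le_mul_of_nonneg_left ?_ (hu _))
  · push_cast
    have : (0 : ℝ) ≤ k := by positivity
    linarith
  · rw [← Real.rpow_natCast]
    apply Real.rpow_le_rpow_of_exponent_le hT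
    push_cast
    have : (0 : ℝ) ≤ k := by positivity
    have : (0 : ℝ) ≤ r := by positivity
    have : (0 : ℝ) ≤ d := by positivity
    linarith

end VarBPHZ

open MeasureTheory Filter
open scoped BigOperators ENNReal

namespace VarBPHZ

set_option linter.unusedVariables false
set_option linter.unusedSimpArgs false
set_option linter.unusedSectionVars false

set_option linter.unnecessarySeqFocus false

variable {d : ℕ}
variable {S : Type*} {δ : S → NNReal} {T κ κ' κ₁ κ₂ γ γ' γ₁ γ₂ C C' C₁ C₂ : ℝ} {n n' : ℕ}
  {Φ Φ' Ψ Ψ' : Ker S d}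

/-! ## Differentiability from continuous line derivatives -/

noncomputable def co : Dir d → (XX d →L[ℝ] ℝ)
  | Sum.inl i => (ContinuousLinearMap.proj i).comp (ContinuousLinearMap.fst ℝ (Pt d) (Pt d))
  | Sum.inr i => (ContinuousLinearMap.proj i).comp (ContinuousLinearMap.snd ℝ (Pt d) (Pt d))

@[simp] lemma co_inl (i : Fin (d + 1)) (h : XX d) : co (Sum.inl i) h = h.1 i := rfl

@[simp] lemma co_inr (i : Fin (d + 1)) (h : XX d) : co (Sum.inr i) h = h.2 i := rfl

lemma co_le (D : Dir d) (h : XX d) : |co D h| ≤ ‖h‖ := by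
  cases D with
  | inl i => exact (norm_le_pi_norm h.1 i).trans (norm_fst_le h)
  | inr i => exact (norm_le_pi_norm h.2 i).trans (norm_snd_le h)

lemma co_ee (D D' : Dir d) : co D (ee D') = if D = D' then 1 else 0 := by
  cases D <;> cases D' <;> simp [ee, Pi.single_apply]

lemma co_sum (h : XX d) : ∑ D : Dir d, co D h • ee D = h := by
  rw [Fintype.sum_sum_type]
  refine Prod.ext ?_ ?_
  · simp [ee, Prod.fst_sum]
    ext j
    simp [Finset.sum_apply, Pi.single_apply]
  · simp [ee, Prod.snd_sum]
    ext j
    simp [Finset.sum_apply, Pi.single_apply]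

lemma line_sum {U : Set (XX d)} (hU : IsOpen U) {f : XX d → ℝ} {g : Dir d → XX d → ℝ}
    (hg : ∀ D, ∀ x ∈ U, HasLineDerivAt ℝ f (g D x) x (ee D)) (hc : ∀ D, ContinuousOn (g D) U)
    (c : Dir d → ℝ) (s : Finset (Dir d)) :
    ∀ x ∈ U, HasLineDerivAt ℝ f (∑ D ∈ s, c D * g D x) x (∑ D ∈ s, c D • ee D) := by
  classical
  induction s using Finset.induction_on with
  | empty =>
    intro x hx
    simpa [HasLineDerivAt] using hasDerivAt_const (0 : ℝ) (f x)
  | insert D s hD ih =>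
    intro x hx
    rw [Finset.sum_insert hD, Finset.sum_insert hD, add_comm (c D * g D x), add_comm (c D • ee D)]
    exact line_add (B := fun x => c D * g D x) hU ih (fun y hy => line_smul (hg D y hy))
      (continuousOn_const.mul (hc D)) x hx

lemma frechet {U : Set (XX d)} (hU : IsOpen U) {f : XX d → ℝ} {g : Dir d → XX d → ℝ}
    (hg : ∀ D, ∀ x ∈ U, HasLineDerivAt ℝ f (g D x) x (ee D)) (hc : ∀ D, ContinuousOn (g D) U)
    {x : XX d} (hx : x ∈ U) : HasFDerivAt f (∑ D, g D x • co D) x := by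
  rw [hasFDerivAt_iff_isLittleO_nhds_zero, Asymptotics.isLittleO_iff]
  intro ε hε
  set N : ℝ := (Fintype.card (Dir d) : ℝ) + 1 with hN
  have hNp : 0 < N := by positivity
  have h1 : ∀ᶠ y in nhds x, y ∈ U ∧ ∀ D, |g D y - g D x| ≤ ε / N := by
    refine Filter.Eventually.and (hU.mem_nhds hx) (eventually_all.2 fun D => ?_)
    have := ((hc D).continuousAt (hU.mem_nhds hx))
    have := Metric.continuousAt_iff'.1 this (ε / N) (by positivity)
    filter_upwards [this] with y hy
    rw [Real.dist_eq] at hy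
    exact hy.le
  obtain ⟨η, hη, hb⟩ := Metric.eventually_nhds_iff.1 h1
  filter_upwards [Metric.ball_mem_nhds (0 : XX d) hη] with h hh
  rw [mem_ball_zero_iff] at hh
  have hseg : ∀ τ ∈ Set.uIcc (0 : ℝ) 1, x + τ • h ∈ U ∧
      ∀ D, |g D (x + τ • h) - g D x| ≤ ε / N := by
    intro τ hτ
    apply hb
    rw [dist_eq_norm, add_sub_cancel_left, norm_smul]
    have : |τ| ≤ 1 := by simpa using abs_le_of_uIcc hτ
    calc ‖τ‖ * ‖h‖ ≤ 1 * ‖h‖ := mul_le_mul_of_nonneg_right this (norm_nonneg _)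
      _ < η := by linarith
  have key := mvt_line' (f := f) (f' := fun y => ∑ D, co D h * g D y) (x := x) (e := h) (t := 1)
    (M := ε * ‖h‖) (c := ∑ D, co D h * g D x) (fun τ hτ => by
      have := line_sum hU hg hc (fun D => co D h) Finset.univ _ (hseg τ hτ).1
      rwa [co_sum] at this) (fun τ hτ => by
      rw [← Finset.sum_sub_distrib]
      calc |∑ D, (co D h * g D (x + τ • h) - co D h * g D x)|
          ≤ ∑ D : Dir d, |co D h * g D (x + τ • h) - co D h * g D x| :=
            Finset.abs_sum_le_sum_abs _ _
        _ ≤ ∑ D : Dir d, ‖h‖ * (ε / N) := by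
            refine Finset.sum_le_sum fun D _ => ?_
            rw [← mul_sub, abs_mul]
            exact mul_le_mul (co_le D h) ((hseg τ hτ).2 D) (abs_nonneg _) (norm_nonneg _)
        _ = (Fintype.card (Dir d) : ℝ) / N * (ε * ‖h‖) := by
            rw [Finset.sum_const, Finset.card_univ, nsmul_eq_mul]; ring
        _ ≤ 1 * (ε * ‖h‖) := by
            refine mul_le_mul_of_nonneg_right ?_ (by positivity)
            rw [div_le_one hNp]; linarith
        _ = ε * ‖h‖ := one_mul _)
  simp only [one_smul, abs_one, mul_one, one_mul] at key
  rw [Real.norm_eq_abs]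
  convert key using 3
  simp [mul_comm]

/-! ## From kernels in `(p, v)` to two-point kernels -/

noncomputable def ex (Φ : Ker S d) : Ker S d := fun s b x =>
  if x.2 0 < x.1 0 then Φ s b (x.2, x.1 - x.2) else 0

def OO (d : ℕ) (T : ℝ) : Set (XX d) := {x | |x.1 0 - x.2 0| < T}

lemma isOpen_OO (T : ℝ) : IsOpen (OO d T) := by
  have h : Continuous fun x : XX d => |x.1 0 - x.2 0| := by fun_prop
  exact isOpen_lt h continuous_const

lemma gau_le_one (hκ : 0 ≤ κ) {v : Pt d} (hv : 0 < v 0) : gau κ v ≤ 1 := by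
  unfold gau
  rw [Real.exp_le_one_iff]
  have : 0 ≤ sq v / v 0 := div_nonneg (sq_nonneg' v) hv.le
  have := mul_nonneg hκ this
  linarith

lemma Base.ex_bd (hT : 1 ≤ T) (hκ : 0 ≤ κ) (h : Base δ T κ ((n : ℝ) / 2 + 2) C Φ) (s : S)
    {x : XX d} (hx : x ∈ OO d T) :
    Bd (δ s) (C * T ^ n * (x.1 0 - x.2 0) ^ 2) (fun b => ex Φ s b x) := by
  have hC := h.nn
  have hTp : 0 ≤ T := by linarith
  by_cases hu : x.2 0 < x.1 0
  · have hm : ((x.2, x.1 - x.2) : XX d) ∈ UU d T := by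
      refine ⟨by simpa using hu, ?_⟩
      have := (abs_lt.1 (show |x.1 0 - x.2 0| < T from hx)).2
      simpa using this
    have := h.bd s _ hm
    simp only [ex, hu, if_true]
    refine this.mono (δ s).2 ?_
    simp only [Pi.sub_apply]
    have hup : 0 < x.1 0 - x.2 0 := by linarith
    have hle : x.1 0 - x.2 0 ≤ T := (abs_lt.1 (show |x.1 0 - x.2 0| < T from hx)).2.le
    have g1 : gau κ (x.1 - x.2) ≤ 1 := gau_le_one hκ (by simpa using hu)
    have g0 := (gau_pos κ (x.1 - x.2)).le
    have e : (x.1 0 - x.2 0) ^ ((n : ℝ) / 2 + 2) ≤ T ^ n * (x.1 0 - x.2 0) ^ 2 := by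
      rw [Real.rpow_add hup, Real.rpow_two]
      refine mul_le_mul_of_nonneg_right ?_ (by positivity)
      calc (x.1 0 - x.2 0) ^ ((n : ℝ) / 2) ≤ T ^ ((n : ℝ) / 2) :=
            Real.rpow_le_rpow hup.le hle (by positivity)
        _ ≤ T ^ (n : ℝ) := Real.rpow_le_rpow_of_exponent_le hT (by
            have : (0 : ℝ) ≤ n := by positivity
            linarith)
        _ = T ^ n := Real.rpow_natCast _ _
    have e0 : 0 ≤ (x.1 0 - x.2 0) ^ ((n : ℝ) / 2 + 2) := Real.rpow_nonneg hup.le _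
    calc C * (x.1 0 - x.2 0) ^ ((n : ℝ) / 2 + 2) * gau κ (x.1 - x.2)
        ≤ C * (x.1 0 - x.2 0) ^ ((n : ℝ) / 2 + 2) * 1 :=
          mul_le_mul_of_nonneg_left g1 (by positivity)
      _ = C * (x.1 0 - x.2 0) ^ ((n : ℝ) / 2 + 2) := mul_one _
      _ ≤ C * (T ^ n * (x.1 0 - x.2 0) ^ 2) := mul_le_mul_of_nonneg_left e hC
      _ = _ := by ring
  · simp only [ex, hu, if_false]
    have hM : 0 ≤ C * T ^ n * (x.1 0 - x.2 0) ^ 2 := by positivity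
    refine ⟨fun b => by simpa using hM, ?_⟩
    have := mul_nonneg (δ s).2 hM
    simpa using this

lemma Base.ex_bd' (hT : 1 ≤ T) (hκ : 0 ≤ κ) (h : Base δ T κ ((n : ℝ) / 2 + 2) C Φ) (s : S)
    {x : XX d} (hx : x ∈ OO d T) : Bd (δ s) (C * T ^ (n + 2)) (fun b => ex Φ s b x) := by
  refine (h.ex_bd hT hκ s hx).mono (δ s).2 ?_
  rw [pow_add, ← mul_assoc]
  have hTp : 0 ≤ T := by linarith
  refine mul_le_mul_of_nonneg_left ?_ (mul_nonneg h.nn (pow_nonneg hTp _))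
  exact sq_le_sq' (by linarith [(abs_lt.1 (show |x.1 0 - x.2 0| < T from hx)).1])
    (abs_lt.1 (show |x.1 0 - x.2 0| < T from hx)).2.le

lemma ex_eventually_pos {x : XX d} (hu : x.2 0 < x.1 0) (s : S) (b : Bool) :
    ex Φ s b =ᶠ[nhds x] fun y => Φ s b (y.2, y.1 - y.2) := by
  have : IsOpen {y : XX d | y.2 0 < y.1 0} := isOpen_lt (by fun_prop) (by fun_prop)
  filter_upwards [this.mem_nhds hu] with y hy
  have hy : y.2 0 < y.1 0 := hy
  simp [ex, hy]

lemma ex_eventually_neg {x : XX d} (hu : x.1 0 < x.2 0) (s : S) (b : Bool) :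
    ex Φ s b =ᶠ[nhds x] fun y => 0 := by
  have : IsOpen {y : XX d | y.1 0 < y.2 0} := isOpen_lt (by fun_prop) (by fun_prop)
  filter_upwards [this.mem_nhds hu] with y hy
  have hy : y.1 0 < y.2 0 := hy
  simp [ex, hy.le, not_lt.2 hy.le]

lemma mem_UU_of {x : XX d} (hu : x.2 0 < x.1 0) (hx : x ∈ OO d T) :
    ((x.2, x.1 - x.2) : XX d) ∈ UU d T := by
  refine ⟨by simpa using hu, ?_⟩
  have := (abs_lt.1 (show |x.1 0 - x.2 0| < T from hx)).2
  simpa using this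

lemma Base.ex_zero_diff (hT : 1 ≤ T) (hκ : 0 ≤ κ) (h : Base δ T κ ((n : ℝ) / 2 + 2) C Φ) (s : S)
    (b : Bool) {x : XX d} (hx : x ∈ OO d T) (hu : x.1 0 = x.2 0) :
    HasFDerivAt (ex Φ s b) (0 : XX d →L[ℝ] ℝ) x := by
  have hC := h.nn
  have hTp : 0 ≤ T := by linarith
  have h0 : ex Φ s b x = 0 := by simp [ex, hu]
  rw [hasFDerivAt_iff_isLittleO, h0]
  have h1 : (fun y => ex Φ s b y - 0 - (0 : XX d →L[ℝ] ℝ) (y - x)) =O[nhds x]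
      fun y => ‖y - x‖ ^ 2 := by
    refine Asymptotics.IsBigO.of_bound (C * T ^ n * 4) ?_
    filter_upwards [(isOpen_OO T).mem_nhds hx] with y hy
    have hb := (h.ex_bd hT hκ s hy).1 b
    simp only [sub_zero, zero_apply]
    rw [Real.norm_eq_abs, Real.norm_eq_abs, abs_of_nonneg (by positivity : 0 ≤ ‖y - x‖ ^ 2),
      mul_assoc]
    refine hb.trans (mul_le_mul_of_nonneg_left ?_ (by positivity))
    have e1 := co_le (Sum.inl 0) (y - x)
    have e2 := co_le (Sum.inr 0) (y - x)
    simp only [co_inl, co_inr, Prod.fst_sub, Prod.snd_sub, Pi.sub_apply] at e1 e2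
    have e3 : |y.1 0 - y.2 0| ≤ 2 * ‖y - x‖ := by
      have : y.1 0 - y.2 0 = (y.1 0 - x.1 0) - (y.2 0 - x.2 0) := by rw [hu]; ring
      rw [this]
      exact (abs_sub _ _).trans (by linarith)
    calc (y.1 0 - y.2 0) ^ 2 = |y.1 0 - y.2 0| ^ 2 := (sq_abs _).symm
      _ ≤ (2 * ‖y - x‖) ^ 2 := pow_le_pow_left₀ (abs_nonneg _) e3 2
      _ = _ := by ring
  refine h1.trans_isLittleO ?_
  have h2 : (fun y : XX d => ‖y - x‖ ^ 2) =o[nhds x] fun y => ‖y - x‖ ^ 1 := by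
    have := Asymptotics.isLittleO_pow_pow (𝕜 := ℝ) (show 1 < 2 by norm_num)
    have ht : Tendsto (fun y : XX d => ‖y - x‖) (nhds x) (nhds 0) := by
      have : Continuous fun y : XX d => ‖y - x‖ := by fun_prop
      simpa using this.tendsto x
    exact this.comp_tendsto ht
  simp only [pow_one] at h2
  exact h2.norm_right.trans_le (fun y => by simp) 

lemma Base.ex_cont (hT : 1 ≤ T) (hκ : 0 ≤ κ) (h : Base δ T κ ((n : ℝ) / 2 + 2) C Φ) (s : S)
    (b : Bool) {x : XX d} (hx : x ∈ OO d T) : ContinuousAt (ex Φ s b) x := by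
  rcases lt_trichotomy (x.2 0) (x.1 0) with hu | hu | hu
  · rw [continuousAt_congr (ex_eventually_pos hu s b)]
    have h1 := (h.cont s b).continuousAt ((isOpen_UU T).mem_nhds (mem_UU_of hu hx))
    exact ContinuousAt.comp (f := fun y : XX d => ((y.2, y.1 - y.2) : XX d)) h1
      (by fun_prop)
  · exact (h.ex_zero_diff hT hκ s b hx hu.symm).continuousAt
  · rw [continuousAt_congr (ex_eventually_neg hu s b)]
    exact continuousAt_const

end VarBPHZ

open MeasureTheory Filter
open scoped BigOperators ENNReal

namespace VarBPHZ

set_option linter.unusedVariables false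
set_option linter.unusedSimpArgs false
set_option linter.unusedSectionVars false

set_option linter.unnecessarySeqFocus false

variable {d : ℕ}
variable {S : Type*} {δ : S → NNReal} {T κ κ' κ₁ κ₂ γ γ' γ₁ γ₂ C C' C₁ C₂ : ℝ} {n n' : ℕ}
  {Φ Φ' Ψ Ψ' : Ker S d}

lemma ClsP.all_dirs (h : ClsP δ T κ n γ C Φ) (hn : 1 ≤ n) :
    ∃ G : Dir d → Ker S d, (∀ D, Has T D Φ (G D)) ∧ (∀ D s b, ContinuousOn (G D s b) (UU d T)) := by
  obtain ⟨m, rfl⟩ : ∃ m, n = m + 1 := ⟨n - 1, by omega⟩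
  obtain ⟨⟨A, a1, a2⟩, ⟨B, b1, b2⟩⟩ := h.2 m rfl
  obtain ⟨dΦ, c1, c2⟩ := h.1.exd
  have : ∀ D : Dir d, ∃ G, Has T D Φ G ∧ ∀ s b, ContinuousOn (G s b) (UU d T) := by
    intro D
    cases D with
    | inl i =>
      refine Fin.cases ⟨A, a1, a2.base.cont⟩ (fun i => ?_) i
      have hw : wt (Sum.inl i.succ : Dir d) ≤ m + 1 := by simp
      exact ⟨_, c1 _ hw, (c2 _ hw).base.cont⟩
    | inr i =>
      refine Fin.cases ⟨B, b1, b2.base.cont⟩ (fun i => ?_) i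
      have hw : wt (Sum.inr i.succ : Dir d) ≤ m + 1 := by simp
      exact ⟨_, c1 _ hw, (c2 _ hw).base.cont⟩
  choose G hG using this
  exact ⟨G, fun D => (hG D).1, fun D => (hG D).2⟩

noncomputable def Dex (G : Dir d → Ker S d) : Dir d → Ker S d
  | Sum.inl i => G (Sum.inr i)
  | Sum.inr i => G (Sum.inl i) + -G (Sum.inr i)

lemma ClsP.ex_deriv (hT : 1 ≤ T) (hκ : 0 ≤ κ) (h : ClsP δ T κ n ((n : ℝ) / 2 + 2) C Φ)
    (hn : 1 ≤ n) : ∃ G : Dir d → Ker S d,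
      (∀ s b, ∀ x ∈ OO d T, DifferentiableAt ℝ (ex Φ s b) x ∧
        ∀ D, fderiv ℝ (ex Φ s b) x (ee D) = ex (G D) s b x) ∧
      ∀ D, wt D ≤ n → ClsP δ T κ (n - wt D) (((n - wt D : ℕ) : ℝ) / 2 + 2) (2 * T * C) (G D) := by
  obtain ⟨G, g1, g2⟩ := h.all_dirs hn
  have hC := h.1.nn
  refine ⟨Dex G, fun s b x hx => ?_, fun D hD => ?_⟩
  · rcases lt_trichotomy (x.2 0) (x.1 0) with hu | hu | hu
    · set P : XX d →L[ℝ] XX d := (ContinuousLinearMap.snd ℝ (Pt d) (Pt d)).prod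
        (ContinuousLinearMap.fst ℝ (Pt d) (Pt d) - ContinuousLinearMap.snd ℝ (Pt d) (Pt d)) with hP
      have hPx : ∀ y : XX d, P y = (y.2, y.1 - y.2) := fun y => rfl
      have h1 := frechet (isOpen_UU T) (f := Φ s b) (g := fun D => G D s b) (fun D => g1 D s b)
        (fun D => g2 D s b) (mem_UU_of hu hx)
      have h2 : HasFDerivAt (fun y : XX d => Φ s b (y.2, y.1 - y.2))
          ((∑ D, G D s b (x.2, x.1 - x.2) • co D).comp P) x := by
        have h1' := h1
        rw [← hPx x] at h1'
        exact h1'.comp x P.hasFDerivAt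
      have h3 := h2.congr_of_eventuallyEq (ex_eventually_pos hu s b)
      refine ⟨h3.differentiableAt, fun D => ?_⟩
      rw [h3.fderiv]
      have hL : ∀ D', (∑ D, G D s b (x.2, x.1 - x.2) • co D) (ee D') =
          G D' s b (x.2, x.1 - x.2) := by
        intro D'
        cases D' <;> simp [co_ee]
      rw [ContinuousLinearMap.comp_apply]
      cases D with
      | inl i =>
        have : P (ee (Sum.inl i)) = ee (Sum.inr i) := by rw [hPx]; simp [ee]
        rw [this, hL]
        simp [ex, hu, Dex]
      | inr i =>
        have : P (ee (Sum.inr i)) = ee (Sum.inl i) + -ee (Sum.inr i) := by rw [hPx]; simp [ee]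
        rw [this, map_add, map_neg, hL, hL]
        simp [ex, hu, Dex]
    · have h1 := h.1.base.ex_zero_diff hT hκ s b hx hu.symm
      refine ⟨h1.differentiableAt, fun D => ?_⟩
      rw [h1.fderiv]
      simp [ex, hu]
    · have h1 := (hasFDerivAt_const (𝕜 := ℝ) (0 : ℝ) x).congr_of_eventuallyEq (ex_eventually_neg (Φ := Φ) hu s b)
      refine ⟨h1.differentiableAt, fun D => ?_⟩
      rw [h1.fderiv]
      simp [ex, not_lt.2 hu.le]
  · have hw1 := wt_pos D
    have hcast : ((n - wt D : ℕ) : ℝ) = (n : ℝ) - wt D := by push_cast [hD]; ring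
    have hTC : C ≤ T * C := le_mul_of_one_le_left hC hT
    cases D with
    | inl i =>
      have hD' : wt (Sum.inr i : Dir d) ≤ n := hD
      refine (h.deriv hD' (g1 (Sum.inr i))).mono hT (le_of_eq ?_) ?_
      · rw [hcast]; simp; ring
      · have : (n : ℝ) / 2 + 2 - cost (Sum.inr i : Dir d) -
            (((n - wt (Sum.inl i : Dir d) : ℕ) : ℝ) / 2 + 2) = 0 := by rw [hcast]; simp; ring
        rw [this, Real.rpow_zero]; linarith
    | inr i =>
      have hD' : wt (Sum.inl i : Dir d) ≤ n := hD
      have e1 := (h.deriv hD (g1 (Sum.inr i))).mono (γ' := ((n - wt (Sum.inr i : Dir d) : ℕ) : ℝ) / 2 + 2)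
        (C' := T * C) hT (le_of_eq (by rw [hcast]; simp; ring)) (by
          have : (n : ℝ) / 2 + 2 - cost (Sum.inr i : Dir d) -
            (((n - wt (Sum.inr i : Dir d) : ℕ) : ℝ) / 2 + 2) = 0 := by rw [hcast]; simp; ring
          rw [this, Real.rpow_zero]; linarith)
      have hwi : (0 : ℝ) ≤ wi i := by positivity
      have e2 := (h.deriv hD' (g1 (Sum.inl i))).mono (γ' := ((n - wt (Sum.inr i : Dir d) : ℕ) : ℝ) / 2 + 2)
        (C' := T * C) hT (by rw [hcast]; simp; linarith) (by
          have : (n : ℝ) / 2 + 2 - cost (Sum.inl i : Dir d) -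
            (((n - wt (Sum.inr i : Dir d) : ℕ) : ℝ) / 2 + 2) = (wi i : ℝ) / 2 := by
            rw [hcast]; simp; ring
          rw [this, mul_comm T]
          refine mul_le_mul_of_nonneg_left ?_ hC
          have : (wi i : ℝ) ≤ 2 := by exact_mod_cast wi_le i
          calc T ^ ((wi i : ℝ) / 2) ≤ T ^ (1 : ℝ) :=
                Real.rpow_le_rpow_of_exponent_le hT (by linarith)
            _ = T := Real.rpow_one _)
      have e3 := e2.add e1.neg
      rw [show 2 * T * C = T * C + T * C by ring]
      exact e3

/-! ## Mixed derivatives -/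

/-- Uncurried mixed derivative. -/
noncomputable def md (j m : Fin (d + 1) → ℕ) (F : Pt d → Pt d → ℝ) : XX d → ℝ :=
  fun x => mderiv2 j m F x.1 x.2

lemma md_zero (F : Pt d → Pt d → ℝ) : md 0 0 F = fun x => F x.1 x.2 := by
  funext x; simp only [md, mderiv2, mderiv_zero]

lemma md_step1 {j m : Fin (d + 1) → ℕ} {i : Fin (d + 1)} (hj : ∀ l < i, j l = 0)
    {F : Pt d → Pt d → ℝ} {x : XX d} (h : DifferentiableAt ℝ (md j m F) x) :
    md (j + Pi.single i 1) m F x = fderiv ℝ (md j m F) x (ee (Sum.inl i)) := by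
  have e : md (j + Pi.single i 1) m F x = fderiv ℝ (fun z => md j m F (z, x.2)) x.1 (Pi.single i 1) := by
    simp only [md, mderiv2]
    rw [mderiv_succ j i hj]
    rfl
  have h1 : HasFDerivAt (fun z : Pt d => ((z, x.2) : XX d))
      (ContinuousLinearMap.inl ℝ (Pt d) (Pt d)) x.1 := hasFDerivAt_prodMk_left _ _
  have h2 := HasFDerivAt.comp (g := md j m F) x.1 (show HasFDerivAt (md j m F) (fderiv ℝ (md j m F) x) ((fun z : Pt d => ((z, x.2) : XX d)) x.1) from h.hasFDerivAt) h1
  rw [e]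
  have h3 : HasFDerivAt (fun z => md j m F (z, x.2)) _ x.1 := h2
  rw [h3.fderiv]
  simp [ee]

lemma md_step2 {m : Fin (d + 1) → ℕ} {i : Fin (d + 1)} (hm : ∀ l < i, m l = 0)
    {F : Pt d → Pt d → ℝ} {x : XX d} (h : DifferentiableAt ℝ (md 0 m F) x) :
    md 0 (m + Pi.single i 1) F x = fderiv ℝ (md 0 m F) x (ee (Sum.inr i)) := by
  have e : md 0 (m + Pi.single i 1) F x =
      fderiv ℝ (fun z => md 0 m F (x.1, z)) x.2 (Pi.single i 1) := by
    simp only [md, mderiv2, mderiv_zero]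
    rw [mderiv_succ m i hm]
    rfl
  have h1 : HasFDerivAt (fun z : Pt d => ((x.1, z) : XX d))
      (ContinuousLinearMap.inr ℝ (Pt d) (Pt d)) x.2 := hasFDerivAt_prodMk_right _ _
  have h2 := HasFDerivAt.comp (g := md 0 m F) x.2 (show HasFDerivAt (md 0 m F) (fderiv ℝ (md 0 m F) x) ((fun z : Pt d => ((x.1, z) : XX d)) x.2) from h.hasFDerivAt) h1
  rw [e]
  have h3 : HasFDerivAt (fun z => md 0 m F (x.1, z)) _ x.2 := h2
  rw [h3.fderiv]
  simp [ee]

/-- Induction on pairs of multi-indices. -/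
lemma pair_ind {P : (Fin (d + 1) → ℕ) → (Fin (d + 1) → ℕ) → Prop} (h0 : P 0 0)
    (h2 : ∀ m i, (∀ l < i, m l = 0) → P 0 m → P 0 (m + Pi.single i 1))
    (h1 : ∀ j m i, (∀ l < i, j l = 0) → P j m → P (j + Pi.single i 1) m) : ∀ j m, P j m := by
  intro j m
  have a : ∀ m, P 0 m := fun m => canon_ind (P := fun m => P 0 m) h0 h2 m
  exact canon_ind (P := fun j => P j m) (a m) (fun k i hk hP => h1 k m i hk hP) j

lemma pdeg_zero : pdeg (0 : Fin (d + 1) → ℕ) = 0 := by simp [pdeg]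

lemma md_sub {r : ℕ} {F G : Pt d → Pt d → ℝ}
    (hF : ∀ j m, pdeg j + pdeg m < r → Differentiable ℝ (md j m F))
    (hG : ∀ j m, pdeg j + pdeg m < r → Differentiable ℝ (md j m G)) :
    ∀ j m, pdeg j + pdeg m ≤ r →
      md j m (fun z zb => F z zb - G z zb) = fun x => md j m F x - md j m G x := by
  intro j m
  refine pair_ind (P := fun j m => pdeg j + pdeg m ≤ r →
      md j m (fun z zb => F z zb - G z zb) = fun x => md j m F x - md j m G x) ?_ ?_ ?_ j m
  · intro _; simp only [md_zero]
  · intro m i hm ih hr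
    rw [pdeg_add, pdeg_zero] at hr
    have := wi_pos i
    have ih := ih (by rw [pdeg_zero]; omega)
    have d1 := hF 0 m (by rw [pdeg_zero]; omega)
    have d2 := hG 0 m (by rw [pdeg_zero]; omega)
    funext x
    have d3 : DifferentiableAt ℝ (md 0 m (fun z zb => F z zb - G z zb)) x := by
      rw [ih]; exact (d1 x).sub (d2 x)
    rw [md_step2 hm d3, md_step2 hm (d1 x), md_step2 hm (d2 x), ih]
    rw [fderiv_fun_sub (d1 x) (d2 x)]
    rfl
  · intro j m i hj ih hr
    rw [pdeg_add] at hr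
    have := wi_pos i
    have ih := ih (by omega)
    have d1 := hF j m (by omega)
    have d2 := hG j m (by omega)
    funext x
    have d3 : DifferentiableAt ℝ (md j m (fun z zb => F z zb - G z zb)) x := by
      rw [ih]; exact (d1 x).sub (d2 x)
    rw [md_step1 hj d3, md_step1 hj (d1 x), md_step1 hj (d2 x), ih]
    rw [fderiv_fun_sub (d1 x) (d2 x)]
    rfl

/-- Representation of the mixed derivatives of an extended kernel. -/
lemma ClsP.md_rep {r : ℕ} (hT : 1 ≤ T) (hκ : 0 ≤ κ) (h : ClsP δ T κ r ((r : ℝ) / 2 + 2) C Φ) :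
    ∀ j m, pdeg j + pdeg m ≤ r → ∃ Ψ : Ker S d,
      ClsP δ T κ (r - (pdeg j + pdeg m)) (((r - (pdeg j + pdeg m) : ℕ) : ℝ) / 2 + 2)
        ((2 * T) ^ (pdeg j + pdeg m) * C) Ψ ∧
      ∀ s b, ∀ x ∈ OO d T, md j m (fun z zb => ex Φ s b (z, zb)) x = ex Ψ s b x := by
  have hC := h.1.nn
  have hT2 : 1 ≤ 2 * T := by linarith
  have step : ∀ (q w : ℕ) (D : Dir d), wt D = w → q + w ≤ r → ∀ Ψ : Ker S d,
      ClsP δ T κ (r - q) (((r - q : ℕ) : ℝ) / 2 + 2) ((2 * T) ^ q * C) Ψ →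
      ∃ Ψ' : Ker S d, ClsP δ T κ (r - (q + w)) (((r - (q + w) : ℕ) : ℝ) / 2 + 2)
        ((2 * T) ^ (q + w) * C) Ψ' ∧ ∀ s b, ∀ x ∈ OO d T, DifferentiableAt ℝ (ex Ψ s b) x ∧
          fderiv ℝ (ex Ψ s b) x (ee D) = ex Ψ' s b x := by
    intro q w D hw hq Ψ hΨ
    have := wt_pos D
    obtain ⟨G, g1, g2⟩ := hΨ.ex_deriv hT hκ (by omega)
    refine ⟨G D, ?_, fun s b x hx => ⟨(g1 s b x hx).1, (g1 s b x hx).2 D⟩⟩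
    have := g2 D (by omega)
    rw [show r - q - wt D = r - (q + w) by omega] at this
    refine this.mono hT le_rfl ?_
    rw [sub_self, Real.rpow_zero, mul_one, ← mul_assoc, ← pow_succ']
    exact mul_le_mul_of_nonneg_right (pow_le_pow_right₀ hT2 (by omega)) hC
  refine pair_ind ?_ ?_ ?_
  · intro _
    refine ⟨Φ, ?_, fun s b x hx => by rw [md_zero]⟩
    simpa [pdeg_zero] using h
  · intro m i hm ih hr
    rw [pdeg_add, ← add_assoc] at hr
    have := wi_pos i
    obtain ⟨Ψ, p1, p2⟩ := ih (by omega)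
    obtain ⟨Ψ', q1, q2⟩ := step (pdeg 0 + pdeg m) (wi i) (Sum.inr i) rfl hr Ψ p1
    rw [pdeg_add, ← add_assoc]
    refine ⟨Ψ', q1, fun s b x hx => ?_⟩
    have ev : md 0 m (fun z zb => ex Φ s b (z, zb)) =ᶠ[nhds x] ex Ψ s b := by
      filter_upwards [(isOpen_OO T).mem_nhds hx] with y hy using p2 s b y hy
    rw [md_step2 hm ((q2 s b x hx).1.congr_of_eventuallyEq ev), ev.fderiv_eq]
    exact (q2 s b x hx).2
  · intro j m i hm ih hr
    have ee1 : pdeg (j + Pi.single i 1) + pdeg m = pdeg j + pdeg m + wi i := by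
      rw [pdeg_add]; ring
    rw [ee1] at hr
    have := wi_pos i
    obtain ⟨Ψ, p1, p2⟩ := ih (by omega)
    obtain ⟨Ψ', q1, q2⟩ := step (pdeg j + pdeg m) (wi i) (Sum.inl i) rfl hr Ψ p1
    rw [ee1]
    refine ⟨Ψ', q1, fun s b x hx => ?_⟩
    have ev : md j m (fun z zb => ex Φ s b (z, zb)) =ᶠ[nhds x] ex Ψ s b := by
      filter_upwards [(isOpen_OO T).mem_nhds hx] with y hy using p2 s b y hy
    rw [md_step1 hm ((q2 s b x hx).1.congr_of_eventuallyEq ev), ev.fderiv_eq]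
    exact (q2 s b x hx).2

lemma ClsP.md_facts {r : ℕ} (hT : 1 ≤ T) (hκ : 0 ≤ κ) (h : ClsP δ T κ r ((r : ℝ) / 2 + 2) C Φ)
    {j m : Fin (d + 1) → ℕ} (hr : pdeg j + pdeg m ≤ r) {x : XX d} (hx : x ∈ OO d T) (s : S) :
    Bd (δ s) ((2 * T) ^ r * T ^ (r + 2) * C) (fun b => md j m (fun z zb => ex Φ s b (z, zb)) x) ∧
    ∀ b, ContinuousAt (md j m (fun z zb => ex Φ s b (z, zb))) x ∧
      (pdeg j + pdeg m < r → DifferentiableAt ℝ (md j m (fun z zb => ex Φ s b (z, zb))) x) := by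
  obtain ⟨Ψ, h1, h2⟩ := h.md_rep hT hκ j m hr
  have hC := h.1.nn
  refine ⟨?_, fun b => ?_⟩
  · have := h1.1.base.ex_bd' hT hκ s hx
    simp only [h2 s _ x hx]
    refine this.mono (δ s).2 ?_
    have a1 : (2 * T) ^ (pdeg j + pdeg m) ≤ (2 * T) ^ r := pow_le_pow_right₀ (by linarith) hr
    have a2 : T ^ (r - (pdeg j + pdeg m) + 2) ≤ T ^ (r + 2) := pow_le_pow_right₀ hT (by omega)
    calc (2 * T) ^ (pdeg j + pdeg m) * C * T ^ (r - (pdeg j + pdeg m) + 2)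
        = ((2 * T) ^ (pdeg j + pdeg m) * T ^ (r - (pdeg j + pdeg m) + 2)) * C := by ring
      _ ≤ _ := by
        refine mul_le_mul_of_nonneg_right (mul_le_mul a1 a2 ?_ ?_) hC <;> positivity
  · have ev : md j m (fun z zb => ex Φ s b (z, zb)) =ᶠ[nhds x] ex Ψ s b := by
      filter_upwards [(isOpen_OO T).mem_nhds hx] with y hy using h2 s b y hy
    refine ⟨(continuousAt_congr ev).2 (h1.1.base.ex_cont hT hκ s b hx), fun hlt => ?_⟩
    obtain ⟨G, g1, _⟩ := h1.ex_deriv hT hκ (by omega)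
    exact (g1 s b x hx).1.congr_of_eventuallyEq ev

end VarBPHZ

open MeasureTheory Filter
open scoped BigOperators ENNReal

namespace VarBPHZ

set_option linter.unusedVariables false
set_option linter.unusedSimpArgs false
set_option linter.unusedSectionVars false

set_option linter.unnecessarySeqFocus false

variable {d : ℕ}
variable {S : Type*} {δ : S → NNReal} {T κ κ' κ₁ κ₂ γ γ' γ₁ γ₂ C C' C₁ C₂ : ℝ} {n n' : ℕ}
  {Φ Φ' Ψ Ψ' : Ker S d}

/-! ## The Volterra series -/

/-- Remainders of the tail of the Volterra series. -/
noncomputable def tl (K n : ℕ) (A : Coeffs d) : Pt d → Pt d → ℝ :=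
  fun z zb => ∑' k, volterra A (K + n + k) z zb

lemma Dat.main {lam M : ℝ} {r : ℕ} {A : S → Bool → Coeffs d} (hlam : 0 < lam) (hT : 1 ≤ T)
    (h : Dat δ lam (r + 2) M A) :
    ∃ u : ℕ → ℝ, Summable u ∧ (∀ k, 0 ≤ u k) ∧
      (∀ k s b j m, pdeg j + pdeg m ≤ r → ∀ x ∈ OO d T,
        |md j m (volterra (A s b) (d + r + 4 + k)) x| ≤ u k) ∧
      ∀ n s j m, pdeg j + pdeg m ≤ r → ∀ x ∈ OO d T,
        Bd (δ s) (∑' k, u (k + n)) (fun b => md j m (tl (d + r + 4) n (A s b)) x) ∧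
        ∀ b, ContinuousAt (md j m (tl (d + r + 4) n (A s b))) x ∧
          (pdeg j + pdeg m < r → DifferentiableAt ℝ (md j m (tl (d + r + 4) n (A s b))) x) := by
  obtain ⟨u, u1, u2, u3⟩ := h.VV_cls' hlam hT (κ := lam / 8) (by positivity) (by linarith)
  have hκ : (0 : ℝ) ≤ lam / 8 := by positivity
  have hTp : 0 ≤ T := by linarith
  set c : ℝ := (2 * T) ^ r * T ^ (r + 2) with hc
  have hc0 : 0 ≤ c := by positivity
  have e1 : ∀ k s b, volterra (A s b) k = fun z zb => ex (VV A k) s b (z, zb) := by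
    intro k s b; funext z zb; exact h.volterra_eq hlam k s b z zb
  refine ⟨fun k => c * u k, u1.mul_left c, fun k => mul_nonneg hc0 (u2 k), ?_, ?_⟩
  · intro k s b j m hr x hx
    rw [e1]
    exact ((u3 k).md_facts hT hκ hr hx s).1.1 b
  · intro n s j m hr x hx
    have hs := (summable_nat_add_iff n).2 u1
    obtain ⟨t1, -⟩ := ClsP.tsum (I := fun k => VV A (d + r + 4 + (k + n))) hs fun k => u3 (k + n)
    have e2 : ∀ b, tl (d + r + 4) n (A s b) = fun z zb =>
        ex (fun s b x => ∑' k, VV A (d + r + 4 + (k + n)) s b x) s b (z, zb) := by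
      intro b
      funext z zb
      simp only [tl, e1, ex]
      have : ∀ k, d + r + 4 + n + k = d + r + 4 + (k + n) := fun k => by omega
      simp only [this]
      split_ifs <;> simp
    have := t1.md_facts hT hκ hr hx s
    simp only [e2]
    rw [tsum_mul_left]
    exact this

lemma coeffDist_self {lam : ℝ} {ρ : ℕ} {A : Coeffs d} (hA : ParReg lam ρ A) :
    coeffDist ρ A A ≤ 0 := by
  have key : ∀ f : Pt d → ℝ, MemCpar ρ f → cparNorm ρ (fun z => f z - f z) ≤ 0 := by
    intro f hf
    refine Real.sSup_nonpos ?_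
    rintro y ⟨k, z, hk, rfl⟩
    rw [mderiv_sub hf hf k hk]
    simp
  unfold coeffDist coeffNorm
  have h1 : sSup {y | ∃ i j, y = cparNorm ρ fun z => (coeffSub A A).a z i j} ≤ 0 := by
    refine Real.sSup_nonpos ?_
    rintro y ⟨i, j, rfl⟩
    exact key _ (hA.areg i j)
  have h2 : sSup {y | ∃ i, y = cparNorm ρ fun z => (coeffSub A A).b z i} ≤ 0 := by
    refine Real.sSup_nonpos ?_
    rintro y ⟨i, rfl⟩
    exact key _ (hA.breg i)
  have h3 : cparNorm ρ (coeffSub A A).c ≤ 0 := key _ hA.creg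
  linarith

lemma single_main {lam : ℝ} {r : ℕ} {A : Coeffs d} (hlam : 0 < lam) (hT : 1 ≤ T)
    (hA : ParReg lam (r + 2) A) :
    ∃ u : ℕ → ℝ, Summable u ∧ (∀ k, 0 ≤ u k) ∧
      (∀ k j m, pdeg j + pdeg m ≤ r → ∀ x ∈ OO d T,
        |md j m (volterra A (d + r + 4 + k)) x| ≤ u k) ∧
      ∀ n j m, pdeg j + pdeg m ≤ r → ∀ x ∈ OO d T,
        |md j m (tl (d + r + 4) n A) x| ≤ ∑' k, u (k + n) ∧
        ContinuousAt (md j m (tl (d + r + 4) n A)) x ∧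
          (pdeg j + pdeg m < r → DifferentiableAt ℝ (md j m (tl (d + r + 4) n A)) x) := by
  obtain ⟨M, hM⟩ := mkDat (S := Unit) hA (fun _ => A) (fun _ => hA)
    (fun _ => (coeffDist_self hA).trans zero_le_one)
  obtain ⟨u, u1, u2, u3, u4⟩ := hM.main hlam hT
  refine ⟨u, u1, u2, fun k => ?_, fun n j m hr x hx => ?_⟩
  · simpa using u3 k () true
  · have := u4 n () j m hr x hx
    exact ⟨by simpa using this.1.1 true, by simpa using this.2 true⟩

/-- A parameter containing a given time separation. -/
lemma mem_OO_of {T : ℝ} {x : XX d} (hx : |x.1 0 - x.2 0| ≤ T) : x ∈ OO d (max 1 (T + 1)) := by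
  have : T + 1 ≤ max 1 (T + 1) := le_max_right _ _
  exact lt_of_le_of_lt hx (by linarith)

lemma tl_memCloc {lam : ℝ} {r : ℕ} {A : Coeffs d} (hlam : 0 < lam)
    (hA : ParReg lam (r + 2) A) (n : ℕ) : MemCloc r (tl (d + r + 4) n A) := by
  refine ⟨fun j m hr x => ?_, fun j m hr => ?_, fun T hT => ?_⟩
  · obtain ⟨u, u1, u2, u3, u4⟩ := single_main (T := max 1 (|x.1 0 - x.2 0| + 1)) hlam
      (le_max_left _ _) hA
    exact (u4 n j m hr.le x (mem_OO_of le_rfl)).2.2 hr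
  · rw [continuous_iff_continuousAt]
    intro x
    obtain ⟨u, u1, u2, u3, u4⟩ := single_main (T := max 1 (|x.1 0 - x.2 0| + 1)) hlam
      (le_max_left _ _) hA
    exact (u4 n j m hr x (mem_OO_of le_rfl)).2.1
  · obtain ⟨u, u1, u2, u3, u4⟩ := single_main (T := max 1 (T + 1)) hlam (le_max_left _ _) hA
    refine ⟨∑' k, u (k + n), ?_⟩
    rintro y ⟨j, m, z, zb, hr, hz, rfl⟩
    exact (u4 n j m hr (z, zb) (mem_OO_of hz)).1

lemma MemCloc.md_sub {r : ℕ} {F G : Pt d → Pt d → ℝ} (hF : MemCloc r F) (hG : MemCloc r G) :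
    ∀ j m, pdeg j + pdeg m ≤ r →
      md j m (fun z zb => F z zb - G z zb) = fun x => md j m F x - md j m G x :=
  VarBPHZ.md_sub hF.1 hG.1

lemma MemCloc.sub {r : ℕ} {F G : Pt d → Pt d → ℝ} (hF : MemCloc r F) (hG : MemCloc r G) :
    MemCloc r (fun z zb => F z zb - G z zb) := by
  have key := hF.md_sub hG
  refine ⟨fun j m hr => ?_, fun j m hr => ?_, fun T hT => ?_⟩
  · have := key j m hr.le
    change Differentiable ℝ (md j m _)
    rw [this]
    exact Differentiable.sub (hF.1 j m hr) (hG.1 j m hr)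
  · have := key j m hr
    change Continuous (md j m _)
    rw [this]
    exact Continuous.sub (hF.2.1 j m hr) (hG.2.1 j m hr)
  · obtain ⟨a, ha⟩ := hF.2.2 T hT
    obtain ⟨b, hb⟩ := hG.2.2 T hT
    refine ⟨a + b, ?_⟩
    rintro y ⟨j, m, z, zb, hr, hz, rfl⟩
    have e : mderiv2 j m (fun z zb => F z zb - G z zb) z zb =
        mderiv2 j m F z zb - mderiv2 j m G z zb := congrFun (key j m hr) (z, zb)
    rw [e]
    exact (abs_sub _ _).trans (add_le_add (ha ⟨j, m, z, zb, hr, hz, rfl⟩)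
      (hb ⟨j, m, z, zb, hr, hz, rfl⟩))

lemma volterra_summable {lam : ℝ} {r : ℕ} {A : Coeffs d} (hlam : 0 < lam)
    (hA : ParReg lam (r + 2) A) (z zb : Pt d) :
    Summable fun k => volterra A (d + r + 4 + k) z zb := by
  obtain ⟨u, u1, u2, u3, u4⟩ := single_main (T := max 1 (|z 0 - zb 0| + 1)) hlam
    (le_max_left _ _) hA
  refine Summable.of_norm_bounded u1 fun k => ?_
  have := u3 k 0 0 (by simp [pdeg_zero]) (z, zb) (mem_OO_of le_rfl)
  rwa [md_zero] at this

lemma partial_eq {lam : ℝ} {r : ℕ} {A : Coeffs d} (hlam : 0 < lam)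
    (hA : ParReg lam (r + 2) A) (n : ℕ) :
    (fun z zb => ∑ k ∈ Finset.range n, volterra A (d + r + 4 + k) z zb) =
      fun z zb => tl (d + r + 4) 0 A z zb - tl (d + r + 4) n A z zb := by
  funext z zb
  have hs := volterra_summable hlam hA z zb
  have := hs.sum_add_tsum_nat_add n
  have e1 : tl (d + r + 4) 0 A z zb = ∑' k, volterra A (d + r + 4 + k) z zb := by
    simp [tl]
  have e2 : tl (d + r + 4) n A z zb = ∑' k, volterra A (d + r + 4 + (k + n)) z zb := by
    unfold tl
    refine tsum_congr fun k => ?_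
    rw [show d + r + 4 + n + k = d + r + 4 + (k + n) by omega]
  rw [e1, e2]
  linarith

lemma tl_zero (K : ℕ) (A : Coeffs d) :
    (fun z zb => ∑' k, volterra A (K + k) z zb) = tl K 0 A := by
  funext z zb; simp [tl]

lemma shift_summable {u : ℕ → ℝ} (hu : Summable u) (K : ℕ) : Summable fun k => u (k - K) := by
  rw [← summable_nat_add_iff K]
  simpa using hu

lemma clause_cont {lam : ℝ} {r : ℕ} {A : Coeffs d} (hlam : 0 < lam)
    (hA : ParReg lam (r + 2) A) {T ε : ℝ} (hT : 0 < T) (hε : 0 < ε) :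
    ∃ η : ℝ, 0 < η ∧ ∀ A' : Coeffs d, ParReg lam (r + 2) A' → coeffDist (r + 2) A A' ≤ η →
      MemCloc r (fun z zb => tl (d + r + 4) 0 A z zb - tl (d + r + 4) 0 A' z zb) ∧
      clocNorm r T (fun z zb => tl (d + r + 4) 0 A z zb - tl (d + r + 4) 0 A' z zb) ≤ ε := by
  obtain ⟨M, hM⟩ := mkDat (S := {A' : Coeffs d // ParReg lam (r + 2) A' ∧ coeffDist (r + 2) A A' ≤ 1})
    hA (fun s => s.1) (fun s => s.2.1) (fun s => s.2.2)
  obtain ⟨u, u1, u2, u3, u4⟩ := hM.main hlam (T := max 1 (T + 1)) (le_max_left _ _)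
  set c := ∑' k, u k with hc
  have hc0 : 0 ≤ c := tsum_nonneg u2
  refine ⟨min 1 (ε / (c + 1)), by positivity, fun A' hA' hd => ?_⟩
  have m1 := tl_memCloc hlam hA 0
  have m2 := tl_memCloc hlam hA' 0
  refine ⟨m1.sub m2, Real.sSup_le ?_ hε.le⟩
  rintro y ⟨j, m, z, zb, hr, hz, rfl⟩
  have e : mderiv2 j m (fun z zb => tl (d + r + 4) 0 A z zb - tl (d + r + 4) 0 A' z zb) z zb =
      md j m (tl (d + r + 4) 0 A) (z, zb) - md j m (tl (d + r + 4) 0 A') (z, zb) :=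
    congrFun (m1.md_sub m2 j m hr) (z, zb)
  have hb := (u4 0 ⟨A', hA', hd.trans (min_le_left _ _)⟩ j m hr (z, zb) (mem_OO_of hz)).1.2
  simp only [if_true, Bool.false_eq_true, if_false, add_zero] at hb
  rw [e]
  refine hb.trans ?_
  rw [Real.coe_toNNReal (coeffDist (r + 2) A A') (coeffNorm_nonneg _ _)]
  calc coeffDist (r + 2) A A' * c ≤ (ε / (c + 1)) * c :=
        mul_le_mul_of_nonneg_right (hd.trans (min_le_right _ _)) hc0
    _ = ε * (c / (c + 1)) := by ring
    _ ≤ ε * 1 := by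
        refine mul_le_mul_of_nonneg_left ?_ hε.le
        rw [div_le_one (by positivity)]; linarith
    _ = ε := mul_one _

end VarBPHZ

namespace VarBPHZ

/-- Convergence of the Volterra series.
If `(a,b,c)` satisfies the parabolicity–regularity assumption w.r.t. `ρ ≥ 2` and
`r = ρ − 2`, there is `K ∈ ℕ` depending only on `d` and `r` such that the sums
`Σ_{k ≥ K} sup |∂₁^{j₁}∂₂^{j₂}(Z*(−E)^{*k})|` (sup over `|t − s| ≤ T`) are finite for
all `T > 0` and `|j₁|_𝔰 + |j₂|_𝔰 ≤ r`; consequently the tail `Σ_{k ≥ K} Z*(−E)^{*k}`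
converges in `C_{loc,t}^r`, and the full series and all its parabolic derivatives of
order `≤ r` converge uniformly on compact subsets of `{t ≠ s}`.  Moreover the map
`𝐀_ρ ∋ (a,b,c) ↦ Σ_{k ≥ K} Z*(−E)^{*k} ∈ C_{loc,t}^r` is continuous. -/
theorem volterra_series_convergence (d : ℕ) (hd : 1 ≤ d) (lam : ℝ) (hlam : 0 < lam)
    (ρ : ℕ) (hρ : 2 ≤ ρ) :
    ∃ K : ℕ,
      (∀ A : Coeffs d, ParReg lam ρ A →
        (∀ T : ℝ, 0 < T → ∀ j1 j2 : Fin (d + 1) → ℕ, pdeg j1 + pdeg j2 ≤ ρ - 2 →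
          ∃ u : ℕ → ℝ, Summable u ∧
            ∀ k : ℕ, K ≤ k → ∀ z zb : Pt d, |z 0 - zb 0| ≤ T →
              |mderiv2 j1 j2 (volterra A k) z zb| ≤ u k) ∧
        MemCloc (ρ - 2) (fun z zb => ∑' k, volterra A (K + k) z zb) ∧
        (∀ T : ℝ, 0 < T → ∀ ε : ℝ, 0 < ε → ∃ N : ℕ, ∀ n : ℕ, N ≤ n →
          ∀ j1 j2 : Fin (d + 1) → ℕ, pdeg j1 + pdeg j2 ≤ ρ - 2 →
            ∀ z zb : Pt d, |z 0 - zb 0| ≤ T →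
              |mderiv2 j1 j2 (fun z' zb' => ∑' k, volterra A (K + k) z' zb') z zb -
                  mderiv2 j1 j2
                    (fun z' zb' => ∑ k ∈ Finset.range n, volterra A (K + k) z' zb') z zb| ≤ ε) ∧
        ∀ j1 j2 : Fin (d + 1) → ℕ, pdeg j1 + pdeg j2 ≤ ρ - 2 →
          ∀ Cpt : Set (Pt d × Pt d), IsCompact Cpt → (∀ p ∈ Cpt, p.1 0 ≠ p.2 0) →
            TendstoUniformlyOn
              (fun (n : ℕ) (p : Pt d × Pt d) =>
                ∑ k ∈ Finset.range n, mderiv2 j1 j2 (volterra A k) p.1 p.2)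
              (fun p => ∑' k, mderiv2 j1 j2 (volterra A k) p.1 p.2) atTop Cpt) ∧
      ∀ A : Coeffs d, ParReg lam ρ A → ∀ T : ℝ, 0 < T → ∀ ε : ℝ, 0 < ε →
        ∃ δ : ℝ, 0 < δ ∧ ∀ A' : Coeffs d, ParReg lam ρ A' → coeffDist ρ A A' ≤ δ →
          MemCloc (ρ - 2)
            (fun z zb => (∑' k, volterra A (K + k) z zb) - ∑' k, volterra A' (K + k) z zb) ∧
          clocNorm (ρ - 2) T
            (fun z zb => (∑' k, volterra A (K + k) z zb) - ∑' k, volterra A' (K + k) z zb) ≤ ε := by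
  obtain ⟨r, rfl⟩ : ∃ r, ρ = r + 2 := ⟨ρ - 2, by omega⟩
  simp only [Nat.add_sub_cancel]
  refine ⟨d + r + 4, fun A hA => ⟨?_, ?_, ?_, ?_⟩, fun A hA T hT ε hε => ?_⟩
  · intro T hT j m hr
    obtain ⟨u, u1, u2, u3, u4⟩ := single_main (T := max 1 (T + 1)) hlam (le_max_left _ _) hA
    refine ⟨fun k => u (k - (d + r + 4)), shift_summable u1 _, fun k hk z zb hz => ?_⟩
    have := u3 (k - (d + r + 4)) j m hr (z, zb) (mem_OO_of hz)
    rwa [Nat.add_sub_cancel' hk] at this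
  · rw [tl_zero]
    exact tl_memCloc hlam hA 0
  · intro T hT ε hε
    obtain ⟨u, u1, u2, u3, u4⟩ := single_main (T := max 1 (T + 1)) hlam (le_max_left _ _) hA
    have ht := (tendsto_sum_nat_add u).eventually (gt_mem_nhds hε)
    obtain ⟨N, hN⟩ := eventually_atTop.1 ht
    refine ⟨N, fun n hn j m hr z zb hz => ?_⟩
    have m1 := tl_memCloc hlam hA 0
    have m2 := tl_memCloc hlam hA n
    rw [tl_zero, partial_eq hlam hA n]
    have e : mderiv2 j m (fun z zb => tl (d + r + 4) 0 A z zb - tl (d + r + 4) n A z zb) z zb =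
        mderiv2 j m (tl (d + r + 4) 0 A) z zb - mderiv2 j m (tl (d + r + 4) n A) z zb :=
      congrFun (m1.md_sub m2 j m hr) (z, zb)
    rw [e, sub_sub_cancel]
    exact (u4 n j m hr (z, zb) (mem_OO_of hz)).1.trans (hN n hn).le
  · intro j m hr Cpt hCpt _
    obtain ⟨T, hT⟩ := hCpt.exists_bound_of_continuousOn (f := fun x : Pt d × Pt d => x.1 0 - x.2 0)
      (by fun_prop)
    obtain ⟨u, u1, u2, u3, u4⟩ := single_main (T := max 1 (T + 1)) hlam (le_max_left _ _) hA
    refine tendstoUniformlyOn_tsum_nat_eventually (shift_summable u1 (d + r + 4)) ?_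
    filter_upwards [eventually_ge_atTop (d + r + 4)] with k hk x hx
    have := u3 (k - (d + r + 4)) j m hr x (mem_OO_of (hT x hx))
    rwa [Nat.add_sub_cancel' hk] at this
  · obtain ⟨η, h1, h2⟩ := clause_cont hlam hA hT hε
    refine ⟨η, h1, fun A' hA' hd' => ?_⟩
    have := h2 A' hA' hd'
    rw [← tl_zero, ← tl_zero] at this
    exact this

end VarBPHZ
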